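/- Koebe's circle packing theorem: Let G=(V,E) be a finite simple graph that admits a proper drawing in the plane. Then there exist points z : V → ℝ² and radii r : V → (0,∞) such that for all distinct vertices u,v one has dist(z(u), z(v)) ≥ r(u) + r(v), with equality dist(z(u), z(v)) = r(u) + r(v) holding if and only if {u,v} ∈ E. (Equivalently, the closed discs of radius r(v) around z(v) have pairwise disjoint interiors and two of them are tangent exactly when the corresponding vertices are adjacent, i.e. G is the tangency graph of a circle packing.) -/

import Mathlib

/-!
Koebe's circle packing theorem.

A *proper drawing* of a finite simple graph `G` in the plane sends vertices
injectively to points of `ℝ²` (modelled as `EuclideanSpace ℝ (Fin 2)`) and each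
edge to a continuous injective curve between the points of its endpoints, such
that two distinct edge-curves meet only at images of common endpoint vertices,
and no edge-curve passes through the point of a vertex other than its
endpoints.

The conclusion produces centers `z v` and radii `r v > 0` such that the closed
discs have pairwise disjoint interiors (`r u + r v ≤ dist (z u) (z v)` for
`u ≠ v`), with tangency (`dist (z u) (z v) = r u + r v`) exactly at edges of
`G`, i.e. `G` is the tangency graph of a circle packing.
-/

/-- A proper drawing of a simple graph in the Euclidean plane. -/
structure ProperDrawing {V : Type*} (G : SimpleGraph V) where
  /-- position of each vertex -/
  pos : V → EuclideanSpace ℝ (Fin 2)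
  pos_inj : Function.Injective pos
  /-- the curve representing each edge, parametrized by `[0,1]` -/
  curve : Sym2 V → ℝ → EuclideanSpace ℝ (Fin 2)
  curve_cont : ∀ e ∈ G.edgeSet, ContinuousOn (curve e) (Set.Icc 0 1)
  curve_inj : ∀ e ∈ G.edgeSet, Set.InjOn (curve e) (Set.Icc 0 1)
  /-- each edge-curve runs between the positions of the two endpoints -/
  curve_ends : ∀ u v, G.Adj u v →
    (curve s(u, v) 0 = pos u ∧ curve s(u, v) 1 = pos v) ∨
    (curve s(u, v) 0 = pos v ∧ curve s(u, v) 1 = pos u)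
  /-- distinct edge-curves meet only at images of shared endpoint vertices -/
  curve_meet : ∀ e ∈ G.edgeSet, ∀ f ∈ G.edgeSet, e ≠ f →
    ∀ s ∈ Set.Icc (0 : ℝ) 1, ∀ t ∈ Set.Icc (0 : ℝ) 1,
      curve e s = curve f t → ∃ w, w ∈ e ∧ w ∈ f ∧ curve e s = pos w
  /-- an edge-curve passes through a vertex position only if that vertex is one
  of its endpoints -/
  curve_vertex : ∀ e ∈ G.edgeSet, ∀ t ∈ Set.Icc (0 : ℝ) 1, ∀ w,
    curve e t = pos w → w ∈ e


namespace Koebe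
set_option linter.unusedSectionVars false
set_option linter.unusedVariables false

/-- vertices of a set of oriented triangles -/
def vs (T : Finset (ℕ × ℕ × ℕ)) : Finset ℕ := T.image (fun t => t.1)

/-- adjacency -/
def Adj (T : Finset (ℕ × ℕ × ℕ)) (a b : ℕ) : Prop := ∃ c, (a, b, c) ∈ T

/-- combinatorial triangulated sphere -/
structure Sph (T : Finset (ℕ × ℕ × ℕ)) : Prop where
  rot : ∀ a b c, (a, b, c) ∈ T → (b, c, a) ∈ T
  ne : ∀ a b c, (a, b, c) ∈ T → a ≠ b
  uniq : ∀ a b c d, (a, b, c) ∈ T → (a, b, d) ∈ T → c = d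
  opp : ∀ a b c, (a, b, c) ∈ T → ∃ d, (b, a, d) ∈ T
  opp_ne : ∀ a b c, (a, b, c) ∈ T → (b, a, c) ∉ T
  link : ∀ (v : ℕ) (A : Set ℕ), (∀ a b, a ∈ A → (v, a, b) ∈ T → b ∈ A) →
    ∀ a b c d, a ∈ A → (v, a, b) ∈ T → (v, c, d) ∈ T → c ∈ A
  conn : ∀ A : Set ℕ, (∀ a b c, a ∈ A → (a, b, c) ∈ T → b ∈ A) →
    ∀ a b c a' b' c', a ∈ A → (a, b, c) ∈ T → (a', b', c') ∈ T → a' ∈ A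
  count : T.card + 12 = 6 * (vs T).card

theorem mem_vs {T : Finset (ℕ × ℕ × ℕ)} {v : ℕ} : v ∈ vs T ↔ ∃ b c, (v, b, c) ∈ T := by
  simp [vs]

namespace Sph
variable {T : Finset (ℕ × ℕ × ℕ)} (h : Sph T)
include h
theorem ne2 {a b c : ℕ} (ht : (a, b, c) ∈ T) : b ≠ c := h.ne _ _ _ (h.rot _ _ _ ht)
theorem ne3 {a b c : ℕ} (ht : (a, b, c) ∈ T) : c ≠ a :=
  h.ne _ _ _ (h.rot _ _ _ (h.rot _ _ _ ht))
theorem adj_symm {a b : ℕ} (ht : Adj T a b) : Adj T b a := by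
  obtain ⟨c, hc⟩ := ht
  exact h.opp _ _ _ hc
theorem adj_ne {a b : ℕ} (ht : Adj T a b) : a ≠ b := by
  obtain ⟨c, hc⟩ := ht
  exact h.ne _ _ _ hc
theorem adj_mem {a b : ℕ} (ht : Adj T a b) : a ∈ vs T := by
  obtain ⟨c, hc⟩ := ht
  exact mem_vs.2 ⟨_, _, hc⟩
theorem adj_mem' {a b : ℕ} (ht : Adj T a b) : b ∈ vs T := h.adj_mem (h.adj_symm ht)
theorem m1 {a b c : ℕ} (ht : (a, b, c) ∈ T) : a ∈ vs T := mem_vs.2 ⟨_, _, ht⟩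
theorem m2 {a b c : ℕ} (ht : (a, b, c) ∈ T) : b ∈ vs T := mem_vs.2 ⟨_, _, h.rot _ _ _ ht⟩
theorem m3 {a b c : ℕ} (ht : (a, b, c) ∈ T) : c ∈ vs T :=
  mem_vs.2 ⟨_, _, h.rot _ _ _ (h.rot _ _ _ ht)⟩
end Sph


/-- link cycle of the new vertex -/
def LL (x y p q b c : ℕ) : Prop :=
  (b = y ∧ c = p) ∨ (b = p ∧ c = x) ∨ (b = x ∧ c = q) ∨ (b = q ∧ c = y)

/-- triple contains both x and y -/
def BB (x y a b c : ℕ) : Prop := (a = x ∨ b = x ∨ c = x) ∧ (a = y ∨ b = y ∨ c = y)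

instance (x y a b c : ℕ) : Decidable (BB x y a b c) := by unfold BB; infer_instance

/-- edge subdivision -/
def sub (T : Finset (ℕ × ℕ × ℕ)) (x y p q m : ℕ) : Finset (ℕ × ℕ × ℕ) :=
  (T.filter (fun t => ¬ BB x y t.1 t.2.1 t.2.2)) ∪
  (({(y,p),(p,x),(x,q),(q,y)} : Finset (ℕ × ℕ)).image (fun t => (m, t.1, t.2)) ∪
  (({(y,p),(p,x),(x,q),(q,y)} : Finset (ℕ × ℕ)).image (fun t => (t.2, m, t.1)) ∪
  ({(y,p),(p,x),(x,q),(q,y)} : Finset (ℕ × ℕ)).image (fun t => (t.1, t.2, m))))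

theorem mem_sub {T : Finset (ℕ × ℕ × ℕ)} {x y p q m a b c : ℕ} :
    (a, b, c) ∈ sub T x y p q m ↔
    ((a,b,c) ∈ T ∧ ¬ BB x y a b c) ∨ (a = m ∧ LL x y p q b c) ∨ (b = m ∧ LL x y p q c a) ∨
      (c = m ∧ LL x y p q a b) := by
  simp only [sub, LL, Finset.mem_union, Finset.mem_filter, Finset.mem_image, Finset.mem_insert,
    Finset.mem_singleton, Prod.mk.injEq, Prod.exists]
  constructor
  · rintro (h | ⟨a', b', h, rfl, rfl, rfl⟩ | ⟨a', b', h, rfl, rfl, rfl⟩ | ⟨a', b', h, rfl, rfl, rfl⟩)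
    · exact Or.inl h
    · exact Or.inr (Or.inl ⟨rfl, h⟩)
    · exact Or.inr (Or.inr (Or.inl ⟨rfl, h⟩))
    · exact Or.inr (Or.inr (Or.inr ⟨rfl, h⟩))
  · rintro (h | ⟨rfl, h⟩ | ⟨rfl, h⟩ | ⟨rfl, h⟩)
    · exact Or.inl h
    · exact Or.inr (Or.inl ⟨_, _, h, rfl, rfl, rfl⟩)
    · exact Or.inr (Or.inr (Or.inl ⟨_, _, h, rfl, rfl, rfl⟩))
    · exact Or.inr (Or.inr (Or.inr ⟨_, _, h, rfl, rfl, rfl⟩))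

theorem BB_symm {x y a b c : ℕ} : BB x y a b c ↔ BB y x a b c := by unfold BB; tauto
theorem BB_rot {x y a b c : ℕ} (h : BB x y a b c) : BB x y b c a := by unfold BB at *; tauto
theorem LL_symm {x y p q a b : ℕ} : LL x y p q a b ↔ LL y x q p a b := by unfold LL; tauto

theorem sub_symm (T : Finset (ℕ × ℕ × ℕ)) (x y p q m : ℕ) : sub T x y p q m = sub T y x q p m := by
  ext ⟨a, b, c⟩
  rw [mem_sub, mem_sub, BB_symm, LL_symm, LL_symm (a := c), LL_symm (a := a)]

section
variable {T : Finset (ℕ × ℕ × ℕ)} (h : Sph T) {x y p q : ℕ}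
  (h1 : (x, y, p) ∈ T) (h2 : (y, x, q) ∈ T)
include h h1 h2

theorem sub_pq : p ≠ q := fun e => h.opp_ne _ _ _ h1 (e ▸ h2)

theorem BB_mem {a b c : ℕ} (ht : (a, b, c) ∈ T) : BB x y a b c ↔
    (a = x ∧ b = y ∧ c = p) ∨ (a = y ∧ b = p ∧ c = x) ∨ (a = p ∧ b = x ∧ c = y) ∨
    (a = y ∧ b = x ∧ c = q) ∨ (a = x ∧ b = q ∧ c = y) ∨ (a = q ∧ b = y ∧ c = x) := by
  have hr := h.rot _ _ _ ht
  have hrr := h.rot _ _ _ hr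
  have n1 := h.ne _ _ _ h1
  constructor
  · rintro ⟨h3, h4⟩
    rcases h3 with rfl | rfl | rfl <;> rcases h4 with rfl | rfl | rfl <;> try (exact absurd rfl n1)
    · have := h.uniq _ _ _ _ ht h1; exact Or.inl ⟨rfl, rfl, this⟩
    · have := h.uniq _ _ _ _ hrr h2; exact Or.inr (Or.inr (Or.inr (Or.inr (Or.inl ⟨rfl, this, rfl⟩))))
    · have := h.uniq _ _ _ _ ht h2; exact Or.inr (Or.inr (Or.inr (Or.inl ⟨rfl, rfl, this⟩)))
    · have := h.uniq _ _ _ _ hr h1; exact Or.inr (Or.inr (Or.inl ⟨this, rfl, rfl⟩))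
    · have := h.uniq _ _ _ _ hrr h1; exact Or.inr (Or.inl ⟨rfl, this, rfl⟩)
    · have := h.uniq _ _ _ _ hr h2; exact Or.inr (Or.inr (Or.inr (Or.inr (Or.inr ⟨this, rfl, rfl⟩))))
  · rintro (⟨rfl, rfl, rfl⟩ | ⟨rfl, rfl, rfl⟩ | ⟨rfl, rfl, rfl⟩ | ⟨rfl, rfl, rfl⟩ |
      ⟨rfl, rfl, rfl⟩ | ⟨rfl, rfl, rfl⟩) <;> simp [BB]

/-- neighbours outside -/
theorem LL_out {b c : ℕ} (hl : LL x y p q b c) : ∃ d, (c, b, d) ∈ T ∧ ¬ BB x y c b d := by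
  have e1 := h.rot _ _ _ h1
  have e2 := h.rot _ _ _ e1
  have e3 := h.rot _ _ _ h2
  have e4 := h.rot _ _ _ e3
  have n1 := h.ne _ _ _ h1
  have n2 := h.ne2 h1
  have n3 := h.ne3 h1
  have n4 := h.ne2 h2
  have n5 := h.ne3 h2
  unfold BB
  rcases hl with ⟨rfl, rfl⟩ | ⟨rfl, rfl⟩ | ⟨rfl, rfl⟩ | ⟨rfl, rfl⟩
  · obtain ⟨d, hd⟩ := h.opp _ _ _ e1
    have : d ≠ x := by rintro rfl; exact h.opp_ne _ _ _ e1 hd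
    exact ⟨d, hd, by tauto⟩
  · obtain ⟨d, hd⟩ := h.opp _ _ _ e2
    have : d ≠ y := by rintro rfl; exact h.opp_ne _ _ _ e2 hd
    exact ⟨d, hd, by tauto⟩
  · obtain ⟨d, hd⟩ := h.opp _ _ _ e3
    have : d ≠ y := by rintro rfl; exact h.opp_ne _ _ _ e3 hd
    exact ⟨d, hd, by tauto⟩
  · obtain ⟨d, hd⟩ := h.opp _ _ _ e4
    have : d ≠ x := by rintro rfl; exact h.opp_ne _ _ _ e4 hd
    exact ⟨d, hd, by tauto⟩

theorem LL_in {b c : ℕ} (hl : LL x y p q b c) : ∃ d, (b, c, d) ∈ T ∧ BB x y b c d := by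
  have e1 := h.rot _ _ _ h1
  have e2 := h.rot _ _ _ e1
  have e3 := h.rot _ _ _ h2
  have e4 := h.rot _ _ _ e3
  unfold BB
  rcases hl with ⟨rfl, rfl⟩ | ⟨rfl, rfl⟩ | ⟨rfl, rfl⟩ | ⟨rfl, rfl⟩
  · exact ⟨_, e1, by tauto⟩
  · exact ⟨_, e2, by tauto⟩
  · exact ⟨_, e3, by tauto⟩
  · exact ⟨_, e4, by tauto⟩

theorem LL_fun {a b c d : ℕ} (hl : LL x y p q a b) (hl' : LL x y p q c d) :
    (a = c → b = d) ∧ (b = d → a = c) ∧ (a = d → b ≠ c) := by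
  have n1 := h.ne _ _ _ h1
  have n2 := h.ne2 h1
  have n3 := h.ne3 h1
  have n4 := h.ne2 h2
  have n5 := h.ne3 h2
  have n6 := sub_pq h h1 h2
  rcases hl with ⟨rfl, rfl⟩ | ⟨rfl, rfl⟩ | ⟨rfl, rfl⟩ | ⟨rfl, rfl⟩ <;>
  rcases hl' with ⟨rfl, rfl⟩ | ⟨rfl, rfl⟩ | ⟨rfl, rfl⟩ | ⟨rfl, rfl⟩ <;> tauto

theorem LL_mem {a b : ℕ} (hl : LL x y p q a b) : a ∈ vs T ∧ b ∈ vs T := by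
  obtain ⟨d, hd, -⟩ := LL_in h h1 h2 hl
  exact ⟨h.m1 hd, h.m2 hd⟩

theorem BB_LL {a b c : ℕ} (ht : (a, b, c) ∈ T) (hb : BB x y a b c) :
    LL x y p q a b ∨ (a = x ∧ b = y) ∨ (a = y ∧ b = x) := by
  rw [BB_mem h h1 h2 ht] at hb
  unfold LL
  tauto

theorem BB_card : (T.filter (fun t => BB x y t.1 t.2.1 t.2.2)).card = 6 := by
  have n1 := h.ne _ _ _ h1
  have n2 := h.ne2 h1
  have n3 := h.ne3 h1
  have n4 := h.ne2 h2
  have n5 := h.ne3 h2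
  have n6 := sub_pq h h1 h2
  have e1 := h.rot _ _ _ h1
  have e2 := h.rot _ _ _ e1
  have e3 := h.rot _ _ _ h2
  have e4 := h.rot _ _ _ e3
  have hB : T.filter (fun t => BB x y t.1 t.2.1 t.2.2) =
      {(x,y,p),(y,p,x),(p,x,y),(y,x,q),(x,q,y),(q,y,x)} := by
    ext ⟨a, b, c⟩
    simp only [Finset.mem_filter, Finset.mem_insert, Finset.mem_singleton, Prod.mk.injEq]
    constructor
    · rintro ⟨ht, hb⟩
      exact (BB_mem h h1 h2 ht).1 hb
    · intro hh
      have ht : (a, b, c) ∈ T := by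
        rcases hh with ⟨rfl, rfl, rfl⟩ | ⟨rfl, rfl, rfl⟩ | ⟨rfl, rfl, rfl⟩ | ⟨rfl, rfl, rfl⟩ |
          ⟨rfl, rfl, rfl⟩ | ⟨rfl, rfl, rfl⟩ <;> assumption
      exact ⟨ht, (BB_mem h h1 h2 ht).2 hh⟩
  rw [hB, Finset.card_insert_of_notMem, Finset.card_insert_of_notMem,
    Finset.card_insert_of_notMem, Finset.card_insert_of_notMem,
      Finset.card_insert_of_notMem, Finset.card_singleton] <;>
  · simp only [Finset.mem_insert, Finset.mem_singleton, Prod.mk.injEq]; tauto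

variable {m : ℕ} (hm : m ∉ vs T)
include hm

theorem sub_vs : vs (sub T x y p q m) = insert m (vs T) := by
  ext v
  rw [Finset.mem_insert, mem_vs]
  constructor
  · rintro ⟨b, c, hbc⟩
    rw [mem_sub] at hbc
    rcases hbc with hbc | ⟨rfl, _⟩ | ⟨rfl, hl⟩ | ⟨rfl, hl⟩
    · right; exact h.m1 hbc.1
    · exact Or.inl rfl
    · exact Or.inr (LL_mem h h1 h2 hl).2
    · exact Or.inr (LL_mem h h1 h2 hl).1
  · rintro (rfl | hv)
    · exact ⟨y, p, by rw [mem_sub]; unfold LL; tauto⟩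
    · obtain ⟨b, c, hbc⟩ := mem_vs.1 hv
      by_cases hB : BB x y v b c
      · rw [BB_mem h h1 h2 hbc] at hB
        have : ∃ w, LL x y p q v w := by
          rcases hB with hB | hB | hB | hB | hB | hB <;> rw [hB.1]
          exacts [⟨q, by simp [LL]⟩, ⟨p, by simp [LL]⟩, ⟨x, by simp [LL]⟩, ⟨p, by simp [LL]⟩,
            ⟨q, by simp [LL]⟩, ⟨y, by simp [LL]⟩]
        obtain ⟨w, hw⟩ := this
        exact ⟨w, m, by rw [mem_sub]; tauto⟩
      · exact ⟨b, c, by rw [mem_sub]; tauto⟩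

theorem sub_card : (sub T x y p q m).card = T.card + 6 := by
  have n1 := h.ne _ _ _ h1
  have n2 := h.ne2 h1
  have n3 := h.ne3 h1
  have n4 := h.ne2 h2
  have n5 := h.ne3 h2
  have n6 := sub_pq h h1 h2
  have e1 := h.rot _ _ _ h1
  have e2 := h.rot _ _ _ e1
  have e3 := h.rot _ _ _ h2
  have e4 := h.rot _ _ _ e3
  have hmL : ∀ a b, (a, b) ∈ ({(y,p),(p,x),(x,q),(q,y)} : Finset (ℕ × ℕ)) → a ≠ m ∧ b ≠ m := by
    intro a b hab
    have : LL x y p q a b := by simpa [LL] using hab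
    have := LL_mem h h1 h2 this
    constructor
    · rintro rfl; exact hm this.1
    · rintro rfl; exact hm this.2
  have hT1 : ∀ a b c, (a, b, c) ∈ T → a ≠ m := by rintro a b c e rfl; exact hm (h.m1 e)
  have hT2 : ∀ a b c, (a, b, c) ∈ T → b ≠ m := by rintro a b c e rfl; exact hm (h.m2 e)
  have hT3 : ∀ a b c, (a, b, c) ∈ T → c ≠ m := by rintro a b c e rfl; exact hm (h.m3 e)
  have hL4 : ({(y,p),(p,x),(x,q),(q,y)} : Finset (ℕ × ℕ)).card = 4 := by
    rw [Finset.card_insert_of_notMem, Finset.card_insert_of_notMem,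
      Finset.card_insert_of_notMem, Finset.card_singleton] <;>
    · simp only [Finset.mem_insert, Finset.mem_singleton, Prod.mk.injEq]; tauto
  have hB6 := BB_card h h1 h2
  have hsum := Finset.card_filter_add_card_filter_not (s := T) (fun t => BB x y t.1 t.2.1 t.2.2)
  have key : ∀ L : Finset (ℕ × ℕ), (∀ a b, (a, b) ∈ L → a ≠ m ∧ b ≠ m) → L.card = 4 →
      ((T.filter (fun t => ¬ BB x y t.1 t.2.1 t.2.2)) ∪
      (L.image (fun t => (m, t.1, t.2)) ∪
      (L.image (fun t => (t.2, m, t.1)) ∪ L.image (fun t => (t.1, t.2, m))))).card = T.card + 6 := by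
    intro L hmL hL4
    rw [Finset.card_union_of_disjoint, Finset.card_union_of_disjoint,
      Finset.card_union_of_disjoint, Finset.card_image_of_injective,
      Finset.card_image_of_injective, Finset.card_image_of_injective]
    · omega
    · rintro ⟨a, b⟩ ⟨c, d⟩ he
      simpa using he
    · rintro ⟨a, b⟩ ⟨c, d⟩ he
      simp at he
      simp [he]
    · rintro ⟨a, b⟩ ⟨c, d⟩ he
      simpa using he
    · rw [Finset.disjoint_left]
      rintro ⟨a, b, c⟩
      simp only [Finset.mem_image, Prod.mk.injEq, Prod.exists]
      rintro ⟨a', b', h3, h4, h5, h6⟩ ⟨a2, b2, h7, h8, h9, h10⟩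
      exact (hmL _ _ h7).2 (h9.trans h5.symm)
    · rw [Finset.disjoint_left]
      rintro ⟨a, b, c⟩
      simp only [Finset.mem_union, Finset.mem_image, Prod.mk.injEq, Prod.exists]
      rintro ⟨a', b', h3, h4, h5, h6⟩ (⟨a2, b2, h7, h8, h9, h10⟩ | ⟨a2, b2, h7, h8, h9, h10⟩)
      · exact (hmL _ _ h7).2 (h8.trans h4.symm)
      · exact (hmL _ _ h7).1 (h8.trans h4.symm)
    · rw [Finset.disjoint_left]
      rintro ⟨a, b, c⟩
      simp only [Finset.mem_union, Finset.mem_image, Prod.mk.injEq, Prod.exists, Finset.mem_filter]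
      rintro ⟨h0, -⟩ (⟨a2, b2, h7, h8, h9, h10⟩ | ⟨a2, b2, h7, h8, h9, h10⟩ | ⟨a2, b2, h7, h8, h9, h10⟩)
      · exact hT1 _ _ _ h0 h8.symm
      · exact hT2 _ _ _ h0 h9.symm
      · exact hT3 _ _ _ h0 h10.symm
  exact key _ hmL hL4

theorem sub_link_aux {A : Set ℕ}
    (hA : ∀ a b, a ∈ A → (x, a, b) ∈ sub T x y p q m → b ∈ A) {a b c d : ℕ} (ha : a ∈ A)
    (hb : (x, a, b) ∈ sub T x y p q m) (hc : (x, c, d) ∈ sub T x y p q m) : c ∈ A := by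
  have n1 := h.ne _ _ _ h1
  have n2 := h.ne2 h1
  have n3 := h.ne3 h1
  have n4 := h.ne2 h2
  have n5 := h.ne3 h2
  have hmx : m ≠ x := by rintro rfl; exact hm (h.m1 h1)
  have e3 := h.rot _ _ _ h2
  have n6 := sub_pq h h1 h2
  have hT2 : ∀ a b c, (a, b, c) ∈ T → b ≠ m := by rintro a b c e rfl; exact hm (h.m2 e)
  have i1 : (x, m, p) ∈ sub T x y p q m := by rw [mem_sub]; simp [LL]
  have i2 : (x, q, m) ∈ sub T x y p q m := by rw [mem_sub]; simp [LL]
  have cases : ∀ a b, (x, a, b) ∈ sub T x y p q m ↔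
      ((x, a, b) ∈ T ∧ a ≠ y ∧ b ≠ y) ∨ (a = m ∧ b = p) ∨ (a = q ∧ b = m) := by
    intro a b
    rw [mem_sub]
    have : BB x y x a b ↔ a = y ∨ b = y := by unfold BB; tauto
    rw [this]
    have : ∀ a, LL x y p q a x ↔ a = p := by intro a; unfold LL; tauto
    rw [this]
    have : ∀ a, LL x y p q x a ↔ a = q := by intro a; unfold LL; tauto
    rw [this]
    constructor
    · rintro (h3 | h3 | h3 | h3)
      · exact Or.inl ⟨h3.1, not_or.1 h3.2⟩
      · exact absurd h3.1.symm hmx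
      · exact Or.inr (Or.inl h3)
      · exact Or.inr (Or.inr h3.symm)
    · rintro (h3 | h3 | h3)
      · exact Or.inl ⟨h3.1, not_or.2 h3.2⟩
      · exact Or.inr (Or.inr (Or.inl h3))
      · exact Or.inr (Or.inr (Or.inr h3.symm))
  have key := h.link x {a | (a ≠ m ∧ a ≠ y ∧ a ∈ A) ∨ (a = y ∧ m ∈ A)} (by
    intro a b ha hb0
    rcases ha with ⟨h3, h4, h5⟩ | ⟨rfl, h3⟩
    · by_cases hy : b = y
      · subst hy
        right
        refine ⟨rfl, hA q m ?_ i2⟩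
        have := h.uniq _ _ _ _ (h.rot _ _ _ (h.rot _ _ _ hb0)) h2
        rwa [← this]
      · left
        exact ⟨by rintro rfl; exact hm (h.m3 hb0), hy, hA a b h5 ((cases _ _).2 (Or.inl ⟨hb0, h4, hy⟩))⟩
    · left
      have := h.uniq _ _ _ _ hb0 h1
      subst this
      exact ⟨by rintro rfl; exact hm (h.m3 hb0), n2.symm, hA _ _ h3 i1⟩)
  have hmA : m ∈ A := by
    have : y ∈ {a | (a ≠ m ∧ a ≠ y ∧ a ∈ A) ∨ (a = y ∧ m ∈ A)} := by
      rcases (cases _ _).1 hb with ⟨h3, h4, h5⟩ | ⟨h3, h4⟩ | ⟨rfl, h4⟩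
      · exact key a b y p (Or.inl ⟨hT2 _ _ _ h3, h4, ha⟩) h3 h1
      · exact Or.inr ⟨rfl, h3 ▸ ha⟩
      · exact Or.inr ⟨rfl, hA _ _ ha i2⟩
    rcases this with h6 | h6
    · exact absurd rfl h6.2.1
    · exact h6.2
  have all : ∀ c d, (x, c, d) ∈ T → c ∈ {a | (a ≠ m ∧ a ≠ y ∧ a ∈ A) ∨ (a = y ∧ m ∈ A)} :=
    fun c d hcd => key y p c d (Or.inr ⟨rfl, hmA⟩) h1 hcd
  rcases (cases _ _).1 hc with ⟨h3, h4, h5⟩ | ⟨h3, h4⟩ | ⟨rfl, h4⟩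
  · rcases all _ _ h3 with h6 | h6
    · exact h6.2.2
    · exact absurd h6.1 h4
  · exact h3 ▸ hmA
  · rcases all _ _ e3 with h6 | h6
    · exact h6.2.2
    · exact absurd h6.1 n5

theorem sub_link_aux2 {A : Set ℕ}
    (hA : ∀ a b, a ∈ A → (p, a, b) ∈ sub T x y p q m → b ∈ A) {a b c d : ℕ} (ha : a ∈ A)
    (hb : (p, a, b) ∈ sub T x y p q m) (hc : (p, c, d) ∈ sub T x y p q m) : c ∈ A := by
  have n1 := h.ne _ _ _ h1
  have n2 := h.ne2 h1
  have n3 := h.ne3 h1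
  have hmp : m ≠ p := by rintro rfl; exact hm (h.m3 h1)
  have e1 := h.rot _ _ _ h1
  have e2 := h.rot _ _ _ e1
  obtain ⟨y', hy'⟩ := h.opp _ _ _ e1
  have n6 := sub_pq h h1 h2
  have i1 : (p, x, m) ∈ sub T x y p q m := by rw [mem_sub]; simp [LL]
  have i2 : (p, m, y) ∈ sub T x y p q m := by rw [mem_sub]; simp [LL]
  have cases : ∀ a b, (p, a, b) ∈ sub T x y p q m ↔
      ((p, a, b) ∈ T ∧ ¬ (a = x ∧ b = y)) ∨ (a = m ∧ b = y) ∨ (a = x ∧ b = m) := by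
    intro a b
    rw [mem_sub]
    have : ∀ a, LL x y p q a p ↔ a = y := by intro a; unfold LL; tauto
    rw [this]
    have : ∀ a, LL x y p q p a ↔ a = x := by intro a; unfold LL; tauto
    rw [this]
    have : (p, a, b) ∈ T → (BB x y p a b ↔ (a = x ∧ b = y)) := by
      intro ht
      unfold BB
      constructor
      · rintro ⟨h3 | rfl | rfl, h4⟩
        · exact absurd h3 n3
        · rcases h4 with h4 | h4 | h4
          · exact absurd h4.symm n2
          · exact absurd h4 n1
          · exact ⟨rfl, h4⟩
        · rcases h4 with h4 | rfl | h4
          · exact absurd h4.symm n2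
          · exact absurd (h.rot _ _ _ e2) (h.opp_ne _ _ _ (h.rot _ _ _ (ht)))
          · exact absurd h4 n1
      · tauto
    have k1 : m = p ↔ False := iff_of_false hmp id
    have k2 : p = m ↔ False := iff_of_false hmp.symm id
    simp only [k2, false_and, false_or]
    tauto
  have key := h.link p A (by
    intro a b ha hb
    by_cases hxy : a = x ∧ b = y
    · rw [hxy.2]; exact hA _ _ (hA _ _ (hxy.1 ▸ ha) i1) i2
    · exact hA a b ha ((cases _ _).2 (Or.inl ⟨hb, hxy⟩)))
  have hxA : x ∈ A := by
    rcases (cases _ _).1 hb with ⟨h3, h4⟩ | ⟨rfl, h4⟩ | ⟨rfl, h4⟩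
    · exact key _ _ _ _ ha h3 e2
    · exact key _ _ _ _ (hA _ _ ha i2) hy' e2
    · exact ha
  rcases (cases _ _).1 hc with ⟨h3, h4⟩ | ⟨rfl, h4⟩ | ⟨rfl, h4⟩
  · exact key _ _ _ _ hxA e2 h3
  · exact hA _ _ hxA i1
  · exact hxA

end
section
variable {T : Finset (ℕ × ℕ × ℕ)} (h : Sph T) {x y p q : ℕ}
  (h1 : (x, y, p) ∈ T) (h2 : (y, x, q) ∈ T) {m : ℕ} (hm : m ∉ vs T)
include h h1 h2 hm

theorem sub_link (v : ℕ) (A : Set ℕ)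
    (hA : ∀ a b, a ∈ A → (v, a, b) ∈ sub T x y p q m → b ∈ A) (a b c d : ℕ) (ha : a ∈ A)
    (hb : (v, a, b) ∈ sub T x y p q m) (hc : (v, c, d) ∈ sub T x y p q m) : c ∈ A := by
  by_cases hx : v = x
  · subst hx; exact sub_link_aux h h1 h2 hm hA ha hb hc
  by_cases hy : v = y
  · subst hy
    rw [sub_symm] at hb hc hA
    exact sub_link_aux h h2 h1 hm hA ha hb hc
  by_cases hp : v = p
  · subst hp; exact sub_link_aux2 h h1 h2 hm hA ha hb hc
  by_cases hq : v = q
  · subst hq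
    rw [sub_symm] at hb hc hA
    exact sub_link_aux2 h h2 h1 hm hA ha hb hc
  by_cases hvm : v = m
  · subst hvm
    have hvT : ∀ a b, (v, a, b) ∉ T := fun a b e => hm (h.m1 e)
    have cases : ∀ a b, (v, a, b) ∈ sub T x y p q v ↔ LL x y p q a b := by
      intro a b
      rw [mem_sub]
      constructor
      · rintro (h3 | h3 | h3 | h3)
        · exact absurd h3.1 (hvT _ _)
        · exact h3.2
        · exact absurd (LL_mem h h1 h2 h3.2).2 hm
        · exact absurd (LL_mem h h1 h2 h3.2).1 hm
      · intro h3; exact Or.inr (Or.inl ⟨rfl, h3⟩)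
    simp only [cases] at hA hb hc
    have lyp : y ∈ A → p ∈ A := fun e => hA _ _ e (by unfold LL; tauto)
    have lpx : p ∈ A → x ∈ A := fun e => hA _ _ e (by unfold LL; tauto)
    have lxq : x ∈ A → q ∈ A := fun e => hA _ _ e (by unfold LL; tauto)
    have lqy : q ∈ A → y ∈ A := fun e => hA _ _ e (by unfold LL; tauto)
    rcases hb with ⟨rfl, rfl⟩ | ⟨rfl, rfl⟩ | ⟨rfl, rfl⟩ | ⟨rfl, rfl⟩ <;>
    rcases hc with ⟨rfl, rfl⟩ | ⟨rfl, rfl⟩ | ⟨rfl, rfl⟩ | ⟨rfl, rfl⟩ <;> tauto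
  · have cases : ∀ a b, (v, a, b) ∈ sub T x y p q m ↔ (v, a, b) ∈ T := by
      intro a b
      rw [mem_sub]
      constructor
      · rintro (h3 | h3 | h3 | h3)
        · exact h3.1
        · exact absurd h3.1 hvm
        · exfalso; have := h3.2; unfold LL at this; tauto
        · exfalso; have := h3.2; unfold LL at this; tauto
      · intro h3
        refine Or.inl ⟨h3, fun hB => ?_⟩
        rw [BB_mem h h1 h2 h3] at hB
        rcases hB with e | e | e | e | e | e
        exacts [hx e.1, hy e.1, hp e.1, hy e.1, hx e.1, hq e.1]
    simp only [cases] at hA hb hc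
    exact h.link v A hA a b c d ha hb hc

theorem sub_sph : Sph (sub T x y p q m) := by
  have hT1 : ∀ a b c, (a, b, c) ∈ T → a ≠ m := by rintro a b c e rfl; exact hm (h.m1 e)
  have hT2 : ∀ a b c, (a, b, c) ∈ T → b ≠ m := by rintro a b c e rfl; exact hm (h.m2 e)
  have hT3 : ∀ a b c, (a, b, c) ∈ T → c ≠ m := by rintro a b c e rfl; exact hm (h.m3 e)
  have hLm1 : ∀ a b, LL x y p q a b → a ≠ m := by
    rintro a b e rfl; exact hm (LL_mem h h1 h2 e).1
  have hLm2 : ∀ a b, LL x y p q a b → b ≠ m := by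
    rintro a b e rfl; exact hm (LL_mem h h1 h2 e).2
  have hLne : ∀ a b, LL x y p q a b → a ≠ b := by
    intro a b e
    obtain ⟨d, hd, -⟩ := LL_in h h1 h2 e
    exact h.ne _ _ _ hd
  have hLT : ∀ a b c, LL x y p q a b → (a, b, c) ∈ T → BB x y a b c := by
    intro a b c hl ht
    obtain ⟨d, hd, hb⟩ := LL_in h h1 h2 hl
    rwa [h.uniq _ _ _ _ ht hd]
  have hLs : ∀ a b, LL x y p q a b → ∃ c, LL x y p q b c := by
    intro a b hl
    rcases hl with ⟨rfl, rfl⟩ | ⟨rfl, rfl⟩ | ⟨rfl, rfl⟩ | ⟨rfl, rfl⟩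
    exacts [⟨x, by unfold LL; tauto⟩, ⟨q, by unfold LL; tauto⟩, ⟨y, by unfold LL; tauto⟩,
      ⟨p, by unfold LL; tauto⟩]
  have hLp : ∀ a b, LL x y p q a b → ∃ c, LL x y p q c a := by
    intro a b hl
    rcases hl with ⟨rfl, rfl⟩ | ⟨rfl, rfl⟩ | ⟨rfl, rfl⟩ | ⟨rfl, rfl⟩
    exacts [⟨q, by unfold LL; tauto⟩, ⟨y, by unfold LL; tauto⟩, ⟨p, by unfold LL; tauto⟩,
      ⟨x, by unfold LL; tauto⟩]
  constructor
  · intro a b c hab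
    rw [mem_sub] at hab ⊢
    rcases hab with hab | hab | hab | hab
    · exact Or.inl ⟨h.rot _ _ _ hab.1, fun e => hab.2 (BB_rot (BB_rot e))⟩
    · tauto
    · tauto
    · tauto
  · intro a b c hab
    rw [mem_sub] at hab
    rcases hab with hab | ⟨rfl, hl⟩ | ⟨rfl, hl⟩ | ⟨rfl, hl⟩
    · exact h.ne _ _ _ hab.1
    · exact (hLm1 _ _ hl).symm
    · exact hLm2 _ _ hl
    · exact hLne _ _ hl
  · intro a b c d hc hd
    rw [mem_sub] at hc hd
    rcases hc with hc | ⟨rfl, hl⟩ | ⟨rfl, hl⟩ | ⟨rfl, hl⟩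
    · rcases hd with hd | ⟨rfl, hl'⟩ | ⟨rfl, hl'⟩ | ⟨rfl, hl'⟩
      · exact h.uniq _ _ _ _ hc.1 hd.1
      · exact absurd rfl (hT1 _ _ _ hc.1)
      · exact absurd rfl (hT2 _ _ _ hc.1)
      · exact absurd (hLT _ _ _ hl' hc.1) hc.2
    · rcases hd with hd | ⟨-, hl'⟩ | ⟨rfl, hl'⟩ | ⟨rfl, hl'⟩
      · exact absurd rfl (hT1 _ _ _ hd.1)
      · exact (LL_fun h h1 h2 hl hl').1 rfl
      · exact absurd rfl (hLm1 _ _ hl)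
      · exact absurd rfl (hLm1 _ _ hl')
    · rcases hd with hd | ⟨rfl, hl'⟩ | ⟨-, hl'⟩ | ⟨rfl, hl'⟩
      · exact absurd rfl (hT2 _ _ _ hd.1)
      · exact absurd rfl (hLm2 _ _ hl)
      · exact (LL_fun h h1 h2 hl hl').2.1 rfl
      · exact absurd rfl (hLm2 _ _ hl')
    · rcases hd with hd | ⟨rfl, hl'⟩ | ⟨rfl, hl'⟩ | ⟨rfl, hl'⟩
      · exact absurd (hLT _ _ _ hl hd.1) hd.2
      · exact absurd rfl (hLm1 _ _ hl)
      · exact absurd rfl (hLm2 _ _ hl)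
      · rfl
  · intro a b c hc
    simp only [mem_sub] at hc ⊢
    rcases hc with hc | ⟨rfl, hl⟩ | ⟨rfl, hl⟩ | ⟨rfl, hl⟩
    · obtain ⟨d, hd⟩ := h.opp _ _ _ hc.1
      by_cases hB : BB x y b a d
      · rcases BB_LL h h1 h2 hd hB with hl | hl | hl
        · exact ⟨m, by tauto⟩
        · exact absurd (by unfold BB; tauto) hc.2
        · exact absurd (by unfold BB; tauto) hc.2
      · exact ⟨d, by tauto⟩
    · obtain ⟨d, hd⟩ := hLp _ _ hl
      exact ⟨d, by tauto⟩
    · obtain ⟨d, hd⟩ := hLs _ _ hl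
      exact ⟨d, by tauto⟩
    · obtain ⟨d, hd, hB⟩ := LL_out h h1 h2 hl
      exact ⟨d, by tauto⟩
  · intro a b c hc hd
    rw [mem_sub] at hc hd
    rcases hc with hc | ⟨rfl, hl⟩ | ⟨rfl, hl⟩ | ⟨rfl, hl⟩
    · rcases hd with hd | ⟨rfl, hl'⟩ | ⟨rfl, hl'⟩ | ⟨rfl, hl'⟩
      · exact h.opp_ne _ _ _ hc.1 hd.1
      · exact absurd rfl (hT2 _ _ _ hc.1)
      · exact absurd rfl (hT1 _ _ _ hc.1)
      · exact absurd rfl (hT3 _ _ _ hc.1)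
    · rcases hd with hd | ⟨rfl, hl'⟩ | ⟨-, hl'⟩ | ⟨rfl, hl'⟩
      · exact absurd rfl (hT2 _ _ _ hd.1)
      · exact absurd rfl (hLm1 _ _ hl)
      · exact (LL_fun h h1 h2 hl hl').2.2 rfl rfl
      · exact absurd rfl (hLm2 _ _ hl)
    · rcases hd with hd | ⟨-, hl'⟩ | ⟨rfl, hl'⟩ | ⟨rfl, hl'⟩
      · exact absurd rfl (hT1 _ _ _ hd.1)
      · exact (LL_fun h h1 h2 hl hl').2.2 rfl rfl
      · exact absurd rfl (hLm2 _ _ hl)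
      · exact absurd rfl (hLm1 _ _ hl)
    · rcases hd with hd | ⟨rfl, hl'⟩ | ⟨rfl, hl'⟩ | ⟨-, hl'⟩
      · exact absurd rfl (hT3 _ _ _ hd.1)
      · exact absurd rfl (hLm2 _ _ hl)
      · exact absurd rfl (hLm1 _ _ hl)
      · exact (LL_fun h h1 h2 hl hl').2.2 rfl rfl
  · exact sub_link h h1 h2 hm
  · intro A hA a b c a' b' c' ha hb hc
    have hA1 : ∀ b c, LL x y p q b c → m ∈ A → b ∈ A := fun b c hl hx =>
      hA m b c hx (by rw [mem_sub]; tauto)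
    have hA2 : ∀ b c, LL x y p q b c → c ∈ A → m ∈ A := fun b c hl hx =>
      hA c m b hx (by rw [mem_sub]; tauto)
    have hA3 : ∀ b c, LL x y p q b c → b ∈ A → c ∈ A := fun b c hl hx =>
      hA b c m hx (by rw [mem_sub]; tauto)
    have lyp : LL x y p q y p := by unfold LL; tauto
    have lpx : LL x y p q p x := by unfold LL; tauto
    have lxq : LL x y p q x q := by unfold LL; tauto
    have lqy : LL x y p q q y := by unfold LL; tauto
    have hcl : ∀ a b c, a ∈ A → (a, b, c) ∈ T → b ∈ A := by
      intro a b c ha hb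
      by_cases hB : BB x y a b c
      · rcases BB_LL h h1 h2 hb hB with hl | ⟨rfl, rfl⟩ | ⟨rfl, rfl⟩
        · exact hA3 _ _ hl ha
        · exact hA3 _ _ lqy (hA3 _ _ lxq ha)
        · exact hA3 _ _ lpx (hA3 _ _ lyp ha)
      · exact hA a b c ha (by rw [mem_sub]; tauto)
    have key := h.conn A hcl
    have hx : x ∈ A := by
      rw [mem_sub] at hb
      rcases hb with hb | ⟨rfl, hl⟩ | ⟨rfl, hl⟩ | ⟨rfl, hl⟩
      · exact key _ _ _ _ _ _ ha hb.1 h1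
      · exact hA1 _ _ lxq ha
      · exact hA1 _ _ lxq (hA2 _ _ hl ha)
      · exact hA1 _ _ lxq (hA2 _ _ hl (hA3 _ _ hl ha))
    have hmA : m ∈ A := hA2 _ _ lpx hx
    rw [mem_sub] at hc
    rcases hc with hc | ⟨rfl, hl⟩ | ⟨rfl, hl⟩ | ⟨rfl, hl⟩
    · exact key _ _ _ _ _ _ hx h1 hc.1
    · exact hmA
    · exact hA3 _ _ hl (hA1 _ _ hl hmA)
    · exact hA1 _ _ hl hmA
  · rw [sub_card h h1 h2 hm, sub_vs h h1 h2 hm, Finset.card_insert_of_notMem hm]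
    have := h.count
    omega

end
end Koebe


namespace Koebe
set_option linter.unusedSectionVars false
set_option linter.unusedVariables false

/-- merge y into x -/
def mg (x y a : ℕ) : ℕ := if a = y then x else a

theorem mg_eq {x y a b : ℕ} : mg x y a = mg x y b ↔ a = b ∨ (a = x ∧ b = y) ∨ (a = y ∧ b = x) := by
  unfold mg; split_ifs <;> grind

theorem mg_ne {x y a : ℕ} (hxy : x ≠ y) : mg x y a ≠ y := by
  unfold mg; split_ifs <;> assumption

theorem mg_self {x y a : ℕ} (h : a ≠ y) : mg x y a = a := by
  unfold mg; simp [h]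

theorem mg_y {x y : ℕ} : mg x y y = x := by
  unfold mg; simp

/-- edge contraction -/
def con (T : Finset (ℕ × ℕ × ℕ)) (x y : ℕ) : Finset (ℕ × ℕ × ℕ) :=
  (T.filter (fun t => ¬ BB x y t.1 t.2.1 t.2.2)).image
    (fun t => (mg x y t.1, mg x y t.2.1, mg x y t.2.2))

theorem mem_con {T : Finset (ℕ × ℕ × ℕ)} {x y a b c : ℕ} :
    (a, b, c) ∈ con T x y ↔ ∃ a' b' c', (a', b', c') ∈ T ∧ ¬ BB x y a' b' c' ∧
      mg x y a' = a ∧ mg x y b' = b ∧ mg x y c' = c := by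
  simp only [con, Finset.mem_image, Finset.mem_filter, Prod.exists, Prod.mk.injEq, and_assoc]

theorem mem_con_of {T : Finset (ℕ × ℕ × ℕ)} {x y a b c : ℕ} (h : (a, b, c) ∈ T)
    (hB : ¬ BB x y a b c) : (mg x y a, mg x y b, mg x y c) ∈ con T x y :=
  mem_con.2 ⟨a, b, c, h, hB, rfl, rfl, rfl⟩

section
variable {T : Finset (ℕ × ℕ × ℕ)} (h : Sph T) {x y p q : ℕ}
  (h1 : (x, y, p) ∈ T) (h2 : (y, x, q) ∈ T)
include h

theorem cyc3 {v a b c : ℕ} (ha : (v, a, b) ∈ T) (hb : (v, b, c) ∈ T) (hc : (v, c, a) ∈ T)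
    {d e : ℕ} (hd : (v, d, e) ∈ T) : d = a ∨ d = b ∨ d = c := by
  refine h.link v {d | d = a ∨ d = b ∨ d = c} ?_ a b d e (Or.inl rfl) ha hd
  rintro s t (rfl | rfl | rfl) ht
  · exact Or.inr (Or.inl (h.uniq _ _ _ _ ht ha))
  · exact Or.inr (Or.inr (h.uniq _ _ _ _ ht hb))
  · exact Or.inl (h.uniq _ _ _ _ ht hc)

include h1 h2

theorem tetra (h3 : (x, p, q) ∈ T) (h4 : (y, q, p) ∈ T) : (vs T).card ≤ 4 := by
  have e1 := h.rot _ _ _ h1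
  have e2 := h.rot _ _ _ e1
  have e3 := h.rot _ _ _ h2
  have e4 := h.rot _ _ _ e3
  have e5 := h.rot _ _ _ h3
  have e6 := h.rot _ _ _ e5
  have e7 := h.rot _ _ _ h4
  have e8 := h.rot _ _ _ e7
  have : vs T ⊆ {x, y, p, q} := by
    intro v hv
    obtain ⟨b, c, hbc⟩ := mem_vs.1 hv
    have := h.conn {d | d = x ∨ d = y ∨ d = p ∨ d = q} (by
      rintro s t r (rfl | rfl | rfl | rfl) ht
      · have := cyc3 h h1 h3 e3 ht; simp; tauto
      · have := cyc3 h h2 h4 e1 ht; simp; tauto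
      · have := cyc3 h e2 e8 e5 ht; simp; tauto
      · have := cyc3 h e4 e6 e7 ht; simp; tauto) x y p v b c (Or.inl rfl) h1 hbc
    simpa using this
  calc _ ≤ _ := Finset.card_le_card this
    _ ≤ 4 := Finset.card_le_four

theorem link_side {A : Set ℕ} (hA : ∀ a b, a ∈ A → (x, a, b) ∈ T → a ≠ y → b ≠ y → b ∈ A)
    {a b : ℕ} (ha : a ∈ A) (hab : (x, a, b) ∈ T) (hay : a ≠ y) : q ∈ A := by
  by_contra hq
  have := h.link x {a | a ∈ A ∧ a ≠ y} (by
    rintro s t ⟨hs, hsy⟩ ht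
    by_cases hty : t = y
    · subst hty
      have := h.uniq _ _ _ _ (h.rot _ _ _ (h.rot _ _ _ ht)) h2
      exact absurd (this ▸ hs) hq
    · exact ⟨hA s t hs ht hsy hty, hty⟩) a b y p ⟨ha, hay⟩ hab h1
  exact this.2 rfl

theorem link_all {A : Set ℕ} (hA : ∀ a b, a ∈ A → (x, a, b) ∈ T → a ≠ y → b ≠ y → b ∈ A)
    (hp : p ∈ A) {c d : ℕ} (hcd : (x, c, d) ∈ T) (hcy : c ≠ y) : c ∈ A := by
  have := h.link x {a | a ∈ A ∨ a = y} (by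
    rintro s t hs ht
    by_cases hty : t = y
    · exact Or.inr hty
    by_cases hsy : s = y
    · subst hsy
      exact Or.inl (by rwa [h.uniq _ _ _ _ ht h1])
    · exact Or.inl (hA s t (hs.resolve_right hsy) ht hsy hty)) y p c d (Or.inr rfl) h1 hcd
  exact this.resolve_right hcy

variable (hcn : ∀ z, Adj T x z → Adj T y z → z = p ∨ z = q) (hV : 5 ≤ (vs T).card)
include hcn

theorem con_k1 {b c c' : ℕ} (h3 : (x, b, c) ∈ T) (h4 : (y, b, c') ∈ T) (h5 : ¬ BB x y x b c)
    (h6 : ¬ BB x y y b c') : False := by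
  have e1 := h.rot _ _ _ h1
  have e3 := h.rot _ _ _ h2
  rcases hcn b ⟨c, h3⟩ ⟨c', h4⟩ with rfl | rfl
  · have := h.uniq _ _ _ _ h4 e1
    subst this
    exact h6 (by simp [BB])
  · have := h.uniq _ _ _ _ h3 e3
    subst this
    exact h5 (by simp [BB])

theorem con_k2 {b c c' : ℕ} (h3 : (b, x, c) ∈ T) (h4 : (b, y, c') ∈ T) (h5 : ¬ BB x y b x c)
    (h6 : ¬ BB x y b y c') : False := by
  have e2 := h.rot _ _ _ (h.rot _ _ _ h1)
  have e4 := h.rot _ _ _ (h.rot _ _ _ h2)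
  rcases hcn b (h.opp _ _ _ h3) (h.opp _ _ _ h4) with rfl | rfl
  · have := h.uniq _ _ _ _ h3 e2
    subst this
    exact h5 (by simp [BB])
  · have := h.uniq _ _ _ _ h4 e4
    subst this
    exact h6 (by simp [BB])

theorem con_key {a b c a' b' c' : ℕ} (h3 : (a, b, c) ∈ T) (h4 : (a', b', c') ∈ T)
    (h5 : ¬ BB x y a b c) (h6 : ¬ BB x y a' b' c') (ha : mg x y a = mg x y a')
    (hb : mg x y b = mg x y b') : a = a' ∧ b = b' := by
  rw [mg_eq] at ha hb
  rcases ha with rfl | ⟨rfl, rfl⟩ | ⟨rfl, rfl⟩ <;> rcases hb with rfl | ⟨rfl, rfl⟩ | ⟨rfl, rfl⟩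
  · exact ⟨rfl, rfl⟩
  · exact (con_k2 h h1 h2 hcn h3 h4 h5 h6).elim
  · exact (con_k2 h h1 h2 hcn h4 h3 h6 h5).elim
  · exact (con_k1 h h1 h2 hcn h3 h4 h5 h6).elim
  · exact absurd rfl (h.ne _ _ _ h3)
  · exact absurd (by simp [BB]) h5
  · exact (con_k1 h h1 h2 hcn h4 h3 h6 h5).elim
  · exact absurd (by simp [BB]) h5
  · exact absurd rfl (h.ne _ _ _ h3)

theorem con_card : (con T x y).card + 6 = T.card := by
  have hB6 := BB_card h h1 h2
  have hsum := Finset.card_filter_add_card_filter_not (s := T) (fun t => BB x y t.1 t.2.1 t.2.2)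
  rw [con, Finset.card_image_of_injOn]
  · omega
  · rintro ⟨a, b, c⟩ ht ⟨a', b', c'⟩ ht' he
    simp only [Finset.coe_filter, Set.mem_ofPred_eq, Prod.mk.injEq] at ht ht' he
    obtain ⟨rfl, rfl⟩ := con_key h h1 h2 hcn ht.1 ht'.1 ht.2 ht'.2 he.1 he.2.1
    rw [h.uniq _ _ _ _ ht.1 ht'.1]

omit hcn in
theorem con_adj {a b : ℕ} (hab : Adj T a b) (hxy : ¬ (a = x ∧ b = y)) (hyx : ¬ (a = y ∧ b = x)) :
    (∃ c, (a, b, c) ∈ T ∧ ¬ BB x y a b c) ∨ (∃ c, (b, a, c) ∈ T ∧ ¬ BB x y b a c) := by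
  obtain ⟨c, hc⟩ := hab
  by_cases hB : BB x y a b c
  · obtain ⟨d, hd⟩ := h.opp _ _ _ hc
    refine Or.inr ⟨d, hd, fun hB' => ?_⟩
    have hcd : d ≠ c := by rintro rfl; exact h.opp_ne _ _ _ hc hd
    have n1 := h.ne _ _ _ h1
    have n2 := h.ne _ _ _ hc
    unfold BB at hB hB'
    grind
  · exact Or.inl ⟨c, hc, hB⟩

omit hcn in
theorem con_opp {a b c : ℕ} (hc : (a, b, c) ∈ T) (hB : ¬ BB x y a b c) :
    ∃ a' b' d, (b', a', d) ∈ T ∧ ¬ BB x y b' a' d ∧ mg x y a' = mg x y a ∧ mg x y b' = mg x y b := by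
  obtain ⟨d, hd⟩ := h.opp _ _ _ hc
  by_cases hB' : BB x y b a d
  · have e1 := h.rot _ _ _ h1
    have e2 := h.rot _ _ _ e1
    have e3 := h.rot _ _ _ h2
    have e4 := h.rot _ _ _ e3
    have l1 : LL x y p q y p := by simp [LL]
    have l2 : LL x y p q p x := by simp [LL]
    have l3 : LL x y p q x q := by simp [LL]
    have l4 : LL x y p q q y := by simp [LL]
    rcases BB_LL h h1 h2 hd hB' with hl | ⟨rfl, rfl⟩ | ⟨rfl, rfl⟩
    · rcases hl with ⟨rfl, rfl⟩ | ⟨rfl, rfl⟩ | ⟨rfl, rfl⟩ | ⟨rfl, rfl⟩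
      · obtain ⟨d, hd, hB⟩ := LL_out h h1 h2 l2
        exact ⟨_, _, d, hd, hB, rfl, mg_eq.2 (by simp)⟩
      · obtain ⟨d, hd, hB⟩ := LL_out h h1 h2 l1
        exact ⟨_, _, d, hd, hB, mg_eq.2 (by simp), rfl⟩
      · obtain ⟨d, hd, hB⟩ := LL_out h h1 h2 l4
        exact ⟨_, _, d, hd, hB, rfl, mg_eq.2 (by simp)⟩
      · obtain ⟨d, hd, hB⟩ := LL_out h h1 h2 l3
        exact ⟨_, _, d, hd, hB, mg_eq.2 (by simp), rfl⟩
    · exact absurd (by simp [BB]) hB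
    · exact absurd (by simp [BB]) hB
  · exact ⟨a, b, d, hd, hB', rfl, rfl⟩

omit hcn in
theorem con_vs : vs (con T x y) = (vs T).erase y := by
  have n1 := h.ne _ _ _ h1
  ext v
  rw [Finset.mem_erase, mem_vs]
  constructor
  · rintro ⟨b, c, hbc⟩
    obtain ⟨a', b', c', ht, hB, rfl, rfl, rfl⟩ := mem_con.1 hbc
    refine ⟨mg_ne n1, ?_⟩
    by_cases ha : a' = y
    · rw [ha, mg_y]; exact h.m1 h1
    · rw [mg_self ha]; exact h.m1 ht
  · rintro ⟨hvy, hv⟩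
    have key : ∀ b c, (v, b, c) ∈ T → ¬ BB x y v b c → ∃ b c, (v, b, c) ∈ con T x y := by
      intro b c hb hB
      have := mem_con_of hb hB
      rw [mg_self hvy] at this
      exact ⟨_, _, this⟩
    by_cases hvx : v = x
    · subst hvx
      obtain ⟨d, hd, hB⟩ := LL_out h h1 h2 (b := p) (c := v) (by simp [LL])
      exact key _ _ hd hB
    · obtain ⟨b, c, hbc⟩ := mem_vs.1 hv
      by_cases hB : BB x y v b c
      · have hcv := h.rot _ _ _ (h.rot _ _ _ hbc)
        obtain ⟨d, hd⟩ := h.opp _ _ _ hcv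
        refine key _ _ hd fun hB' => ?_
        have hdb : d ≠ b := by rintro rfl; exact h.opp_ne _ _ _ hcv hd
        unfold BB at hB hB'
        grind
      · exact key _ _ hbc hB

include hV

theorem con_k3 {b c : ℕ} (h3 : (x, b, c) ∈ T) (h4 : (y, c, b) ∈ T) (h5 : ¬ BB x y x b c)
    (h6 : ¬ BB x y y c b) : False := by
  have e3 := h.rot _ _ _ h2
  have hb := hcn b ⟨c, h3⟩ (h.opp _ _ _ (h.rot _ _ _ (h.rot _ _ _ h4)))
  have hc := hcn c (h.opp _ _ _ (h.rot _ _ _ (h.rot _ _ _ h3))) ⟨b, h4⟩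
  have hbc := h.ne2 h3
  rcases hb with rfl | rfl
  · rcases hc with rfl | rfl
    · exact hbc rfl
    · have := tetra h h1 h2 h3 h4
      omega
  · have := h.uniq _ _ _ _ h3 e3
    subst this
    exact h5 (by simp [BB])

theorem con_k4 {a b c a' b' c' : ℕ} (h3 : (a, b, c) ∈ T) (h4 : (b', a', c') ∈ T)
    (h5 : ¬ BB x y a b c) (h6 : ¬ BB x y b' a' c') (ha : mg x y a = mg x y a')
    (hb : mg x y b = mg x y b') (hc : mg x y c = mg x y c') : a = a' := by
  by_contra hne
  rw [mg_eq] at ha hb hc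
  have r4 := h.rot _ _ _ h4
  have n1 := h.ne _ _ _ h3
  have n2 := h.ne3 h3
  have n1' := h.ne _ _ _ h4
  have n2' := h.ne2 h4
  rcases ha with ha | ⟨rfl, rfl⟩ | ⟨rfl, rfl⟩
  · exact hne ha
  · have hb' : b = b' := by
      rcases hb with hb | ⟨rfl, rfl⟩ | ⟨rfl, rfl⟩
      · exact hb
      · exact absurd rfl n1
      · exact absurd (by simp [BB]) h5
    have hc' : c = c' := by
      rcases hc with hb | ⟨rfl, rfl⟩ | ⟨rfl, rfl⟩
      · exact hb
      · exact absurd rfl n2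
      · exact absurd (by simp [BB]) h5
    subst hb' hc'
    exact con_k3 h h1 h2 hcn hV h3 r4 h5 (fun e => h6 (BB_rot (BB_rot e)))
  · have hb' : b = b' := by
      rcases hb with hb | ⟨rfl, rfl⟩ | ⟨rfl, rfl⟩
      · exact hb
      · exact absurd (by simp [BB]) h5
      · exact absurd rfl n1
    have hc' : c = c' := by
      rcases hc with hb | ⟨rfl, rfl⟩ | ⟨rfl, rfl⟩
      · exact hb
      · exact absurd (by simp [BB]) h5
      · exact absurd rfl n2
    subst hb' hc'
    exact con_k3 h h1 h2 hcn hV r4 h3 (fun e => h6 (BB_rot (BB_rot e))) h5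

theorem con_sph : Sph (con T x y) := by
  have n1 := h.ne _ _ _ h1
  constructor
  · intro a b c hab
    obtain ⟨a', b', c', ht, hB, rfl, rfl, rfl⟩ := mem_con.1 hab
    exact mem_con_of (h.rot _ _ _ ht) fun e => hB (BB_rot (BB_rot e))
  · intro a b c hab
    obtain ⟨a', b', c', ht, hB, rfl, rfl, rfl⟩ := mem_con.1 hab
    intro he
    rw [mg_eq] at he
    rcases he with he | ⟨rfl, rfl⟩ | ⟨rfl, rfl⟩
    · exact h.ne _ _ _ ht he
    · exact hB (by simp [BB])
    · exact hB (by simp [BB])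
  · intro a b c d hc hd
    obtain ⟨a1, b1, c1, ht, hB, rfl, rfl, rfl⟩ := mem_con.1 hc
    obtain ⟨a2, b2, c2, ht', hB', ha, hb, rfl⟩ := mem_con.1 hd
    obtain ⟨rfl, rfl⟩ := con_key h h1 h2 hcn ht ht' hB hB' ha.symm hb.symm
    rw [h.uniq _ _ _ _ ht ht']
  · intro a b c hc
    obtain ⟨a1, b1, c1, ht, hB, rfl, rfl, rfl⟩ := mem_con.1 hc
    obtain ⟨a', b', d, hd, hB', ha, hb⟩ := con_opp h h1 h2 ht hB
    rw [← ha, ← hb]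
    exact ⟨_, mem_con_of hd hB'⟩
  · intro a b c hc hd
    obtain ⟨a1, b1, c1, ht, hB, rfl, rfl, rfl⟩ := mem_con.1 hc
    obtain ⟨b2, a2, c2, ht', hB', hb, ha, hc⟩ := mem_con.1 hd
    have rB := fun e => hB (BB_rot (BB_rot e))
    have rB' := fun e => hB' (BB_rot (BB_rot e))
    have e1 := con_k4 h h1 h2 hcn hV ht ht' hB hB' ha.symm hb.symm hc.symm
    have e2 := con_k4 h h1 h2 hcn hV (h.rot _ _ _ ht) (h.rot _ _ _ (h.rot _ _ _ ht')) rB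
      (fun e => rB' (BB_rot (BB_rot e))) hb.symm hc.symm ha.symm
    have e3 := con_k4 h h1 h2 hcn hV (h.rot _ _ _ (h.rot _ _ _ ht)) (h.rot _ _ _ ht')
      (fun e => rB (BB_rot (BB_rot e))) rB' hc.symm ha.symm hb.symm
    subst e1 e2 e3
    exact h.opp_ne _ _ _ ht ht'
  · intro v A hA a b c d ha hb hc
    by_cases hvx : v = x
    · subst hvx
      have hA1 : ∀ a b, a ∈ A → (v, a, b) ∈ T → a ≠ y → b ≠ y → b ∈ A := by
        intro a b ha hb h3 h4
        refine hA a b ha ?_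
        have := mem_con_of hb (x := v) (y := y) (by unfold BB; tauto)
        rwa [mg_self h3, mg_self h4, mg_self n1] at this
      have hA2 : ∀ a b, a ∈ A → (y, a, b) ∈ T → a ≠ v → b ≠ v → b ∈ A := by
        intro a b ha hb h3 h4
        have n2 := h.ne _ _ _ hb
        have n3 := h.ne3 hb
        refine hA a b ha ?_
        have := mem_con_of hb (x := v) (y := y) (by unfold BB; tauto)
        rwa [mg_self n2.symm, mg_self n3, mg_y] at this
      have cases : ∀ a b, (v, a, b) ∈ con T v y →
          ((v, a, b) ∈ T ∧ a ≠ y) ∨ ((y, a, b) ∈ T ∧ a ≠ v) := by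
        intro a b hab
        obtain ⟨a1, b1, c1, ht, hB, h3, rfl, rfl⟩ := mem_con.1 hab
        replace h3 : mg v y a1 = mg v y v := h3.trans (mg_self n1).symm
        rw [mg_eq] at h3
        unfold BB at hB
        have n2 := h.ne _ _ _ ht
        have n3 := h.ne3 ht
        rcases h3 with rfl | ⟨-, h3⟩ | ⟨rfl, -⟩
        · left
          rw [mg_self (by tauto), mg_self (by tauto)]
          exact ⟨ht, by tauto⟩
        · exact absurd h3 n1
        · right
          rw [mg_self (by tauto), mg_self (by tauto)]
          exact ⟨ht, by tauto⟩
      obtain ⟨d1, hd1⟩ := h.opp _ _ _ (h.rot _ _ _ (h.rot _ _ _ h1))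
      obtain ⟨d2, hd2⟩ := h.opp _ _ _ (h.rot _ _ _ (h.rot _ _ _ h2))
      have hpq : p ∈ A ∧ q ∈ A := by
        rcases cases _ _ hb with ⟨h3, h4⟩ | ⟨h3, h4⟩
        · have hq := link_side h h1 h2 hA1 ha h3 h4
          exact ⟨link_side h h2 h1 hA2 hq hd2 (h.ne2 h2).symm, hq⟩
        · have hp := link_side h h2 h1 hA2 ha h3 h4
          exact ⟨hp, link_side h h1 h2 hA1 hp hd1 (h.ne2 h1).symm⟩
      rcases cases _ _ hc with ⟨h3, h4⟩ | ⟨h3, h4⟩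
      · exact link_all h h1 h2 hA1 hpq.1 h3 h4
      · exact link_all h h2 h1 hA2 hpq.2 h3 h4
    · have hlift : ∀ a b, (v, a, b) ∈ con T x y → ∃ a' b', (v, a', b') ∈ T ∧ mg x y a' = a := by
        intro a b hab
        obtain ⟨a1, b1, c1, ht, hB, h3, rfl, rfl⟩ := mem_con.1 hab
        by_cases h4 : a1 = y
        · subst h4; rw [mg_y] at h3; exact absurd h3.symm hvx
        · rw [mg_self h4] at h3
          subst h3
          exact ⟨_, _, ht, rfl⟩
      obtain ⟨a', b', hab', rfl⟩ := hlift _ _ hb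
      obtain ⟨c', d', hcd', rfl⟩ := hlift _ _ hc
      have hvy : v ≠ y := by
        intro e
        obtain ⟨a1, b1, c1, ht, hB, h3, -⟩ := mem_con.1 hb
        exact mg_ne n1 (h3.trans e)
      refine h.link v {a | mg x y a ∈ A} ?_ a' b' c' d' ha hab' hcd'
      intro s t hs hst
      by_cases hB : BB x y v s t
      · have : mg x y s = mg x y t := by
          rw [mg_eq]; unfold BB at hB; have := h.ne2 hst; grind
        simpa [← this] using hs
      · have := mem_con_of hst hB
        rw [mg_self hvy] at this
        exact hA _ _ hs this
  · intro A hA a b c a' b' c' ha hb hc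
    obtain ⟨a1, b1, c1, ht, hB, rfl, rfl, rfl⟩ := mem_con.1 hb
    obtain ⟨a2, b2, c2, ht', hB', rfl, rfl, rfl⟩ := mem_con.1 hc
    refine h.conn {a | mg x y a ∈ A} ?_ a1 b1 c1 a2 b2 c2 ha ht ht'
    intro s t r hs hst
    by_cases hxy : s = x ∧ t = y
    · rw [hxy.1] at hs
      have : mg x y x = mg x y y := mg_eq.2 (by simp)
      rw [hxy.2]; simpa [← this] using hs
    by_cases hyx : s = y ∧ t = x
    · rw [hyx.1] at hs
      have : mg x y y = mg x y x := mg_eq.2 (by simp)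
      rw [hyx.2]; simpa [← this] using hs
    rcases con_adj h h1 h2 ⟨_, hst⟩ hxy hyx with ⟨r', h3, h4⟩ | ⟨r', h3, h4⟩
    · exact hA _ _ _ hs (mem_con_of h3 h4)
    · obtain ⟨a', b', d, hd, hB', ha', hb'⟩ := con_opp h h1 h2 h3 h4
      have := mem_con_of hd hB'
      rw [ha', hb'] at this
      exact hA _ _ _ hs this
  · have h3 := con_card h h1 h2 hcn
    rw [con_vs h h1 h2, Finset.card_erase_of_mem (h.m2 h1)]
    have := h.count
    omega

end
end Koebe


namespace Koebe
set_option linter.unusedSectionVars false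
set_option linter.unusedVariables false

section
variable {T : Finset (ℕ × ℕ × ℕ)} (h : Sph T) {x y p q : ℕ}
  (h1 : (x, y, p) ∈ T) (h2 : (y, x, q) ∈ T) {m : ℕ} (hm : m ∉ vs T)
include h h1 h2

theorem sub_adj_of {a b : ℕ} (hab : Adj T a b) (hxy : ¬ (a = x ∧ b = y)) (hyx : ¬ (a = y ∧ b = x)) :
    Adj (sub T x y p q m) a b := by
  obtain ⟨c, hc⟩ := hab
  by_cases hB : BB x y a b c
  · rcases BB_LL h h1 h2 hc hB with hl | hl | hl
    · exact ⟨m, by rw [mem_sub]; exact Or.inr (Or.inr (Or.inr ⟨rfl, hl⟩))⟩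
    · exact absurd hl hxy
    · exact absurd hl hyx
  · exact ⟨c, by rw [mem_sub]; exact Or.inl ⟨hc, hB⟩⟩

include hm
theorem sub_adj_cases {a b : ℕ} (hab : Adj (sub T x y p q m) a b) :
    (Adj T a b ∧ ¬ (a = x ∧ b = y) ∧ ¬ (a = y ∧ b = x)) ∨
    (a = m ∧ (b = x ∨ b = y ∨ b = p ∨ b = q)) ∨ (b = m ∧ (a = x ∨ a = y ∨ a = p ∨ a = q)) := by
  obtain ⟨c, hc⟩ := hab
  rw [mem_sub] at hc
  rcases hc with hc | ⟨rfl, hl⟩ | ⟨rfl, hl⟩ | ⟨rfl, hl⟩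
  · left
    refine ⟨⟨c, hc.1⟩, ?_, ?_⟩
    · rintro ⟨rfl, rfl⟩; exact hc.2 (by simp [BB])
    · rintro ⟨rfl, rfl⟩; exact hc.2 (by simp [BB])
  · right; left
    refine ⟨rfl, ?_⟩
    unfold LL at hl; tauto
  · right; right
    refine ⟨rfl, ?_⟩
    unfold LL at hl; tauto
  · left
    obtain ⟨d, hd, hB⟩ := LL_in h h1 h2 hl
    refine ⟨⟨d, hd⟩, ?_, ?_⟩
    · rintro ⟨rfl, rfl⟩
      have n1 := h.ne _ _ _ h1
      have n2 := h.ne2 h1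
      have n3 := h.ne3 h1
      have n4 := h.ne2 h2
      have n5 := h.ne3 h2
      unfold LL at hl; tauto
    · rintro ⟨rfl, rfl⟩
      have n1 := h.ne _ _ _ h1
      have n2 := h.ne2 h1
      have n3 := h.ne3 h1
      have n4 := h.ne2 h2
      have n5 := h.ne3 h2
      unfold LL at hl; tauto

omit hm in
theorem con_adj_of {a b : ℕ} (hab : Adj T a b) (hxy : ¬ (a = x ∧ b = y))
    (hyx : ¬ (a = y ∧ b = x)) : Adj (con T x y) (mg x y a) (mg x y b) := by
  rcases con_adj h h1 h2 hab hxy hyx with ⟨r', h3, h4⟩ | ⟨r', h3, h4⟩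
  · exact ⟨_, mem_con_of h3 h4⟩
  · obtain ⟨a', b', d, hd, hB', ha', hb'⟩ := con_opp h h1 h2 h3 h4
    have := mem_con_of hd hB'
    rw [ha', hb'] at this
    exact ⟨_, this⟩
end

/-- a marked sphere carrying `G` as a minor -/
structure St {V : Type*} (G : SimpleGraph V) (T : Finset (ℕ × ℕ × ℕ)) (β : ℕ → Option V) : Prop where
  sph : Sph T
  t0 : ∃ p q s, (p, q, s) ∈ T ∧ β p = none ∧ β q = none ∧ β s = none
  supp : ∀ a v, β a = some v → a ∈ vs T
  fib : ∀ v, ∃ a, β a = some v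
  fconn : ∀ v (A : Set ℕ), (∀ a b, a ∈ A → β a = some v → β b = some v → Adj T a b → b ∈ A) →
    ∀ a b, a ∈ A → β a = some v → β b = some v → b ∈ A
  edge : ∀ u v, G.Adj u v → ∃ a b, β a = some u ∧ β b = some v ∧ Adj T a b

/-- number of marked vertices -/
noncomputable def mkd {V : Type*} (T : Finset (ℕ × ℕ × ℕ)) (β : ℕ → Option V) : Finset ℕ :=
  by classical exact (vs T).filter (fun a => β a ≠ none)

section
variable {V : Type*} {G : SimpleGraph V} {T : Finset (ℕ × ℕ × ℕ)} {β : ℕ → Option V}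

theorem St.t0_sub (h : St G T β) {x z p q m : ℕ} {v : V} (hx : β x = some v) :
    ∃ p' q' s, (p', q', s) ∈ sub T x z p q m ∧ β p' = none ∧ β q' = none ∧ β s = none := by
  obtain ⟨a, b, c, ht, ha, hb, hc⟩ := h.t0
  refine ⟨a, b, c, ?_, ha, hb, hc⟩
  rw [mem_sub]
  refine Or.inl ⟨ht, ?_⟩
  rintro ⟨h3, -⟩
  rcases h3 with rfl | rfl | rfl
  · rw [hx] at ha; cases ha
  · rw [hx] at hb; cases hb
  · rw [hx] at hc; cases hc

/-- subdivide xz when y is in the same fiber as x and adjacent to both -/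
theorem St.sub1 (h : St G T β) {x y z p q m : ℕ} {v : V} (hx : β x = some v) (hy : β y = some v)
    (hxy : Adj T x y) (hyz : Adj T y z) (h1 : (x, z, p) ∈ T) (h2 : (z, x, q) ∈ T)
    (hm : m ∉ vs T) : St G (sub T x z p q m) β := by
  have hs := h.sph
  have nyz := hs.adj_ne hyz
  have nxy := hs.adj_ne hxy
  have nxz := hs.ne _ _ _ h1
  have a1 : Adj (sub T x z p q m) x y := sub_adj_of hs h1 h2 hxy (by tauto) (by tauto)
  have a2 : Adj (sub T x z p q m) y z := sub_adj_of hs h1 h2 hyz (by tauto) (by tauto)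
  have hs' := sub_sph hs h1 h2 hm
  refine ⟨hs', h.t0_sub hx, ?_, h.fib, ?_, ?_⟩
  · intro a u ha
    rw [sub_vs hs h1 h2 hm]
    exact Finset.mem_insert_of_mem (h.supp a u ha)
  · intro u A hA
    refine h.fconn u A ?_
    intro a b ha hau hbu hab
    by_cases e1 : a = x ∧ b = z
    · obtain ⟨rfl, rfl⟩ := e1
      rw [hau] at hx
      rw [← hx] at hy
      exact hA y b (hA a y ha hau hy a1) hy hbu a2
    by_cases e2 : a = z ∧ b = x
    · obtain ⟨rfl, rfl⟩ := e2
      rw [hbu] at hx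
      rw [← hx] at hy
      exact hA y b (hA a y ha hau hy (hs'.adj_symm a2)) hy hbu (hs'.adj_symm a1)
    · exact hA a b ha hau hbu (sub_adj_of hs h1 h2 hab e1 e2)
  · intro u w huw
    obtain ⟨a, b, ha, hb, hab⟩ := h.edge u w huw
    by_cases e1 : a = x ∧ b = z
    · obtain ⟨rfl, rfl⟩ := e1
      exact ⟨y, b, by rw [hy, ← hx, ha], hb, a2⟩
    by_cases e2 : a = z ∧ b = x
    · obtain ⟨rfl, rfl⟩ := e2
      exact ⟨a, y, ha, by rw [hy, ← hx, hb], hs'.adj_symm a2⟩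
    · exact ⟨a, b, ha, hb, sub_adj_of hs h1 h2 hab e1 e2⟩

theorem mk_sub (h : St G T β) {x y p q m : ℕ} (h1 : (x, y, p) ∈ T) (h2 : (y, x, q) ∈ T)
    (hm : m ∉ vs T) : mkd (sub T x y p q m) β = mkd T β := by
  classical
  unfold mkd
  ext a
  simp only [Finset.mem_filter, sub_vs h.sph h1 h2 hm, Finset.mem_insert]
  constructor
  · rintro ⟨rfl | h3, h4⟩
    · obtain ⟨v, hv⟩ := Option.ne_none_iff_exists'.1 h4
      exact absurd (h.supp _ _ hv) hm
    · exact ⟨h3, h4⟩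
  · rintro ⟨h3, h4⟩
    exact ⟨Or.inr h3, h4⟩

theorem fresh (T : Finset (ℕ × ℕ × ℕ)) : ∃ m, m ∉ vs T := Infinite.exists_notMem_finset _

/-- reduce the common neighbours to two -/
theorem St.reduce (n : ℕ) : ∀ (T : Finset (ℕ × ℕ × ℕ)) (x y p q : ℕ) (v : V), St G T β →
    β x = some v → β y = some v → (x, y, p) ∈ T → (y, x, q) ∈ T →
    {z | Adj T x z ∧ Adj T y z}.ncard ≤ n →
    ∃ T', St G T' β ∧ (x, y, p) ∈ T' ∧ (y, x, q) ∈ T' ∧ mkd T' β = mkd T β ∧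
      ∀ z, Adj T' x z → Adj T' y z → z = p ∨ z = q := by
  have hfin : ∀ (T : Finset (ℕ × ℕ × ℕ)) (x y : ℕ), Sph T → {z | Adj T x z ∧ Adj T y z}.Finite := by
    intro T x y hs
    exact (vs T).finite_toSet.subset fun z hz => hs.adj_mem' hz.1
  induction n with
  | zero =>
    intro T x y p q v h hx hy h1 h2 hn
    exfalso
    have : {z | Adj T x z ∧ Adj T y z} = ∅ := by
      rw [← Set.ncard_eq_zero (hfin T x y h.sph)]; omega
    have hp : p ∈ {z | Adj T x z ∧ Adj T y z} :=
      ⟨h.sph.opp _ _ _ (h.sph.rot _ _ _ (h.sph.rot _ _ _ h1)), ⟨_, h.sph.rot _ _ _ h1⟩⟩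
    rw [this] at hp
    exact hp
  | succ n ih =>
    intro T x y p q v h hx hy h1 h2 hn
    have hs := h.sph
    by_cases hz : ∀ z, Adj T x z → Adj T y z → z = p ∨ z = q
    · exact ⟨T, h, h1, h2, rfl, hz⟩
    push Not at hz
    obtain ⟨z, hxz, hyz, hzp, hzq⟩ := hz
    obtain ⟨p', h3⟩ := id hxz
    obtain ⟨q', h4⟩ := hs.adj_symm hxz
    obtain ⟨m, hm⟩ := fresh T
    have nxy := hs.ne _ _ _ h1
    have nyz := hs.adj_ne hyz
    have nxz := hs.adj_ne hxz
    have np' : p' ≠ y := by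
      rintro rfl
      exact hzq (hs.uniq _ _ _ _ (hs.rot _ _ _ (hs.rot _ _ _ h3)) h2)
    have nq' : q' ≠ y := by
      rintro rfl
      exact hzp (hs.uniq _ _ _ _ (hs.rot _ _ _ h4) h1)
    have hT' := h.sub1 hx hy ⟨p, h1⟩ hyz h3 h4 hm
    have hxm : x ≠ m := by rintro rfl; exact hm (hs.m1 h1)
    have hym : y ≠ m := by rintro rfl; exact hm (hs.m2 h1)
    have nyp := hs.ne2 h1
    have nxq := hs.ne2 h2
    have k1 : (x, y, p) ∈ sub T x z p' q' m := by
      rw [mem_sub]; refine Or.inl ⟨h1, ?_⟩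
      unfold BB
      rintro ⟨-, h5 | h5 | h5⟩
      exacts [nxz h5, nyz h5, hzp h5.symm]
    have k2 : (y, x, q) ∈ sub T x z p' q' m := by
      rw [mem_sub]; refine Or.inl ⟨h2, ?_⟩
      unfold BB
      rintro ⟨-, h5 | h5 | h5⟩
      exacts [nyz h5, nxz h5, hzq h5.symm]
    obtain ⟨T', a1, a2, a3, a4, a5⟩ := ih _ x y p q v hT' hx hy k1 k2 (by
      have hsub : {w | Adj (sub T x z p' q' m) x w ∧ Adj (sub T x z p' q' m) y w} ⊆
          {w | Adj T x w ∧ Adj T y w} \ {z} := by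
        rintro w ⟨hw1, hw2⟩
        rcases sub_adj_cases hs h3 h4 hm hw2 with h5 | h5 | h5
        · rcases sub_adj_cases hs h3 h4 hm hw1 with h6 | h6 | h6
          · refine ⟨⟨h6.1, h5.1⟩, ?_⟩
            rintro rfl
            exact h6.2.1 ⟨rfl, rfl⟩
          · exact absurd h6.1 hxm
          · exact absurd (h6.1 ▸ hs.adj_mem' h5.1) hm
        · exact absurd h5.1 hym
        · rcases h5.2 with h6 | h6 | h6 | h6
          exacts [absurd h6.symm nxy, absurd h6 nyz, absurd h6.symm np', absurd h6.symm nq']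
      have c1 := Set.ncard_le_ncard hsub ((hfin T x y hs).diff)
      have c2 := Set.ncard_diff_singleton_add_one (s := {w | Adj T x w ∧ Adj T y w})
        (a := z) ⟨hxz, hyz⟩ (hfin T x y hs)
      omega)
    exact ⟨T', a1, a2, a3, a4.trans (mk_sub h h3 h4 hm), a5⟩

theorem St.contract (h : St G T β) {x y p q : ℕ} {v : V} (hx : β x = some v) (hy : β y = some v)
    (h1 : (x, y, p) ∈ T) (h2 : (y, x, q) ∈ T)
    (hcn : ∀ z, Adj T x z → Adj T y z → z = p ∨ z = q) :
    St G (con T x y) (fun a => if a = y then none else β a) ∧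
    (mkd (con T x y) (fun a => if a = y then none else β a)).card < (mkd T β).card := by
  classical
  have hs := h.sph
  have nxy := hs.ne _ _ _ h1
  obtain ⟨a, b, c, ht, ha, hb, hc⟩ := h.t0
  have hax : a ≠ x := by rintro rfl; rw [hx] at ha; cases ha
  have hbx : b ≠ x := by rintro rfl; rw [hx] at hb; cases hb
  have hcx : c ≠ x := by rintro rfl; rw [hx] at hc; cases hc
  have hay : a ≠ y := by rintro rfl; rw [hy] at ha; cases ha
  have hby : b ≠ y := by rintro rfl; rw [hy] at hb; cases hb
  have hcy : c ≠ y := by rintro rfl; rw [hy] at hc; cases hc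
  have n1 := hs.ne _ _ _ ht
  have n2 := hs.ne2 ht
  have n3 := hs.ne3 ht
  have hV : 5 ≤ (vs T).card := by
    have : ({x, y, a, b, c} : Finset ℕ) ⊆ vs T := by
      simp only [Finset.insert_subset_iff, Finset.singleton_subset_iff]
      exact ⟨hs.m1 h1, hs.m2 h1, hs.m1 ht, hs.m2 ht, hs.m3 ht⟩
    have h5 : ({x, y, a, b, c} : Finset ℕ).card = 5 := by
      rw [Finset.card_insert_of_notMem, Finset.card_insert_of_notMem,
        Finset.card_insert_of_notMem, Finset.card_insert_of_notMem, Finset.card_singleton] <;>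
      simp only [Finset.mem_insert, Finset.mem_singleton, not_or]
      · exact n2
      · exact ⟨n1, n3.symm⟩
      · exact ⟨hay.symm, hby.symm, hcy.symm⟩
      · exact ⟨nxy, hax.symm, hbx.symm, hcx.symm⟩
    rw [← h5]; exact Finset.card_le_card this
  have hs' := con_sph hs h1 h2 hcn hV
  have hβ : ∀ a, (if mg x y a = y then none else β (mg x y a)) = β a := by
    intro a
    rw [if_neg (mg_ne nxy)]
    by_cases e : a = y
    · rw [e, mg_y, hx, hy]
    · rw [mg_self e]
  have hβ' : ∀ a u, (if a = y then none else β a) = some u → a ≠ y ∧ β a = some u := by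
    intro a u hu
    split_ifs at hu with e
    exact ⟨e, hu⟩
  have hfix : ∀ a u, (if a = y then none else β a) = some u → mg x y a = a :=
    fun a u hu => mg_self (hβ' a u hu).1
  have hadj : ∀ a b, Adj T a b → mg x y a = mg x y b ∨ Adj (con T x y) (mg x y a) (mg x y b) := by
    intro a b hab
    by_cases e1 : a = x ∧ b = y
    · left; rw [mg_eq]; exact Or.inr (Or.inl e1)
    by_cases e2 : a = y ∧ b = x
    · left; rw [mg_eq]; exact Or.inr (Or.inr e2)
    · right; exact con_adj_of hs h1 h2 hab e1 e2
  refine ⟨⟨hs', ?_, ?_, ?_, ?_, ?_⟩, ?_⟩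
  · refine ⟨a, b, c, ?_, by simp [ha], by simp [hb], by simp [hc]⟩
    have := mem_con_of (x := x) (y := y) ht (by unfold BB; tauto)
    rwa [mg_self hay, mg_self hby, mg_self hcy] at this
  · intro a u hu
    rw [con_vs hs h1 h2, Finset.mem_erase]
    exact ⟨(hβ' a u hu).1, h.supp _ _ (hβ' a u hu).2⟩
  · intro u
    obtain ⟨a, ha⟩ := h.fib u
    exact ⟨mg x y a, by rw [hβ, ha]⟩
  · intro u A hA a b ha hau hbu
    have := h.fconn u {a | mg x y a ∈ A} (by
      intro s t hs' hsu htu hst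
      rcases hadj s t hst with e | e
      · simpa [← e] using hs'
      · exact hA _ _ hs' (by rw [hβ]; exact hsu) (by rw [hβ]; exact htu) e) a b
      (by rwa [Set.mem_ofPred_eq, hfix a u hau]) (hβ' a u hau).2 (hβ' b u hbu).2
    rwa [Set.mem_ofPred_eq, hfix b u hbu] at this
  · intro u w huw
    obtain ⟨a, b, ha, hb, hab⟩ := h.edge u w huw
    refine ⟨mg x y a, mg x y b, by rw [hβ, ha], by rw [hβ, hb], ?_⟩
    rcases hadj a b hab with e | e
    · exfalso
      have := hβ a
      rw [e, hβ b, ha, hb] at this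
      exact G.ne_of_adj huw (Option.some.inj this).symm
    · exact e
  · apply Finset.card_lt_card
    rw [Finset.ssubset_iff_of_subset]
    · refine ⟨y, ?_, ?_⟩
      · simp [mkd, hs.m2 h1, hy]
      · simp [mkd]
    · intro a
      simp only [mkd, Finset.mem_filter, con_vs hs h1 h2, Finset.mem_erase]
      rintro ⟨⟨h3, h4⟩, h5⟩
      rw [if_neg h3] at h5
      exact ⟨h4, h5⟩

theorem St.toInj (n : ℕ) : ∀ (T : Finset (ℕ × ℕ × ℕ)) (β : ℕ → Option V), St G T β →
    (mkd T β).card ≤ n →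
    ∃ T' β', St G T' β' ∧ ∀ a b v, β' a = some v → β' b = some v → a = b := by
  induction n with
  | zero =>
    intro T β h hn
    refine ⟨T, β, h, fun a b v ha hb => ?_⟩
    exfalso
    have : a ∈ mkd T β := by
      classical
      simp [mkd, h.supp _ _ ha, ha]
    have := Finset.card_pos.2 ⟨a, this⟩
    omega
  | succ n ih =>
    intro T β h hn
    by_cases hinj : ∀ a b v, β a = some v → β b = some v → a = b
    · exact ⟨T, β, h, hinj⟩
    push Not at hinj
    obtain ⟨a, b, v, ha, hb, hab⟩ := hinj
    have : ∃ y, β y = some v ∧ Adj T a y := by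
      by_contra hno
      push Not at hno
      have := h.fconn v {a} (by
        rintro s t rfl hs ht hst
        exact absurd hst (hno t ht)) a b rfl ha hb
      exact hab this.symm
    obtain ⟨y, hy, hay⟩ := this
    obtain ⟨p, h1⟩ := id hay
    obtain ⟨q, h2⟩ := h.sph.adj_symm hay
    obtain ⟨T', a1, a2, a3, a4, a5⟩ := St.reduce _ T a y p q v h ha hy h1 h2 le_rfl
    obtain ⟨b1, b2⟩ := a1.contract ha hy a2 a3 a5
    exact ih _ _ b1 (by rw [a4] at b2; omega)

theorem St.toInd (n : ℕ) : ∀ (T : Finset (ℕ × ℕ × ℕ)), St G T β →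
    (∀ a b v, β a = some v → β b = some v → a = b) →
    {e : ℕ × ℕ | Adj T e.1 e.2 ∧ ∃ u v, β e.1 = some u ∧ β e.2 = some v ∧ ¬ G.Adj u v}.ncard ≤ n →
    ∃ T', St G T' β ∧ ∀ a b u v, β a = some u → β b = some v → Adj T' a b → G.Adj u v := by
  have hfin : ∀ (T : Finset (ℕ × ℕ × ℕ)), Sph T →
      {e : ℕ × ℕ | Adj T e.1 e.2 ∧ ∃ u v, β e.1 = some u ∧ β e.2 = some v ∧ ¬ G.Adj u v}.Finite := by
    intro T hs
    exact (vs T ×ˢ vs T).finite_toSet.subset fun z hz => by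
      simp only [Finset.coe_product, Set.mem_prod, Finset.mem_coe]
      exact ⟨hs.adj_mem hz.1, hs.adj_mem' hz.1⟩
  induction n with
  | zero =>
    intro T h hinj hn
    refine ⟨T, h, fun a b u v ha hb hab => ?_⟩
    by_contra hG
    have : {e : ℕ × ℕ | Adj T e.1 e.2 ∧ ∃ u v, β e.1 = some u ∧ β e.2 = some v ∧ ¬ G.Adj u v} = ∅ := by
      rw [← Set.ncard_eq_zero (hfin T h.sph)]; omega
    have hp : (a, b) ∈ {e : ℕ × ℕ | Adj T e.1 e.2 ∧ ∃ u v, β e.1 = some u ∧ β e.2 = some v ∧ ¬ G.Adj u v} :=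
      ⟨hab, u, v, ha, hb, hG⟩
    rw [this] at hp
    exact hp
  | succ n ih =>
    intro T h hinj hn
    by_cases hgood : ∀ a b u v, β a = some u → β b = some v → Adj T a b → G.Adj u v
    · exact ⟨T, h, hgood⟩
    push Not at hgood
    obtain ⟨x, y, u, v, hx, hy, hxy, hG⟩ := hgood
    have hs := h.sph
    obtain ⟨p, h1⟩ := id hxy
    obtain ⟨q, h2⟩ := hs.adj_symm hxy
    obtain ⟨m, hm⟩ := fresh T
    have hT' : St G (sub T x y p q m) β := by
      refine ⟨sub_sph hs h1 h2 hm, h.t0_sub hx, ?_, h.fib, ?_, ?_⟩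
      · intro a u ha
        rw [sub_vs hs h1 h2 hm]
        exact Finset.mem_insert_of_mem (h.supp a u ha)
      · intro w A hA a b ha haw hbw
        rwa [← hinj a b w haw hbw]
      · intro u' w' huw
        obtain ⟨a, b, ha, hb, hab⟩ := h.edge u' w' huw
        refine ⟨a, b, ha, hb, sub_adj_of hs h1 h2 hab ?_ ?_⟩
        · rintro ⟨rfl, rfl⟩
          rw [ha] at hx; rw [hb] at hy
          cases hx; cases hy
          exact hG huw
        · rintro ⟨rfl, rfl⟩
          rw [hb] at hx; rw [ha] at hy
          cases hx; cases hy
          exact hG huw.symm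
    refine ih _ hT' hinj ?_
    have hsub : {e : ℕ × ℕ | Adj (sub T x y p q m) e.1 e.2 ∧ ∃ u v, β e.1 = some u ∧ β e.2 = some v ∧ ¬ G.Adj u v}
        ⊆ {e : ℕ × ℕ | Adj T e.1 e.2 ∧ ∃ u v, β e.1 = some u ∧ β e.2 = some v ∧ ¬ G.Adj u v} \ {(x, y)} := by
      rintro ⟨a, b⟩ ⟨hw1, u', v', hu, hv, hG'⟩
      rcases sub_adj_cases hs h1 h2 hm hw1 with h5 | h5 | h5
      · refine ⟨⟨h5.1, u', v', hu, hv, hG'⟩, ?_⟩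
        intro e
        rw [Set.mem_singleton_iff, Prod.mk.injEq] at e
        exact h5.2.1 e
      · exact absurd (h5.1 ▸ h.supp _ _ hu) hm
      · exact absurd (h5.1 ▸ h.supp _ _ hv) hm
    have c1 := Set.ncard_le_ncard hsub ((hfin T hs).diff)
    have c2 := Set.ncard_diff_singleton_add_one (a := (x, y)) (show (x, y) ∈ {e : ℕ × ℕ | Adj T e.1 e.2 ∧ ∃ u v, β e.1 = some u ∧ β e.2 = some v ∧ ¬ G.Adj u v}
      from ⟨hxy, u, v, hx, hy, hG⟩) (hfin T hs)
    omega

theorem St.final (h : St G T β) : ∃ (T' : Finset (ℕ × ℕ × ℕ)) (φ : V → ℕ) (p q s : ℕ),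
    Sph T' ∧ Function.Injective φ ∧ (∀ v, φ v ∈ vs T') ∧
    (∀ u v, Adj T' (φ u) (φ v) ↔ G.Adj u v) ∧ (p, q, s) ∈ T' ∧
    ∀ v, φ v ≠ p ∧ φ v ≠ q ∧ φ v ≠ s := by
  obtain ⟨T1, β1, h1, hinj⟩ := St.toInj _ T β h le_rfl
  obtain ⟨T2, h2, hadj⟩ := St.toInd _ T1 h1 hinj le_rfl
  choose φ hφ using h2.fib
  obtain ⟨a, b, c, ht, ha, hb, hc⟩ := h2.t0
  refine ⟨T2, φ, a, b, c, h2.sph, ?_, fun v => h2.supp _ _ (hφ v), ?_, ht, ?_⟩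
  · intro u v huv
    have := hφ u
    rw [huv, hφ v] at this
    exact (Option.some.inj this).symm
  · intro u v
    constructor
    · exact hadj _ _ _ _ (hφ u) (hφ v)
    · intro huv
      obtain ⟨a, b, ha, hb, hab⟩ := h2.edge u v huv
      rwa [hinj _ _ _ (hφ u) ha, hinj _ _ _ (hφ v) hb]
  · intro v
    have := hφ v
    refine ⟨?_, ?_, ?_⟩ <;> intro e <;> simp_all
end
end Koebe


namespace Koebe
set_option linter.unusedSectionVars false
set_option linter.unusedVariables false

/-- tetrahedron -/
def tet : Finset (ℕ × ℕ × ℕ) :=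
  {(0,2,3),(2,3,0),(3,0,2),(0,3,1),(3,1,0),(1,0,3),(0,1,2),(1,2,0),(2,0,1),(1,3,2),(3,2,1),(2,1,3)}

theorem tet_vs : vs tet = Finset.range 4 := by decide

theorem tet_sph : Sph tet := by
  refine ⟨?_, ?_, ?_, ?_, ?_, ?_, ?_, by decide⟩
  · have : ∀ t ∈ tet, (t.2.1, t.2.2, t.1) ∈ tet := by decide
    intro a b c h; exact this _ h
  · have : ∀ t ∈ tet, t.1 ≠ t.2.1 := by decide
    intro a b c h; exact this _ h
  · have : ∀ t ∈ tet, ∀ s ∈ tet, t.1 = s.1 → t.2.1 = s.2.1 → t.2.2 = s.2.2 := by decide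
    intro a b c d h h'; exact this _ h _ h' rfl rfl
  · have : ∀ t ∈ tet, ∃ d ∈ Finset.range 4, (t.2.1, t.1, d) ∈ tet := by decide
    intro a b c h
    obtain ⟨d, -, hd⟩ := this _ h
    exact ⟨d, hd⟩
  · have : ∀ t ∈ tet, (t.2.1, t.1, t.2.2) ∉ tet := by decide
    intro a b c h; exact this _ h
  · intro v A hA a b c d ha h1 h2
    have e1 : ∀ {s t}, s ∈ A → (v, s, t) ∈ tet → t ∈ A := fun h h' => hA _ _ h h'
    have key : ∀ t ∈ tet, (t.1, t.2.2, 6 - t.1 - t.2.1 - t.2.2) ∈ tet ∧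
      (t.1, 6 - t.1 - t.2.1 - t.2.2, t.2.1) ∈ tet := by decide
    have k2 : ∀ t ∈ tet, ∀ s ∈ tet, t.1 = s.1 → s.2.1 = t.2.1 ∨ s.2.1 = t.2.2 ∨
      s.2.1 = 6 - t.1 - t.2.1 - t.2.2 := by decide
    have hb := e1 ha h1
    have hc := e1 hb (key _ h1).1
    rcases k2 _ h1 _ h2 rfl with h | h | h <;> simp only at h <;> rw [h] <;> assumption
  · intro A hA a b c a' b' c' ha h1 h2
    have key : ∀ t ∈ tet, ∀ s ∈ tet, s.1 = t.1 ∨ ∃ d ∈ Finset.range 4, (t.1, s.1, d) ∈ tet := by decide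
    rcases key _ h1 _ h2 with h | ⟨d, -, hd⟩
    · simp only at h; rw [h]; exact ha
    · exact hA _ _ _ ha hd

theorem path_base (k : ℕ) : ∃ T, Sph T ∧ vs T = Finset.range (k + 4) ∧
    (∀ i, i < k + 1 → (0, i + 2, i + 3) ∈ T) ∧ (0, k + 3, 1) ∈ T := by
  induction k with
  | zero =>
    refine ⟨tet, tet_sph, tet_vs, ?_, by decide⟩
    intro i hi
    obtain rfl : i = 0 := by omega
    decide
  | succ k ih =>
    obtain ⟨T, h, hv, hp, hl⟩ := ih
    have h1 := h.rot _ _ _ hl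
    obtain ⟨q, h2⟩ := h.opp _ _ _ h1
    have hm : k + 4 ∉ vs T := by rw [hv]; simp
    refine ⟨sub T (k + 3) 1 0 q (k + 4), sub_sph h h1 h2 hm, ?_, ?_, ?_⟩
    · rw [sub_vs h h1 h2 hm, hv, Finset.range_add_one (n := k + 4)]
    · intro i hi
      rw [mem_sub]
      by_cases hk : i = k + 1
      · subst hk
        refine Or.inr (Or.inr (Or.inr ⟨by omega, ?_⟩))
        exact Or.inr (Or.inl ⟨rfl, by omega⟩)
      · refine Or.inl ⟨hp i (by omega), ?_⟩
        unfold BB; omega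
    · rw [mem_sub]
      exact Or.inr (Or.inr (Or.inl ⟨by omega, Or.inl ⟨rfl, rfl⟩⟩))

theorem grid_base (n : ℕ) (hn : 2 ≤ n) (K : ℕ) (hK : n ≤ K) : ∃ T, Sph T ∧ vs T = Finset.range (K + 2) ∧
    (∀ j, K ≤ j + n → j + 1 < K → (j + 1) % n ≠ 0 → (0, j + 2, j + 3) ∈ T) ∧
    (K % n ≠ 0 → (0, K + 1, K - n + 2) ∈ T) ∧
    (∀ j, j + 1 < K → (j + 1) % n ≠ 0 → Adj T (j + 2) (j + 3)) ∧
    (∀ j, j + n < K → Adj T (j + 2) (j + n + 2)) := by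
  induction K, hK using Nat.le_induction with
  | base =>
    obtain ⟨k, rfl⟩ : ∃ k, n = k + 2 := ⟨n - 2, by omega⟩
    obtain ⟨T, h, hv, hp, hl⟩ := path_base k
    refine ⟨T, h, hv, fun j _ hj _ => hp j (by omega), fun h0 => absurd (Nat.mod_self _) h0,
      fun j hj _ => ?_, fun j hj => by omega⟩
    exact ⟨_, h.rot _ _ _ (hp j (by omega))⟩
  | succ K hK ih =>
    obtain ⟨T, h, hv, i1, i2, i4, i5⟩ := ih
    obtain ⟨L, rfl⟩ : ∃ L, K = L + n := ⟨K - n, by omega⟩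
    have hmod : (L + n) % n = L % n := Nat.add_mod_right _ _
    have hmod1 : (L + n + 1) % n = (L + 1) % n := by
      rw [show L + n + 1 = L + 1 + n by ring, Nat.add_mod_right]
    rw [hmod] at i2
    rw [hmod1]
    simp only [show L + n - n + 2 = L + 2 by omega] at i2
    -- adjacency of top to infinity
    have hadj : Adj T 0 (L + 2) := by
      by_cases h0 : L % n = 0
      · have : (L + 1) % n ≠ 0 := by
          rw [Nat.add_mod, h0, zero_add, Nat.mod_mod, Nat.mod_eq_of_lt (by omega)]; omega
        exact ⟨_, i1 L (by omega) (by omega) this⟩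
      · exact h.adj_symm ⟨_, h.rot _ _ _ (h.rot _ _ _ (i2 h0))⟩
    obtain ⟨p, h1⟩ := hadj
    obtain ⟨q, h2⟩ := h.opp _ _ _ h1
    have hm : L + n + 2 ∉ vs T := by rw [hv]; simp
    have hp : (L + 1) % n ≠ 0 → p = L + 3 := fun h0 =>
      h.uniq _ _ _ _ h1 (i1 L (by omega) (by omega) h0)
    have hq : L % n ≠ 0 → q = L + n + 1 := fun h0 =>
      h.uniq _ _ _ _ h2 (h.rot _ _ _ (h.rot _ _ _ (i2 h0)))
    have j4 : ∀ j, j + 1 < L + n + 1 → (j + 1) % n ≠ 0 →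
        Adj (sub T 0 (L + 2) p q (L + n + 2)) (j + 2) (j + 3) := by
      intro j hj hj0
      by_cases e : j + 1 = L + n
      · have hq' := hq (by rw [← hmod, ← e]; exact hj0)
        refine ⟨0, ?_⟩
        rw [mem_sub]
        exact Or.inr (Or.inr (Or.inl ⟨by omega, Or.inr (Or.inr (Or.inl ⟨rfl, by omega⟩))⟩))
      · exact sub_adj_of h h1 h2 (i4 j (by omega) hj0) (by omega) (by omega)
    refine ⟨sub T 0 (L + 2) p q (L + n + 2), sub_sph h h1 h2 hm, ?_, ?_, ?_, j4, ?_⟩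
    · rw [sub_vs h h1 h2 hm, hv, ← Finset.range_add_one]
    · intro j hj1 hj2 hj0
      rw [mem_sub]
      by_cases e : j + 1 = L + n
      · have hq' := hq (by rw [← hmod, ← e]; exact hj0)
        refine Or.inr (Or.inr (Or.inr ⟨by omega, ?_⟩))
        exact Or.inr (Or.inr (Or.inl ⟨rfl, by omega⟩))
      · refine Or.inl ⟨i1 j (by omega) (by omega) hj0, ?_⟩
        unfold BB; omega
    · intro h0
      have := hp h0
      rw [mem_sub]
      exact Or.inr (Or.inr (Or.inl ⟨by omega, Or.inr (Or.inl ⟨by omega, rfl⟩)⟩))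
    · intro j hj
      by_cases e : j = L
      · subst e
        refine ⟨q, ?_⟩
        rw [mem_sub]
        exact Or.inr (Or.inr (Or.inl ⟨rfl, Or.inr (Or.inr (Or.inr ⟨rfl, rfl⟩))⟩))
      · exact sub_adj_of h h1 h2 (i5 j (by omega)) (by omega) (by omega)

/-- a sphere containing an `n × n` grid avoiding a triangle -/
theorem grid_sph (n : ℕ) (hn : 2 ≤ n) : ∃ T, Sph T ∧ (∀ j, j < n * n → j + 2 ∈ vs T) ∧
    (∃ q s, (0, q, s) ∈ T ∧ n * n + 2 ≤ q ∧ n * n + 2 ≤ s) ∧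
    (∀ i j, i + 1 < n → j < n → Adj T (j * n + i + 2) (j * n + (i + 1) + 2)) ∧
    (∀ i j, i < n → j + 1 < n → Adj T (j * n + i + 2) ((j + 1) * n + i + 2)) := by
  obtain ⟨T, h, hv, i1, i2, i4, i5⟩ := grid_base n hn (n * n + 2 * n) (by nlinarith)
  have hle : ∀ j, j < n → j * n + n ≤ n * n := by
    intro j hj
    have : (j + 1) * n ≤ n * n := Nat.mul_le_mul_right _ hj
    linarith [add_mul j 1 n]
  refine ⟨T, h, ?_, ?_, ?_, ?_⟩
  · intro j hj; rw [hv, Finset.mem_range]; omega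
  · refine ⟨_, _, i1 (n * n + n) (by omega) (by omega) ?_, by omega, by omega⟩
    rw [show n * n + n + 1 = 1 + n * (n + 1) by ring, Nat.add_mul_mod_self_left,
      Nat.mod_eq_of_lt (by omega)]
    omega
  · intro i j hi hj
    have := hle j hj
    refine i4 (j * n + i) (by omega) ?_
    rw [show j * n + i + 1 = (i + 1) + n * j by ring, Nat.add_mul_mod_self_left,
      Nat.mod_eq_of_lt hi]
    omega
  · intro i j hi hj
    have := hle j (by omega)
    have h3 := i5 (j * n + i) (by omega)
    convert h3 using 1
    ring
end Koebe


namespace Koebe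
set_option linter.unusedSectionVars false
set_option linter.unusedVariables false

/-- the plane -/
abbrev E2 := EuclideanSpace ℝ (Fin 2)

section sets
variable {V : Type*} {G : SimpleGraph V} (D : ProperDrawing G)

/-- parameter interval of the arm of `e` at `v` -/
noncomputable def armJ (e : Sym2 V) (v : V) : Set ℝ :=
  by classical exact if D.curve e 0 = D.pos v then Set.Icc 0 (1/3) else Set.Icc (2/3) 1

theorem armJ_sub (e : Sym2 V) (v : V) : armJ D e v ⊆ Set.Icc 0 1 := by
  unfold armJ
  split_ifs
  · exact Set.Icc_subset_Icc le_rfl (by norm_num)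
  · exact Set.Icc_subset_Icc (by norm_num) le_rfl

theorem ends' {e : Sym2 V} (he : e ∈ G.edgeSet) {v : V} (hv : v ∈ e) :
    D.curve e 0 = D.pos v ∨ D.curve e 1 = D.pos v := by
  induction e using Sym2.ind with
  | _ a b =>
    rw [Sym2.mem_iff] at hv
    rcases D.curve_ends a b he with h | h <;> rcases hv with rfl | rfl
    exacts [Or.inl h.1, Or.inr h.2, Or.inr h.2, Or.inl h.1]

theorem t01 {e : Sym2 V} (he : e ∈ G.edgeSet) {t : ℝ} (ht : t ∈ Set.Icc (0:ℝ) 1) {w : V}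
    (hw : D.curve e t = D.pos w) : t = 0 ∨ t = 1 := by
  have hwe := D.curve_vertex e he t ht w hw
  rcases ends' D he hwe with h | h
  · left; exact D.curve_inj e he ht (by simp) (by rw [hw, h])
  · right; exact D.curve_inj e he ht (by simp) (by rw [hw, h])

theorem arm_pos {e : Sym2 V} (he : e ∈ G.edgeSet) {v : V} (hv : v ∈ e) {t : ℝ}
    (ht : t ∈ armJ D e v) {w : V} (hw : D.curve e t = D.pos w) : w = v := by
  have h01 := t01 D he (armJ_sub D e v ht) hw
  unfold armJ at ht
  apply D.pos_inj
  split_ifs at ht with h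
  · rcases h01 with rfl | rfl
    · rw [← hw, h]
    · exfalso; have := ht.2; norm_num at this
  · rcases h01 with rfl | rfl
    · exfalso; have := ht.1; norm_num at this
    · rcases ends' D he hv with h' | h'
      · exact absurd h' h
      · rw [← hw, h']

theorem arm_end {e : Sym2 V} (he : e ∈ G.edgeSet) {v : V} (hv : v ∈ e) :
    ∃ t ∈ armJ D e v, D.curve e t = D.pos v := by
  unfold armJ
  split_ifs with h
  · exact ⟨0, by norm_num, h⟩
  · exact ⟨1, by norm_num, (ends' D he hv).resolve_left h⟩

/-- stars -/
def Kst (v : V) : Set E2 :=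
  {D.pos v} ∪ ⋃ e ∈ {e | e ∈ G.edgeSet ∧ v ∈ e}, D.curve e '' armJ D e v

/-- middle parts -/
def Mid (e : Sym2 V) : Set E2 := D.curve e '' Set.Icc (1/3) (2/3)

theorem armJ_conn (e : Sym2 V) (v : V) : IsPreconnected (armJ D e v) ∧ IsCompact (armJ D e v) := by
  unfold armJ
  split_ifs
  · exact ⟨isPreconnected_Icc, isCompact_Icc⟩
  · exact ⟨isPreconnected_Icc, isCompact_Icc⟩

theorem mem_Kst {v : V} {x : E2} : x ∈ Kst D v ↔ x = D.pos v ∨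
    ∃ e ∈ G.edgeSet, v ∈ e ∧ ∃ t ∈ armJ D e v, D.curve e t = x := by
  simp only [Kst, Set.mem_union, Set.mem_singleton_iff, Set.mem_iUnion, Set.mem_image,
    Set.mem_ofPred_eq, exists_prop, and_assoc]

theorem Kst_compact [Finite V] (v : V) : IsCompact (Kst D v) := by
  refine isCompact_singleton.union ?_
  refine (Set.toFinite _).isCompact_biUnion ?_
  rintro e ⟨he, hv⟩
  exact (armJ_conn D e v).2.image_of_continuousOn ((D.curve_cont e he).mono (armJ_sub D e v))

theorem Kst_conn (v : V) : IsPreconnected (Kst D v) := by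
  have : Kst D v = ⋃₀ ({({D.pos v} : Set E2)} ∪ {s | ∃ e, (e ∈ G.edgeSet ∧ v ∈ e) ∧ s = D.curve e '' armJ D e v}) := by
    ext x
    rw [mem_Kst]
    simp only [Set.mem_sUnion, Set.mem_union, Set.mem_singleton_iff, Set.mem_ofPred_eq]
    constructor
    · rintro (rfl | ⟨e, he, hv, t, ht, rfl⟩)
      · exact ⟨_, Or.inl rfl, rfl⟩
      · exact ⟨_, Or.inr ⟨e, ⟨he, hv⟩, rfl⟩, t, ht, rfl⟩
    · rintro ⟨s, rfl | ⟨e, ⟨he, hv⟩, rfl⟩, hx⟩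
      · exact Or.inl hx
      · obtain ⟨t, ht, rfl⟩ := hx
        exact Or.inr ⟨e, he, hv, t, ht, rfl⟩
  rw [this]
  refine isPreconnected_sUnion (D.pos v) _ ?_ ?_
  · rintro s (rfl | ⟨e, ⟨he, hv⟩, rfl⟩)
    · rfl
    · obtain ⟨t, ht, h⟩ := arm_end D he hv
      exact ⟨t, ht, h⟩
  · rintro s (rfl | ⟨e, ⟨he, hv⟩, rfl⟩)
    · exact isPreconnected_singleton
    · exact (armJ_conn D e v).1.image _ ((D.curve_cont e he).mono (armJ_sub D e v))

theorem Kst_disj {u v : V} (huv : u ≠ v) : Disjoint (Kst D u) (Kst D v) := by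
  rw [Set.disjoint_left]
  intro x hx hy
  rw [mem_Kst] at hx hy
  rcases hx with rfl | ⟨e, he, hu, s, hs, rfl⟩ <;> rcases hy with hy | ⟨f, hf, hv, t, ht, hy⟩
  · exact huv (D.pos_inj hy)
  · exact huv (arm_pos D hf hv ht hy)
  · exact huv (arm_pos D he hu hs hy).symm
  · by_cases hef : e = f
    · subst hef
      have := D.curve_inj e he (armJ_sub D e _ ht) (armJ_sub D e _ hs) hy
      subst this
      unfold armJ at hs ht
      split_ifs at hs ht with h1 h2 h2
      · exact huv (D.pos_inj (h1.symm.trans h2))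
      · have a := hs.2; have b := ht.1; linarith
      · have a := hs.1; have b := ht.2; linarith
      · exact huv (D.pos_inj (((ends' D he hu).resolve_left h1).symm.trans
          ((ends' D he hv).resolve_left h2)))
    · obtain ⟨w, -, -, hw⟩ := D.curve_meet e he f hf hef s (armJ_sub D e _ hs) t (armJ_sub D f _ ht) hy.symm
      have h1 := arm_pos D he hu hs hw
      rw [← hy] at hw
      have h2 := arm_pos D hf hv ht hw
      exact huv (h1.symm.trans h2)

theorem Mid_sub : Set.Icc (1/3:ℝ) (2/3) ⊆ Set.Icc 0 1 :=
  Set.Icc_subset_Icc (by norm_num) (by norm_num)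

theorem Mid_pos {e : Sym2 V} (he : e ∈ G.edgeSet) {t : ℝ}
    (ht : t ∈ Set.Icc (1/3:ℝ) (2/3)) {w : V} (hw : D.curve e t = D.pos w) : False := by
  rcases t01 D he (Mid_sub ht) hw with rfl | rfl
  · have := ht.1; norm_num at this
  · have := ht.2; norm_num at this

theorem Mid_disj {e f : Sym2 V} (he : e ∈ G.edgeSet) (hf : f ∈ G.edgeSet) (hef : e ≠ f) :
    Disjoint (Mid D e) (Mid D f) := by
  rw [Set.disjoint_left]
  rintro x ⟨s, hs, rfl⟩ ⟨t, ht, h⟩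
  obtain ⟨w, -, -, hw⟩ := D.curve_meet e he f hf hef s (Mid_sub hs) t (Mid_sub ht) h.symm
  exact Mid_pos D he hs hw

theorem Mid_Kst {e : Sym2 V} (he : e ∈ G.edgeSet) {w : V} (hw : w ∉ e) :
    Disjoint (Mid D e) (Kst D w) := by
  rw [Set.disjoint_left]
  rintro x ⟨s, hs, rfl⟩ hx
  rw [mem_Kst] at hx
  rcases hx with hx | ⟨f, hf, hv, t, ht, hy⟩
  · exact Mid_pos D he hs hx
  · have hef : e ≠ f := by rintro rfl; exact hw hv
    obtain ⟨w, -, -, hw⟩ := D.curve_meet e he f hf hef s (Mid_sub hs) t (armJ_sub D f _ ht) hy.symm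
    exact Mid_pos D he hs hw

theorem Mid_meet {e : Sym2 V} (he : e ∈ G.edgeSet) {w : V} (hw : w ∈ e) :
    ∃ x, x ∈ Mid D e ∧ x ∈ Kst D w := by
  by_cases h : D.curve e 0 = D.pos w
  · refine ⟨D.curve e (1/3), ⟨_, by norm_num, rfl⟩, ?_⟩
    rw [mem_Kst]
    refine Or.inr ⟨e, he, hw, 1/3, ?_, rfl⟩
    unfold armJ; rw [if_pos h]; norm_num
  · refine ⟨D.curve e (2/3), ⟨_, by norm_num, rfl⟩, ?_⟩
    rw [mem_Kst]
    refine Or.inr ⟨e, he, hw, 2/3, ?_, rfl⟩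
    unfold armJ; rw [if_neg h]; norm_num

theorem Mid_compact {e : Sym2 V} (he : e ∈ G.edgeSet) : IsCompact (Mid D e) :=
  isCompact_Icc.image_of_continuousOn ((D.curve_cont e he).mono Mid_sub)

theorem Mid_conn {e : Sym2 V} (he : e ∈ G.edgeSet) : IsPreconnected (Mid D e) :=
  isPreconnected_Icc.image _ ((D.curve_cont e he).mono Mid_sub)
end sets

/-- uniform separation -/
theorem sep_unif {ι : Type*} [Finite ι] (F : ι → Set E2) (hc : ∀ i, IsCompact (F i)) :
    ∃ ε > 0, ∀ i j, Disjoint (F i) (F j) → ∀ x ∈ F i, ∀ y ∈ F j, ε ≤ dist x y := by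
  have : ∀ p : ι × ι, ∃ ε > 0, Disjoint (F p.1) (F p.2) → ∀ x ∈ F p.1, ∀ y ∈ F p.2, ε ≤ dist x y := by
    intro p
    by_cases h : Disjoint (F p.1) (F p.2)
    · obtain ⟨δ, hδ, hd⟩ := h.exists_thickenings (hc p.1) (hc p.2).isClosed
      refine ⟨δ, hδ, fun _ x hx y hy => ?_⟩
      by_contra hlt
      push Not at hlt
      exact Set.disjoint_left.1 hd (Metric.mem_thickening_iff.2 ⟨x, hx, by rwa [dist_comm]⟩)
        (Metric.self_subset_thickening hδ _ hy)
    · exact ⟨1, one_pos, fun h' => absurd h' h⟩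
  choose ε hε h using this
  rcases isEmpty_or_nonempty ι with he | he
  · exact ⟨1, one_pos, fun i => he.elim i⟩
  obtain ⟨p0, hp0⟩ := Finite.exists_min ε
  exact ⟨ε p0, hε p0, fun i j hij x hx y hy => (hp0 (i, j)).trans (h (i, j) hij x hx y hy)⟩

/-- grid adjacency -/
def adj4 (a b : ℕ × ℕ) : Prop :=
  (a.2 = b.2 ∧ (a.1 + 1 = b.1 ∨ b.1 + 1 = a.1)) ∨ (a.1 = b.1 ∧ (a.2 + 1 = b.2 ∨ b.2 + 1 = a.2))

theorem adj4_symm {a b : ℕ × ℕ} (h : adj4 a b) : adj4 b a := by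
  unfold adj4 at *; omega

/-- grid connectedness -/
def Conn4 (S : Set (ℕ × ℕ)) : Prop :=
  ∀ A : Set (ℕ × ℕ), (∀ a b, a ∈ A → a ∈ S → b ∈ S → adj4 a b → b ∈ A) →
    ∀ a b, a ∈ A → a ∈ S → b ∈ S → b ∈ A

/-- closed square -/
def sq (R δ : ℝ) (c : ℕ × ℕ) : Set E2 :=
  {x | |(x 0 + R) / δ - c.1| ≤ 1/2 ∧ |(x 1 + R) / δ - c.2| ≤ 1/2}

theorem sq_closed (R δ : ℝ) (c : ℕ × ℕ) : IsClosed (sq R δ c) := by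
  exact (isClosed_le (f := fun x : E2 => |(x 0 + R) / δ - c.1|) (g := fun _ => 1/2)
    (by fun_prop) (by fun_prop)).inter
    (isClosed_le (f := fun x : E2 => |(x 1 + R) / δ - c.2|) (g := fun _ => 1/2)
    (by fun_prop) (by fun_prop))

/-- cells meeting a set -/
def cells (R δ : ℝ) (K : Set E2) : Set (ℕ × ℕ) := {c | ∃ x ∈ K, x ∈ sq R δ c}

theorem near_nat {a : ℝ} (h : 0 ≤ a) : ∃ i : ℕ, |a - i| ≤ 1/2 := by
  refine ⟨⌊a + 1/2⌋₊, ?_⟩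
  have h1 := Nat.floor_le (show 0 ≤ a + 1/2 by linarith)
  have h2 := Nat.lt_floor_add_one (a + 1/2)
  rw [abs_le]; constructor <;> linarith

theorem near_nat2 {a : ℝ} {i j : ℕ} (h : |a - i| ≤ 1/2) (h' : |a - j| ≤ 1/2) :
    i = j ∨ i + 1 = j ∨ j + 1 = i := by
  rw [abs_le] at h h'
  have h1 : (i:ℝ) ≤ j + 1 := by linarith
  have h2 : (j:ℝ) ≤ i + 1 := by linarith
  have h1 : i ≤ j + 1 := by exact_mod_cast h1
  have h2 : j ≤ i + 1 := by exact_mod_cast h2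
  omega

theorem cells_conn {R δ : ℝ} {K : Set E2} (hK : IsPreconnected K)
    (hpos : ∀ x ∈ K, 0 ≤ (x 0 + R) / δ ∧ 0 ≤ (x 1 + R) / δ) (hfin : (cells R δ K).Finite) :
    Conn4 (cells R δ K) := by
  intro A hA a b ha haS hbS
  by_contra hb
  have hP : IsClosed (⋃ c ∈ cells R δ K ∩ A, sq R δ c) :=
    (hfin.inter_of_left _).isClosed_biUnion fun c _ => sq_closed R δ c
  have hQ : IsClosed (⋃ c ∈ cells R δ K \ A, sq R δ c) :=
    (hfin.sdiff).isClosed_biUnion fun c _ => sq_closed R δ c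
  have hcov : K ⊆ (⋃ c ∈ cells R δ K ∩ A, sq R δ c) ∪ (⋃ c ∈ cells R δ K \ A, sq R δ c) := by
    intro x hx
    obtain ⟨i, hi⟩ := near_nat (hpos x hx).1
    obtain ⟨j, hj⟩ := near_nat (hpos x hx).2
    have hs : x ∈ sq R δ (i, j) := ⟨hi, hj⟩
    have hc : (i, j) ∈ cells R δ K := ⟨x, hx, hs⟩
    by_cases h : (i, j) ∈ A
    · exact Or.inl (Set.mem_biUnion (show (i, j) ∈ cells R δ K ∩ A from ⟨hc, h⟩) hs)
    · exact Or.inr (Set.mem_biUnion (show (i, j) ∈ cells R δ K \ A from ⟨hc, h⟩) hs)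
  obtain ⟨xa, hxa, hsa⟩ := id haS
  obtain ⟨xb, hxb, hsb⟩ := id hbS
  obtain ⟨x, hxK, hx1, hx2⟩ := isPreconnected_closed_iff.1 hK _ _ hP hQ hcov
    ⟨xa, hxa, Set.mem_biUnion (show a ∈ cells R δ K ∩ A from ⟨haS, ha⟩) hsa⟩
    ⟨xb, hxb, Set.mem_biUnion (show b ∈ cells R δ K \ A from ⟨hbS, hb⟩) hsb⟩
  rw [Set.mem_iUnion₂] at hx1 hx2
  obtain ⟨⟨i, j⟩, ⟨hc1, hA1⟩, hs1⟩ := hx1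
  obtain ⟨⟨i', j'⟩, ⟨hc2, hA2⟩, hs2⟩ := hx2
  have hm : (i', j) ∈ cells R δ K := ⟨x, hxK, hs2.1, hs1.2⟩
  have e1 := near_nat2 hs1.1 hs2.1
  have e2 := near_nat2 hs1.2 hs2.2
  simp only at e1 e2
  have hm' : (i', j) ∈ A := by
    rcases e1 with e1 | e1
    · rw [← e1]; exact hA1
    · exact hA _ _ hA1 hc1 hm (Or.inl ⟨rfl, e1⟩)
  apply hA2
  rcases e2 with e2 | e2
  · rw [← e2]; exact hm'
  · exact hA _ _ hm' hm hc2 (Or.inr ⟨rfl, e2⟩)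

theorem cells_disj {R δ ε : ℝ} (hδ : 0 < δ) (hε : 2 * δ < ε) {K L : Set E2}
    (h : ∀ x ∈ K, ∀ y ∈ L, ε ≤ dist x y) : ∀ c, c ∈ cells R δ K → c ∉ cells R δ L := by
  rintro c ⟨x, hx, h1, h2⟩ ⟨y, hy, h3, h4⟩
  have hd := h x hx y hy
  have key : ∀ (s t : ℝ) (n : ℕ), |(s + R) / δ - n| ≤ 1/2 → |(t + R) / δ - n| ≤ 1/2 → |s - t| ≤ δ := by
    intro s t n h h'
    have e : s - t = δ * (((s + R) / δ - n) - ((t + R) / δ - n)) := by field_simp; ring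
    rw [e, abs_mul, abs_of_pos hδ]
    have := abs_sub ((s + R) / δ - n) ((t + R) / δ - n)
    nlinarith
  have k1 := key _ _ _ h1 h3
  have k2 := key _ _ _ h2 h4
  rw [EuclideanSpace.dist_eq, Fin.sum_univ_two, Real.dist_eq, Real.dist_eq] at hd
  have : √(|x 0 - y 0| ^ 2 + |x 1 - y 1| ^ 2) ≤ 2 * δ := by
    rw [Real.sqrt_le_left (by positivity)]
    nlinarith [abs_nonneg (x 0 - y 0), abs_nonneg (x 1 - y 1)]
  linarith

theorem cells_bdd {R δ : ℝ} (hδ : 0 < δ) {n : ℕ} (hn : 2 * R / δ + 1 ≤ n) {K : Set E2}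
    (hK : ∀ x ∈ K, ‖x‖ ≤ R) : ∀ c ∈ cells R δ K, c.1 < n ∧ c.2 < n := by
  rintro c ⟨x, hx, h1, h2⟩
  have hb := hK x hx
  have key : ∀ (i : Fin 2) (m : ℕ), |(x i + R) / δ - m| ≤ 1/2 → m < n := by
    intro i m h
    have hi : x i ≤ R := (le_abs_self _).trans ((PiLp.norm_apply_le x i).trans hb)
    have : (x i + R) / δ ≤ 2 * R / δ := by gcongr; linarith
    rw [abs_le] at h
    have : (m:ℝ) < n := by linarith
    exact_mod_cast this
  exact ⟨key 0 _ h1, key 1 _ h2⟩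

theorem cells_pos {R δ : ℝ} (hδ : 0 < δ) {x : E2} (hx : ‖x‖ ≤ R) :
    0 ≤ (x 0 + R) / δ ∧ 0 ≤ (x 1 + R) / δ := by
  have key : ∀ i : Fin 2, 0 ≤ (x i + R) / δ := by
    intro i
    have hi : |x i| ≤ R := ((PiLp.norm_apply_le x i).trans hx)
    rw [abs_le] at hi
    apply div_nonneg _ hδ.le
    linarith
  exact ⟨key 0, key 1⟩

theorem cells_mem {R δ : ℝ} (hδ : 0 < δ) {x : E2} (hx : ‖x‖ ≤ R) : ∃ c, x ∈ sq R δ c := by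
  obtain ⟨h1, h2⟩ := cells_pos hδ hx
  obtain ⟨i, hi⟩ := near_nat h1
  obtain ⟨j, hj⟩ := near_nat h2
  exact ⟨(i, j), hi, hj⟩

/-- reachability -/
inductive Rch (S A : Set (ℕ × ℕ)) : ℕ × ℕ → Prop
  | base (c) (h : c ∈ S) : Rch S A c
  | step (c d) (h : Rch S A c) (h1 : adj4 c d) (h2 : d ∈ A) : Rch S A d

section comb
variable {V : Type*} {G : SimpleGraph V} {B0 : V → Set (ℕ × ℕ)} {C : Sym2 V → Set (ℕ × ℕ)}

theorem comb_grid (b1 : ∀ v, (B0 v).Nonempty) (b2 : ∀ v, Conn4 (B0 v))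
    (b3 : ∀ u v, u ≠ v → ∀ c, c ∈ B0 u → c ∉ B0 v)
    (c1 : ∀ e ∈ G.edgeSet, Conn4 (C e))
    (c2 : ∀ e ∈ G.edgeSet, ∀ f ∈ G.edgeSet, e ≠ f → ∀ c, c ∈ C e → c ∉ C f)
    (c3 : ∀ e ∈ G.edgeSet, ∀ w, w ∉ e → ∀ c, c ∈ C e → c ∉ B0 w)
    (c4 : ∀ e ∈ G.edgeSet, ∀ w ∈ e, ∃ c, c ∈ C e ∧ c ∈ B0 w) :
    ∃ B : V → Set (ℕ × ℕ), (∀ v, (B v).Nonempty) ∧ (∀ v, Conn4 (B v)) ∧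
      (∀ u v, u ≠ v → ∀ c, c ∈ B u → c ∉ B v) ∧
      (∀ u v, G.Adj u v → ∃ a b, a ∈ B u ∧ b ∈ B v ∧ adj4 a b) ∧
      (∀ v c, c ∈ B v → c ∈ B0 v ∨ ∃ e ∈ G.edgeSet, c ∈ C e) := by
  have hor : ∀ e : Sym2 V, ∃ p : V × V, e = s(p.1, p.2) := by
    intro e
    induction e using Sym2.ind with
    | _ a b => exact ⟨(a, b), rfl⟩
  choose o ho using hor
  have m1 : ∀ e, (o e).1 ∈ e := fun e => by
    have h := Sym2.mem_mk_left (o e).1 (o e).2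
    rwa [← ho e] at h
  have m2 : ∀ e, (o e).2 ∈ e := fun e => by
    have h := Sym2.mem_mk_right (o e).1 (o e).2
    rwa [← ho e] at h
  have m3 : ∀ e w, w ∈ e → w = (o e).1 ∨ w = (o e).2 := fun e w hw => by
    rw [ho e, Sym2.mem_iff] at hw
    exact hw
  have m4 : ∀ e ∈ G.edgeSet, (o e).1 ≠ (o e).2 := fun e he => by
    rw [ho e] at he
    exact G.ne_of_adj he
  let D : Sym2 V → Set (ℕ × ℕ) := fun e => {c | Rch (C e ∩ B0 (o e).1) (C e \ B0 (o e).2) c}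
  have d1 : ∀ e c, c ∈ D e → c ∈ C e := by
    intro e c hc
    induction hc with
    | base c h => exact h.1
    | step c d h h1 h2 => exact h2.1
  have d2 : ∀ e ∈ G.edgeSet, ∀ c, c ∈ D e → c ∉ B0 (o e).2 := by
    intro e he c hc
    induction hc with
    | base c h => exact b3 _ _ (m4 e he) c h.2
    | step c d h h1 h2 => exact h2.2
  let B : V → Set (ℕ × ℕ) := fun v => {c | c ∈ B0 v ∨ ∃ e ∈ G.edgeSet, (o e).1 = v ∧ c ∈ D e}
  have B0D : ∀ u v, u ≠ v → ∀ e ∈ G.edgeSet, (o e).1 = u → ∀ c, c ∈ D e → c ∉ B0 v := by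
    intro u v huv e he hu c hc
    by_cases hv : v ∈ e
    · rcases m3 e v hv with h | h
      · exact absurd (hu.symm.trans h.symm) huv
      · rw [h]; exact d2 e he c hc
    · exact c3 e he v hv c (d1 e c hc)
  refine ⟨B, fun v => (b1 v).mono fun c hc => Or.inl hc, ?_, ?_, ?_, ?_⟩
  · intro v A hA a b ha haS hbS
    have root : ∀ e ∈ G.edgeSet, (o e).1 = v → ∀ c, c ∈ D e → ∃ r ∈ B0 v, (r ∈ A ↔ c ∈ A) := by
      intro e he hv c hc
      induction hc with
      | base c h => exact ⟨c, hv ▸ h.2, Iff.rfl⟩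
      | step c d h h1 h2 ih =>
        obtain ⟨r, hr, hrc⟩ := ih
        have hcB : c ∈ B v := Or.inr ⟨e, he, hv, h⟩
        have hdB : d ∈ B v := Or.inr ⟨e, he, hv, Rch.step c d h h1 h2⟩
        refine ⟨r, hr, hrc.trans ⟨fun h' => hA _ _ h' hcB hdB h1, fun h' => hA _ _ h' hdB hcB (adj4_symm h1)⟩⟩
    have hB0 : ∀ r s, r ∈ B0 v → r ∈ A → s ∈ B0 v → s ∈ A := by
      intro r s hr hrA hs
      exact b2 v A (fun a b h1 h2 h3 h4 => hA a b h1 (Or.inl h2) (Or.inl h3) h4) r s hrA hr hs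
    have hex : ∃ r ∈ B0 v, r ∈ A := by
      rcases haS with h | ⟨e, he, hv, hc⟩
      · exact ⟨a, h, ha⟩
      · obtain ⟨r, hr, hrc⟩ := root e he hv a hc
        exact ⟨r, hr, hrc.2 ha⟩
    obtain ⟨r, hr, hrA⟩ := hex
    rcases hbS with h | ⟨e, he, hv, hc⟩
    · exact hB0 r b hr hrA h
    · obtain ⟨r', hr', hrc⟩ := root e he hv b hc
      exact hrc.1 (hB0 r r' hr hrA hr')
  · rintro u v huv c (h1 | ⟨e, he, hu, h1⟩) (h2 | ⟨f, hf, hv, h2⟩)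
    · exact b3 u v huv c h1 h2
    · exact B0D v u huv.symm f hf hv c h2 h1
    · exact B0D u v huv e he hu c h1 h2
    · have hef : e ≠ f := by rintro rfl; exact huv (hu.symm.trans hv)
      exact c2 e he f hf hef c (d1 _ _ h1) (d1 _ _ h2)
  · have key : ∀ e ∈ G.edgeSet, ∃ a b, a ∈ B (o e).1 ∧ b ∈ B (o e).2 ∧ adj4 a b := by
      intro e he
      by_contra hno
      push Not at hno
      obtain ⟨c, hc, hcB⟩ := c4 e he _ (m1 e)
      obtain ⟨d, hd, hdB⟩ := c4 e he _ (m2 e)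
      have : d ∈ D e := by
        refine c1 e he (D e) ?_ c d (Rch.base c ⟨hc, hcB⟩) hc hd
        intro a b ha haC hbC hab
        refine Rch.step a b ha hab ⟨hbC, fun hb => ?_⟩
        exact hno a b (Or.inr ⟨e, he, rfl, ha⟩) (Or.inl hb) hab
      exact d2 e he d this hdB
    intro u v huv
    obtain ⟨a, b, ha, hb, hab⟩ := key s(u, v) huv
    have h3 := ho s(u, v)
    rw [Sym2.eq_iff] at h3
    rcases h3 with ⟨h3, h4⟩ | ⟨h3, h4⟩
    · rw [← h3] at ha; rw [← h4] at hb
      exact ⟨a, b, ha, hb, hab⟩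
    · rw [← h4] at ha; rw [← h3] at hb
      exact ⟨b, a, hb, ha, adj4_symm hab⟩
  · rintro v c (h | ⟨e, he, -, h⟩)
    · exact Or.inl h
    · exact Or.inr ⟨e, he, d1 _ _ h⟩
end comb

theorem drawing_grid {V : Type*} [Finite V] {G : SimpleGraph V} (D : ProperDrawing G) :
    ∃ (n : ℕ) (B : V → Set (ℕ × ℕ)), 2 ≤ n ∧ (∀ v, (B v).Nonempty) ∧ (∀ v, Conn4 (B v)) ∧
      (∀ u v, u ≠ v → ∀ c, c ∈ B u → c ∉ B v) ∧
      (∀ u v, G.Adj u v → ∃ a b, a ∈ B u ∧ b ∈ B v ∧ adj4 a b) ∧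
      (∀ v c, c ∈ B v → c.1 < n ∧ c.2 < n) := by
  let F : V ⊕ G.edgeSet → Set E2 := Sum.elim (Kst D) (fun e => Mid D e.1)
  have hF : ∀ i, IsCompact (F i) := by
    rintro (v | e)
    · exact Kst_compact D v
    · exact Mid_compact D e.2
  obtain ⟨ε, hε, hsep⟩ := sep_unif F hF
  obtain ⟨R, hR⟩ : ∃ R, ∀ x ∈ ⋃ i, F i, ‖x‖ ≤ R :=
    (isCompact_iUnion hF).isBounded.exists_norm_le
  have hRi : ∀ i, ∀ x ∈ F i, ‖x‖ ≤ R := fun i x hx => hR x (Set.mem_iUnion.2 ⟨i, hx⟩)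
  let δ := ε / 3
  have hδ : 0 < δ := by positivity
  have h2δ : 2 * δ < ε := by simp only [δ]; linarith
  obtain ⟨n, hn⟩ := exists_nat_ge (max (2 * R / δ + 1) 2)
  have hn1 : 2 * R / δ + 1 ≤ n := (le_max_left _ _).trans hn
  have hn2 : 2 ≤ n := by exact_mod_cast (le_max_right _ _).trans hn
  have hbd : ∀ i, ∀ c ∈ cells R δ (F i), c.1 < n ∧ c.2 < n := fun i => cells_bdd hδ hn1 (hRi i)
  have hfin : ∀ i, (cells R δ (F i)).Finite := fun i =>
    (Finset.range n ×ˢ Finset.range n).finite_toSet.subset fun c hc => by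
      have := hbd i c hc
      simpa using this
  have hcon : ∀ i, IsPreconnected (F i) → Conn4 (cells R δ (F i)) := fun i hi =>
    cells_conn hi (fun x hx => cells_pos hδ (hRi i x hx)) (hfin i)
  have hdis : ∀ i j, Disjoint (F i) (F j) → ∀ c, c ∈ cells R δ (F i) → c ∉ cells R δ (F j) :=
    fun i j hij => cells_disj hδ h2δ (hsep i j hij)
  obtain ⟨B, g1, g2, g3, g4, g5⟩ := comb_grid (G := G) (B0 := fun v => cells R δ (Kst D v))
    (C := fun e => cells R δ (Mid D e))
    (fun v => by
      have hx : D.pos v ∈ F (Sum.inl v) := (mem_Kst D).2 (Or.inl rfl)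
      obtain ⟨c, hc⟩ := cells_mem hδ (hRi (Sum.inl v) _ hx)
      exact ⟨c, _, hx, hc⟩)
    (fun v => hcon (Sum.inl v) (Kst_conn D v))
    (fun u v huv => hdis (Sum.inl u) (Sum.inl v) (Kst_disj D huv))
    (fun e he => hcon (Sum.inr ⟨e, he⟩) (Mid_conn D he))
    (fun e he f hf hef => hdis (Sum.inr ⟨e, he⟩) (Sum.inr ⟨f, hf⟩) (Mid_disj D he hf hef))
    (fun e he w hw => hdis (Sum.inr ⟨e, he⟩) (Sum.inl w) (Mid_Kst D he hw))
    (fun e he w hw => by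
      obtain ⟨x, hx1, hx2⟩ := Mid_meet D he hw
      obtain ⟨c, hc⟩ := cells_mem hδ (hRi (Sum.inl w) _ hx2)
      exact ⟨c, ⟨x, hx1, hc⟩, ⟨x, hx2, hc⟩⟩)
  refine ⟨n, B, hn2, g1, g2, g3, g4, ?_⟩
  intro v c hc
  rcases g5 v c hc with h | ⟨e, he, h⟩
  · exact hbd (Sum.inl v) c h
  · exact hbd (Sum.inr ⟨e, he⟩) c h

theorem drawing_St {V : Type*} [Finite V] {G : SimpleGraph V} (D : ProperDrawing G) :
    ∃ T β, St G T β := by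
  classical
  obtain ⟨n, B, hn, g1, g2, g3, g4, g5⟩ := drawing_grid D
  obtain ⟨T, hs, hv, ⟨q, s, ht, hq, hs'⟩, e1, e2⟩ := grid_sph n hn
  -- code of a cell
  let φ : ℕ × ℕ → ℕ := fun c => c.2 * n + c.1 + 2
  have φlt : ∀ c : ℕ × ℕ, c.1 < n → c.2 < n → c.2 * n + c.1 < n * n := by
    intro c h1 h2
    have : (c.2 + 1) * n ≤ n * n := Nat.mul_le_mul_right _ h2
    nlinarith
  have φinj : ∀ c d : ℕ × ℕ, c.1 < n → d.1 < n → φ c = φ d → c = d := by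
    intro c d hc hd h
    have h : c.2 * n + c.1 = d.2 * n + d.1 := by simp only [φ] at h; omega
    have k1 : c.1 = d.1 := by
      have := congrArg (· % n) h
      simpa [Nat.mul_add_mod_self_right, Nat.mod_eq_of_lt hc, Nat.mod_eq_of_lt hd] using this
    rw [k1] at h
    have k2 : c.2 * n = d.2 * n := by omega
    exact Prod.ext k1 (Nat.eq_of_mul_eq_mul_right (by omega) k2)
  have φadj : ∀ c d : ℕ × ℕ, c.1 < n → c.2 < n → d.1 < n → d.2 < n → adj4 c d → Adj T (φ c) (φ d) := by
    rintro ⟨i, j⟩ ⟨i', j'⟩ h1 h2 h3 h4 (⟨h, h' | h'⟩ | ⟨h, h' | h'⟩) <;> simp only at h h' h1 h2 h3 h4 <;>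
      subst h <;> subst h'
    · exact e1 i j h3 h2
    · exact hs.adj_symm (e1 i' j h1 h2)
    · exact e2 i j h1 h4
    · exact hs.adj_symm (e2 i j' h1 h2)
  let β : ℕ → Option V := fun a => if h : ∃ v c, c ∈ B v ∧ φ c = a then some h.choose else none
  have hβ : ∀ a v, β a = some v ↔ ∃ c, c ∈ B v ∧ φ c = a := by
    intro a v
    simp only [β]
    by_cases h : ∃ v c, c ∈ B v ∧ φ c = a
    · rw [dif_pos h]
      obtain ⟨c, hc, hca⟩ := h.choose_spec
      constructor
      · intro h'
        rw [← Option.some.inj h']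
        exact ⟨c, hc, hca⟩
      · rintro ⟨d, hd, hda⟩
        have : c = d := φinj c d (g5 _ _ hc).1 (g5 _ _ hd).1 (hca.trans hda.symm)
        subst this
        by_contra hne
        exact g3 _ v (fun h => hne (congrArg some h)) c hc hd
    · rw [dif_neg h]
      constructor
      · intro h'; cases h'
      · rintro ⟨c, hc⟩; exact absurd ⟨v, c, hc⟩ h
  have hnone : ∀ a, (a = 0 ∨ n * n + 2 ≤ a) → β a = none := by
    intro a ha
    by_contra hne
    obtain ⟨v, hv⟩ := Option.ne_none_iff_exists'.1 hne
    obtain ⟨c, hc, rfl⟩ := (hβ a v).1 hv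
    have := φlt c (g5 _ _ hc).1 (g5 _ _ hc).2
    simp only [φ] at ha
    omega
  refine ⟨T, β, hs, ⟨0, q, s, ht, hnone _ (Or.inl rfl), hnone _ (Or.inr hq), hnone _ (Or.inr hs')⟩,
    ?_, ?_, ?_, ?_⟩
  · intro a v ha
    obtain ⟨c, hc, rfl⟩ := (hβ a v).1 ha
    exact hv _ (φlt c (g5 _ _ hc).1 (g5 _ _ hc).2)
  · intro v
    obtain ⟨c, hc⟩ := g1 v
    exact ⟨φ c, (hβ _ _).2 ⟨c, hc, rfl⟩⟩
  · intro v A hA a b ha hav hbv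
    obtain ⟨c, hc, rfl⟩ := (hβ _ _).1 hav
    obtain ⟨d, hd, rfl⟩ := (hβ _ _).1 hbv
    refine g2 v {c | φ c ∈ A} ?_ c d ha hc hd
    intro s t hs hsB htB hst
    exact hA _ _ hs ((hβ _ _).2 ⟨s, hsB, rfl⟩) ((hβ _ _).2 ⟨t, htB, rfl⟩)
      (φadj s t (g5 _ _ hsB).1 (g5 _ _ hsB).2 (g5 _ _ htB).1 (g5 _ _ htB).2 hst)
  · intro u v huv
    obtain ⟨a, b, ha, hb, hab⟩ := g4 u v huv
    exact ⟨φ a, φ b, (hβ _ _).2 ⟨a, ha, rfl⟩, (hβ _ _).2 ⟨b, hb, rfl⟩,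
      φadj a b (g5 _ _ ha).1 (g5 _ _ ha).2 (g5 _ _ hb).1 (g5 _ _ hb).2 hab⟩

end Koebe


namespace Koebe
set_option linter.unusedSectionVars false
set_option linter.unusedVariables false

section
variable {T : Finset (ℕ × ℕ × ℕ)} (h : Sph T)
include h

/-- dual connectivity -/
theorem Sph.dual (P : ℕ → ℕ → ℕ → Prop) (hrot : ∀ a b c, (a, b, c) ∈ T → P a b c → P b c a)
    (hcr : ∀ a b c d, (a, b, c) ∈ T → (b, a, d) ∈ T → P a b c → P b a d)
    {a b c : ℕ} (ht : (a, b, c) ∈ T) (hP : P a b c) : ∀ a' b' c', (a', b', c') ∈ T → P a' b' c' := by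
  have key : ∀ v x y, (v, x, y) ∈ T → P v x y → ∀ b c, (v, b, c) ∈ T → P v b c := by
    intro v x y hv hp b c hb
    refine h.link v {x | ∀ y, (v, x, y) ∈ T → P v x y} ?_ x y b c ?_ hv hb c hb
    · intro s t hs hst u htu
      have h1 := hs t hst
      have h2 := hrot _ _ _ (h.rot _ _ _ hst) (hrot _ _ _ hst h1)
      exact hcr _ _ _ _ (h.rot _ _ _ (h.rot _ _ _ hst)) htu h2
    · intro z hz
      rwa [h.uniq _ _ _ _ hz hv]
  intro a' b' c' ht'
  refine h.conn {v | ∀ b c, (v, b, c) ∈ T → P v b c} ?_ a b c a' b' c' ?_ ht ht' b' c' ht'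
  · intro x y z hx hxyz
    exact key _ _ _ (h.rot _ _ _ hxyz) (hrot _ _ _ hxyz (hx _ _ hxyz))
  · exact key _ _ _ ht hP

theorem Sph.sum_rot {M : Type*} [AddCommMonoid M] (f : ℕ → ℕ → ℕ → M) :
    ∑ t ∈ T, f t.1 t.2.1 t.2.2 = ∑ t ∈ T, f t.2.1 t.2.2 t.1 := by
  symm
  refine Finset.sum_bij (fun t _ => (t.2.1, t.2.2, t.1)) ?_ ?_ ?_ ?_
  · rintro ⟨a, b, c⟩ ht; exact h.rot _ _ _ ht
  · rintro ⟨a, b, c⟩ _ ⟨a', b', c'⟩ _ e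
    simp only [Prod.mk.injEq] at e ⊢
    exact ⟨e.2.2, e.1, e.2.1⟩
  · rintro ⟨a, b, c⟩ ht
    exact ⟨(c, a, b), h.rot _ _ _ (h.rot _ _ _ ht), rfl⟩
  · rintro ⟨a, b, c⟩ _; rfl

/-- connected graph bound -/
theorem conn_bound {Y : Finset ℕ} (hY : Y.Nonempty) {D : Finset (ℕ × ℕ × ℕ)} (hDT : D ⊆ T)
    (hsym : ∀ a b c d, (a, b, c) ∈ D → (b, a, d) ∈ T → (b, a, d) ∈ D)
    (hDY : ∀ a b c, (a, b, c) ∈ D → a ∈ Y ∧ b ∈ Y)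
    (hc : ∀ A : Set ℕ, (∀ a b c, (a, b, c) ∈ D → a ∈ A → b ∈ A) → ∀ a ∈ Y, ∀ b ∈ Y, a ∈ A → b ∈ A) :
    2 * Y.card ≤ D.card + 2 := by
  classical
  let Γ : SimpleGraph Y :=
    { Adj := fun u v => ∃ c, (u.1, v.1, c) ∈ D
      symm := ⟨by
        rintro u v ⟨c, hc⟩
        obtain ⟨d, hd⟩ := h.opp _ _ _ (hDT hc)
        exact ⟨d, hsym _ _ _ _ hc hd⟩⟩
      loopless := ⟨by
        rintro u ⟨c, hc⟩
        exact h.ne _ _ _ (hDT hc) rfl⟩ }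
  have hconn : Γ.Connected := by
    haveI : Nonempty Y := hY.to_subtype
    refine SimpleGraph.Connected.mk ?_
    intro u v
    have := hc {x | ∃ hx : x ∈ Y, Γ.Reachable u ⟨x, hx⟩} (by
      rintro a b c habc ⟨ha, hr⟩
      refine ⟨(hDY _ _ _ habc).2, hr.trans (SimpleGraph.Adj.reachable ?_)⟩
      exact ⟨c, habc⟩) u.1 u.2 v.1 v.2 ⟨u.2, SimpleGraph.Reachable.refl _⟩
    exact this.2
  have h1 := hconn.card_vert_le_card_edgeSet_add_one
  have h2 := Γ.dart_card_eq_twice_card_edges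
  have h3 : Fintype.card Γ.Dart ≤ D.card := by
    rw [← Fintype.card_coe D]
    choose c hc using fun d : Γ.Dart => d.adj
    refine Fintype.card_le_of_injective (fun d => ⟨(d.fst.1, d.snd.1, c d), hc d⟩) ?_
    intro d e hde
    simp only [Subtype.mk.injEq, Prod.mk.injEq] at hde
    ext
    · exact hde.1
    · exact hde.2.1
  rw [Nat.card_eq_fintype_card, Fintype.card_coe, Nat.card_eq_fintype_card,
    ← SimpleGraph.edgeFinset_card] at h1
  omega

theorem euler_aux {Y : Finset ℕ} (hY : Y.Nonempty) (k : ℕ) : ∀ (P D : Finset (ℕ × ℕ × ℕ)),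
    P.card ≤ k → D ⊆ T → P ⊆ D → P ≠ T →
    (∀ a b c, (a, b, c) ∈ P → (b, c, a) ∈ P) →
    (∀ a b c d, (a, b, c) ∈ D → (b, a, d) ∈ T → (b, a, d) ∈ D) →
    (∀ a b c, (a, b, c) ∈ D → a ∈ Y ∧ b ∈ Y) →
    (∀ A : Set ℕ, (∀ a b c, (a, b, c) ∈ D → a ∈ A → b ∈ A) → ∀ a ∈ Y, ∀ b ∈ Y, a ∈ A → b ∈ A) →
    2 * P.card + 6 * Y.card ≤ 3 * D.card + 6 := by
  classical
  induction k with
  | zero =>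
    intro P D hk hDT hPD hPT hPr hsym hDY hc
    have := conn_bound h hY hDT hsym hDY hc
    omega
  | succ k ih =>
    intro P D hk hDT hPD hPT hPr hsym hDY hc
    by_cases hP0 : P = ∅
    · have := conn_bound h hY hDT hsym hDY hc
      rw [hP0, Finset.card_empty]; omega
    obtain ⟨⟨a0, b0, c0⟩, ht0⟩ := Finset.nonempty_iff_ne_empty.2 hP0
    have hPsub : P ⊆ T := hPD.trans hDT
    have : ∃ a b c d, (a, b, c) ∈ P ∧ (b, a, d) ∈ T ∧ (b, a, d) ∉ P := by
      by_contra hno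
      push Not at hno
      apply hPT
      apply Finset.Subset.antisymm hPsub
      rintro ⟨a, b, c⟩ ht
      exact h.dual (fun a b c => (a, b, c) ∈ P) (fun a b c _ hp => hPr a b c hp)
        (fun a b c d _ hd hp => hno a b c d hp hd) (hPsub ht0) ht0 a b c ht
    obtain ⟨a, b, c, d, hp, hd, hdP⟩ := this
    have hp2 := hPr _ _ _ hp
    have hp3 := hPr _ _ _ hp2
    have n1 := h.ne _ _ _ (hPsub hp)
    have n2 := h.ne2 (hPsub hp)
    have n3 := h.ne3 (hPsub hp)
    let P' := ((P.erase (a, b, c)).erase (b, c, a)).erase (c, a, b)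
    let D' := (D.erase (a, b, c)).erase (b, a, d)
    have hP'c : P'.card + 3 = P.card := by
      have e1 : (P.erase (a, b, c)).card + 1 = P.card := Finset.card_erase_add_one hp
      have e2 : ((P.erase (a, b, c)).erase (b, c, a)).card + 1 = (P.erase (a, b, c)).card :=
        Finset.card_erase_add_one (Finset.mem_erase.2 ⟨by simp [n1.symm], hp2⟩)
      have e3 : P'.card + 1 = ((P.erase (a, b, c)).erase (b, c, a)).card :=
        Finset.card_erase_add_one (Finset.mem_erase.2 ⟨by simp [n2.symm],
          Finset.mem_erase.2 ⟨by simp [n3], hp3⟩⟩)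
      omega
    have hdD := hsym _ _ _ _ (hPD hp) hd
    have hD'c : D'.card + 2 = D.card := by
      have e1 : (D.erase (a, b, c)).card + 1 = D.card := Finset.card_erase_add_one (hPD hp)
      have e2 : D'.card + 1 = (D.erase (a, b, c)).card :=
        Finset.card_erase_add_one (Finset.mem_erase.2 ⟨by simp [n1.symm], hdD⟩)
      omega
    have memD : ∀ x y z, (x, y, z) ∈ D' ↔ (x, y, z) ≠ (b, a, d) ∧ (x, y, z) ≠ (a, b, c) ∧ (x, y, z) ∈ D := by
      intro x y z; simp only [D', Finset.mem_erase]
    have memP : ∀ x y z, (x, y, z) ∈ P' ↔ (x, y, z) ≠ (c, a, b) ∧ (x, y, z) ≠ (b, c, a) ∧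
        (x, y, z) ≠ (a, b, c) ∧ (x, y, z) ∈ P := by
      intro x y z; simp only [P', Finset.mem_erase]
    have key := ih P' D' (by omega) ((Finset.erase_subset _ _).trans ((Finset.erase_subset _ _).trans hDT))
      ?_ ?_ ?_ ?_ ?_ ?_
    · omega
    · rintro ⟨x, y, z⟩ hx
      rw [memP] at hx
      rw [memD]
      refine ⟨?_, hx.2.2.1, hPD hx.2.2.2⟩
      intro e; rw [e] at hx; exact hdP hx.2.2.2
    · intro e
      have : (a, b, c) ∈ P' := by rw [e]; exact hPsub hp
      rw [memP] at this
      exact this.2.2.1 rfl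
    · intro x y z hx
      rw [memP] at hx ⊢
      simp only [ne_eq, Prod.mk.injEq] at hx ⊢
      refine ⟨fun e => hx.2.1 ⟨e.2.2, e.1, e.2.1⟩, fun e => hx.2.2.1 ⟨e.2.2, e.1, e.2.1⟩,
        fun e => hx.1 ⟨e.2.2, e.1, e.2.1⟩, hPr _ _ _ hx.2.2.2⟩
    · intro x y z w hx hw
      rw [memD] at hx ⊢
      refine ⟨?_, ?_, hsym _ _ _ _ hx.2.2 hw⟩
      · intro e
        simp only [Prod.mk.injEq] at e
        obtain ⟨rfl, rfl, rfl⟩ := e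
        exact hx.2.1 (by rw [h.uniq _ _ _ _ (hDT hx.2.2) (hPsub hp)])
      · intro e
        simp only [Prod.mk.injEq] at e
        obtain ⟨rfl, rfl, rfl⟩ := e
        exact hx.1 (by rw [h.uniq _ _ _ _ (hDT hx.2.2) hd])
    · intro x y z hx
      rw [memD] at hx
      exact hDY _ _ _ hx.2.2
    · intro A hA
      refine hc A ?_
      obtain ⟨e1, he1⟩ := h.opp _ _ _ (hPsub hp2)
      obtain ⟨e2, he2⟩ := h.opp _ _ _ (hPsub hp3)
      have q1 : (b, c, a) ∈ D' := (memD _ _ _).2 ⟨by simp [n3], by simp [n1.symm], hPD hp2⟩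
      have q2 : (c, a, b) ∈ D' := (memD _ _ _).2 ⟨by simp [n2.symm], by simp [n3], hPD hp3⟩
      have q3 : (c, b, e1) ∈ D' := (memD _ _ _).2 ⟨by simp [n2.symm], by simp [n3], hsym _ _ _ _ (hPD hp2) he1⟩
      have q4 : (a, c, e2) ∈ D' := (memD _ _ _).2 ⟨by simp [n1], by simp [n2.symm], hsym _ _ _ _ (hPD hp3) he2⟩
      intro x y z hx hxA
      by_cases g1 : (x, y, z) = (b, a, d)
      · simp only [Prod.mk.injEq] at g1
        obtain ⟨rfl, rfl, rfl⟩ := g1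
        exact hA _ _ _ q2 (hA _ _ _ q1 hxA)
      by_cases g2 : (x, y, z) = (a, b, c)
      · simp only [Prod.mk.injEq] at g2
        obtain ⟨rfl, rfl, rfl⟩ := g2
        exact hA _ _ _ q3 (hA _ _ _ q4 hxA)
      exact hA _ _ _ ((memD _ _ _).2 ⟨g1, g2, hx⟩) hxA

omit h in
/-- touching count -/
def tau (T : Finset (ℕ × ℕ × ℕ)) (Y : Finset ℕ) : ℕ :=
  (T.filter (fun t => t.1 ∈ Y ∨ t.2.1 ∈ Y ∨ t.2.2 ∈ Y)).card

theorem tau_conn {Y : Finset ℕ} (hY : Y.Nonempty) {w : ℕ} (hw : w ∈ vs T) (hwY : w ∉ Y)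
    (hc : ∀ A : Set ℕ, (∀ a b, a ∈ Y → b ∈ Y → Adj T a b → a ∈ A → b ∈ A) →
      ∀ a ∈ Y, ∀ b ∈ Y, a ∈ A → b ∈ A) :
    6 * Y.card + 3 * (T.filter (fun t => t.1 ∉ Y ∧ t.2.1 ∉ Y ∧ t.2.2 ∈ Y)).card ≤ tau T Y + 6 := by
  classical
  have key := euler_aux h hY _ (T.filter (fun t => t.1 ∈ Y ∧ t.2.1 ∈ Y ∧ t.2.2 ∈ Y))
    (T.filter (fun t => t.1 ∈ Y ∧ t.2.1 ∈ Y)) le_rfl (Finset.filter_subset _ _) ?_ ?_ ?_ ?_ ?_ ?_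
  · simp only [Finset.card_filter] at key
    simp only [tau, Finset.card_filter]
    have r1 := h.sum_rot (fun a b c => if a ∈ Y ∧ b ∈ Y ∧ c ∉ Y then 1 else 0)
    have r2 := h.sum_rot (fun a b c => if b ∈ Y ∧ c ∈ Y ∧ a ∉ Y then 1 else 0)
    have r3 := h.sum_rot (fun a b c => if a ∉ Y ∧ b ∉ Y ∧ c ∈ Y then 1 else 0)
    have r4 := h.sum_rot (fun a b c => if b ∉ Y ∧ c ∉ Y ∧ a ∈ Y then 1 else 0)
    have s1 : ∑ t ∈ T, (if t.1 ∈ Y ∧ t.2.1 ∈ Y then 1 else 0) =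
        ∑ t ∈ T, (if t.1 ∈ Y ∧ t.2.1 ∈ Y ∧ t.2.2 ∈ Y then 1 else 0) +
        ∑ t ∈ T, (if t.1 ∈ Y ∧ t.2.1 ∈ Y ∧ t.2.2 ∉ Y then 1 else 0) := by
      rw [← Finset.sum_add_distrib]
      refine Finset.sum_congr rfl fun t _ => ?_
      by_cases a1 : t.1 ∈ Y <;> by_cases a2 : t.2.1 ∈ Y <;> by_cases a3 : t.2.2 ∈ Y <;>
        simp [a1, a2, a3]
    have s2 : ∑ t ∈ T, (if t.1 ∈ Y ∨ t.2.1 ∈ Y ∨ t.2.2 ∈ Y then 1 else 0) =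
        ∑ t ∈ T, (if t.1 ∈ Y ∧ t.2.1 ∈ Y ∧ t.2.2 ∈ Y then 1 else 0) +
        ∑ t ∈ T, (if t.1 ∈ Y ∧ t.2.1 ∈ Y ∧ t.2.2 ∉ Y then 1 else 0) +
        ∑ t ∈ T, (if t.2.1 ∈ Y ∧ t.2.2 ∈ Y ∧ t.1 ∉ Y then 1 else 0) +
        ∑ t ∈ T, (if t.2.2 ∈ Y ∧ t.1 ∈ Y ∧ t.2.1 ∉ Y then 1 else 0) +
        ∑ t ∈ T, (if t.1 ∉ Y ∧ t.2.1 ∉ Y ∧ t.2.2 ∈ Y then 1 else 0) +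
        ∑ t ∈ T, (if t.2.1 ∉ Y ∧ t.2.2 ∉ Y ∧ t.1 ∈ Y then 1 else 0) +
        ∑ t ∈ T, (if t.2.2 ∉ Y ∧ t.1 ∉ Y ∧ t.2.1 ∈ Y then 1 else 0) := by
      simp only [← Finset.sum_add_distrib]
      refine Finset.sum_congr rfl fun t _ => ?_
      by_cases a1 : t.1 ∈ Y <;> by_cases a2 : t.2.1 ∈ Y <;> by_cases a3 : t.2.2 ∈ Y <;>
        simp [a1, a2, a3]
    omega
  · intro t ht
    simp only [Finset.mem_filter] at ht ⊢
    exact ⟨ht.1, ht.2.1, ht.2.2.1⟩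
  · intro e
    obtain ⟨b, c, hbc⟩ := mem_vs.1 hw
    rw [← e, Finset.mem_filter] at hbc
    exact hwY hbc.2.1
  · intro a b c ht
    simp only [Finset.mem_filter] at ht ⊢
    exact ⟨h.rot _ _ _ ht.1, ht.2.2.1, ht.2.2.2, ht.2.1⟩
  · intro a b c d ht hd
    simp only [Finset.mem_filter] at ht ⊢
    exact ⟨hd, ht.2.2, ht.2.1⟩
  · intro a b c ht
    simp only [Finset.mem_filter] at ht
    exact ht.2
  · intro A hA
    refine hc A ?_
    rintro a b ha hb ⟨c, hc⟩
    exact hA a b c (by simp only [Finset.mem_filter]; exact ⟨hc, ha, hb⟩)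

theorem bdry3 {Y : Finset ℕ} (hYT : Y ⊆ vs T) (hY : Y.Nonempty) {p q s : ℕ} (ht : (p, q, s) ∈ T)
    (hp : p ∉ Y) (hq : q ∉ Y) (hs : s ∉ Y) :
    3 ≤ (T.filter (fun t => t.1 ∉ Y ∧ t.2.1 ∉ Y ∧ t.2.2 ∈ Y)).card := by
  classical
  set U := T.filter (fun t => t.1 ∉ Y ∧ t.2.1 ∉ Y ∧ t.2.2 ∈ Y) with hU
  have memU : ∀ a b c, (a, b, c) ∈ U ↔ (a, b, c) ∈ T ∧ a ∉ Y ∧ b ∉ Y ∧ c ∈ Y := by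
    intro a b c; simp [U, Finset.mem_filter]
  have next : ∀ a b c, (a, b, c) ∈ U → ∃ d e, (b, d, e) ∈ U := by
    intro a b c hu
    rw [memU] at hu
    by_contra hno
    push Not at hno
    obtain ⟨d, hd⟩ := h.opp _ _ _ hu.1
    have := h.link b {x | x ∉ Y} (by
      intro x y hx hxy hy
      exact hno x y ((memU _ _ _).2 ⟨hxy, hu.2.2.1, hx, hy⟩)) a d c a hu.2.1 hd (h.rot _ _ _ hu.1)
    exact this hu.2.2.2
  have turn : ∃ a b c d, (a, b, c) ∈ U ∧ (b, a, d) ∈ T ∧ (b, a, d) ∉ U := by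
    by_contra hno
    push Not at hno
    obtain ⟨y, hy⟩ := hY
    obtain ⟨b, c, hbc⟩ := mem_vs.1 (hYT hy)
    have := h.dual (fun a b c => a ∈ Y ∨ b ∈ Y ∨ c ∈ Y) (fun a b c _ h' => by tauto)
      (by
        intro a b c d habc hbad h'
        by_cases ha : a ∈ Y
        · exact Or.inr (Or.inl ha)
        by_cases hb : b ∈ Y
        · exact Or.inl hb
        have hc : c ∈ Y := by tauto
        have := hno a b c d ((memU _ _ _).2 ⟨habc, ha, hb, hc⟩) hbad
        exact Or.inr (Or.inr ((memU _ _ _).1 this).2.2.2)) hbc (Or.inl hy) p q s ht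
    tauto
  obtain ⟨a, b, c, d, hu, hd, hdU⟩ := turn
  obtain ⟨e, f, hu2⟩ := next _ _ _ hu
  obtain ⟨g, i, hu3⟩ := next _ _ _ hu2
  have n1 := h.ne _ _ _ ((memU _ _ _).1 hu).1
  have n2 := h.ne _ _ _ ((memU _ _ _).1 hu2).1
  have n3 : a ≠ e := by
    rintro rfl
    rw [h.uniq _ _ _ _ hd ((memU _ _ _).1 hu2).1] at hdU
    exact hdU hu2
  have hsub : ({(a, b, c), (b, e, f), (e, g, i)} : Finset (ℕ × ℕ × ℕ)) ⊆ U := by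
    simp only [Finset.insert_subset_iff, Finset.singleton_subset_iff]
    exact ⟨hu, hu2, hu3⟩
  have hcard : ({(a, b, c), (b, e, f), (e, g, i)} : Finset (ℕ × ℕ × ℕ)).card = 3 := by
    rw [Finset.card_insert_of_notMem, Finset.card_insert_of_notMem, Finset.card_singleton] <;>
      simp [n1, n2, n3]
  rw [← hcard]
  exact Finset.card_le_card hsub

theorem tau_main (k : ℕ) : ∀ Y : Finset ℕ, Y.card ≤ k → Y ⊆ vs T → Y.Nonempty →
    ((∃ w ∈ vs T, w ∉ Y) → 6 * Y.card ≤ tau T Y + 6) ∧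
    ((∃ p q s, (p, q, s) ∈ T ∧ p ∉ Y ∧ q ∉ Y ∧ s ∉ Y) → 6 * Y.card + 3 ≤ tau T Y) := by
  classical
  induction k with
  | zero => 
    intro Y hk hYT hY
    have := hY.card_pos
    omega
  | succ k ih =>
    intro Y hk hYT hY
    by_cases hc : ∀ A : Set ℕ, (∀ a b, a ∈ Y → b ∈ Y → Adj T a b → a ∈ A → b ∈ A) →
      ∀ a ∈ Y, ∀ b ∈ Y, a ∈ A → b ∈ A
    · constructor
      · rintro ⟨w, hw, hwY⟩
        have := tau_conn h hY hw hwY hc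
        omega
      · rintro ⟨p, q, s, ht, hp, hq, hs⟩
        have h1 := tau_conn h hY (h.m1 ht) hp hc
        have h2 := bdry3 h hYT hY ht hp hq hs
        omega
    · push Not at hc
      obtain ⟨A, hA, a, ha, b, hb, haA, hbA⟩ := hc
      set Y1 := Y.filter (fun x => x ∈ A)
      set Y2 := Y.filter (fun x => x ∉ A)
      have m1 : ∀ x, x ∈ Y1 ↔ x ∈ Y ∧ x ∈ A := fun x => by simp [Y1]
      have m2 : ∀ x, x ∈ Y2 ↔ x ∈ Y ∧ x ∉ A := fun x => by simp [Y2]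
      have ha1 : a ∈ Y1 := (m1 a).2 ⟨ha, haA⟩
      have hb2 : b ∈ Y2 := (m2 b).2 ⟨hb, hbA⟩
      have hcard : Y1.card + Y2.card = Y.card := Finset.card_filter_add_card_filter_not _
      have p1 := Finset.card_pos.2 ⟨a, ha1⟩
      have p2 := Finset.card_pos.2 ⟨b, hb2⟩
      have nadj : ∀ x y, x ∈ Y1 → y ∈ Y2 → ¬ Adj T x y := by
        intro x y hx hy hxy
        rw [m1] at hx; rw [m2] at hy
        exact hy.2 (hA x y hx.1 hy.1 hxy hx.2)
      have nadj' : ∀ x y, x ∈ Y1 → y ∈ Y2 → ¬ Adj T y x := fun x y hx hy hxy =>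
        nadj x y hx hy (h.adj_symm hxy)
      have nxy : ∀ x, x ∈ Y1 → x ∉ Y2 := by
        intro x hx hy; rw [m1] at hx; rw [m2] at hy; exact hy.2 hx.2
      have excl : ∀ x y z, (x, y, z) ∈ T → (x ∈ Y1 ∨ y ∈ Y1 ∨ z ∈ Y1) → ¬ (x ∈ Y2 ∨ y ∈ Y2 ∨ z ∈ Y2) := by
        intro x y z ht h1 h2
        have a1 : Adj T x y := ⟨_, ht⟩
        have a2 : Adj T y z := ⟨_, h.rot _ _ _ ht⟩
        have a3 : Adj T z x := ⟨_, h.rot _ _ _ (h.rot _ _ _ ht)⟩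
        rcases h1 with h1 | h1 | h1 <;> rcases h2 with h2 | h2 | h2
        exacts [nxy _ h1 h2, nadj _ _ h1 h2 a1, nadj' _ _ h1 h2 a3, nadj' _ _ h1 h2 a1, nxy _ h1 h2,
          nadj _ _ h1 h2 a2, nadj _ _ h1 h2 a3, nadj' _ _ h1 h2 a2, nxy _ h1 h2]
      have htau : tau T Y1 + tau T Y2 = tau T Y := by
        unfold tau
        rw [← Finset.card_union_of_disjoint]
        · congr 1
          ext ⟨x, y, z⟩
          simp only [Finset.mem_union, Finset.mem_filter, m1, m2]
          tauto
        · rw [Finset.disjoint_left]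
          rintro ⟨x, y, z⟩ h1 h2
          simp only [Finset.mem_filter] at h1 h2
          exact excl x y z h1.1 h1.2 h2.2
      obtain ⟨b1, c1, t1⟩ := mem_vs.1 (hYT ha)
      obtain ⟨b2, c2, t2⟩ := mem_vs.1 (hYT hb)
      have e1 := excl _ _ _ t1 (Or.inl ha1)
      have e2 : ¬ (b ∈ Y1 ∨ b2 ∈ Y1 ∨ c2 ∈ Y1) := fun h' => excl _ _ _ t2 h' (Or.inl hb2)
      push Not at e1 e2
      have i1 := (ih Y1 (by omega) ((Finset.filter_subset _ _).trans hYT) ⟨a, ha1⟩).2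
        ⟨b, b2, c2, t2, e2⟩
      have i2 := (ih Y2 (by omega) ((Finset.filter_subset _ _).trans hYT) ⟨b, hb2⟩).2
        ⟨a, b1, c1, t1, e1⟩
      constructor <;> intro _ <;> omega

/-- zero-set inequality -/
theorem tau_ge {S : Finset ℕ} (hS : S ⊆ vs T) (hne : S.Nonempty) {p q s : ℕ} (ht : (p, q, s) ∈ T)
    (hp : p ∉ S) (hq : q ∉ S) (hs : s ∉ S) : 6 * S.card + 3 ≤ tau T S :=
  (tau_main h _ S le_rfl hS hne).2 ⟨p, q, s, ht, hp, hq, hs⟩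

/-- infinity-set inequality -/
theorem n3_le {S : Finset ℕ} (hS : S ⊆ vs T) (hne : S.Nonempty) {p : ℕ} (hp : p ∈ vs T) (hpS : p ∉ S) :
    (T.filter (fun t => t.1 ∈ S ∧ t.2.1 ∈ S ∧ t.2.2 ∈ S)).card + 6 ≤ 6 * S.card := by
  classical
  obtain ⟨w, hw⟩ := hne
  have h1 := (tau_main h _ (vs T \ S) le_rfl Finset.sdiff_subset ⟨p, by simp [hp, hpS]⟩).1
    ⟨w, hS hw, by simp [hw]⟩
  have h2 : tau T (vs T \ S) + (T.filter (fun t => t.1 ∈ S ∧ t.2.1 ∈ S ∧ t.2.2 ∈ S)).card = T.card := by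
    unfold tau
    rw [← Finset.card_filter_add_card_filter_not (s := T)
      (fun t => t.1 ∈ vs T \ S ∨ t.2.1 ∈ vs T \ S ∨ t.2.2 ∈ vs T \ S)]
    congr 2
    ext ⟨x, y, z⟩
    simp only [Finset.mem_filter, Finset.mem_sdiff]
    constructor
    · rintro ⟨h1, h2⟩; exact ⟨h1, by tauto⟩
    · rintro ⟨h1, h2⟩
      have := h.m1 h1; have := h.m2 h1; have := h.m3 h1
      exact ⟨h1, by tauto⟩
  have h3 := h.count
  have h4 := Finset.card_sdiff_add_card_eq_card hS
  omega
end
end Koebe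


namespace Koebe
set_option linter.unusedSectionVars false
set_option linter.unusedVariables false
open Real Filter Topology

/-- angle at the disc of radius x in the triangle of mutually tangent discs of radii x y z -/
noncomputable def al (x y z : ℝ) : ℝ := 2 * arctan (√(y * z / (x * (x + y + z))))

theorem al_sum {x y z : ℝ} (hx : 0 < x) (hy : 0 < y) (hz : 0 < z) :
    al x y z + al y z x + al z x y = π := by
  unfold al
  set A := √(y * z / (x * (x + y + z)))
  set B := √(z * x / (y * (y + z + x)))
  set C := √(x * y / (z * (z + x + y)))
  have hA : 0 < A := Real.sqrt_pos.2 (by positivity)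
  have hB : 0 < B := Real.sqrt_pos.2 (by positivity)
  have hC : 0 < C := Real.sqrt_pos.2 (by positivity)
  have hAB : A * B = z / (x + y + z) := by
    rw [← Real.sqrt_mul (by positivity)]
    rw [show y * z / (x * (x + y + z)) * (z * x / (y * (y + z + x))) = (z / (x + y + z)) ^ 2 by
      rw [show y + z + x = x + y + z by ring]; field_simp]
    exact Real.sqrt_sq (by positivity)
  have hBC : B * C = x / (x + y + z) := by
    rw [← Real.sqrt_mul (by positivity)]
    rw [show z * x / (y * (y + z + x)) * (x * y / (z * (z + x + y))) = (x / (x + y + z)) ^ 2 by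
      rw [show y + z + x = x + y + z by ring, show z + x + y = x + y + z by ring]; field_simp]
    exact Real.sqrt_sq (by positivity)
  have hCA : C * A = y / (x + y + z) := by
    rw [← Real.sqrt_mul (by positivity)]
    rw [show x * y / (z * (z + x + y)) * (y * z / (x * (x + y + z))) = (y / (x + y + z)) ^ 2 by
      rw [show z + x + y = x + y + z by ring]; field_simp]
    exact Real.sqrt_sq (by positivity)
  have hsum : A * B + B * C + C * A = 1 := by
    rw [hAB, hBC, hCA]; field_simp; ring
  have h1 : A * B < 1 := by nlinarith [mul_pos hB hC, mul_pos hC hA]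
  have h2 := Real.arctan_add h1
  have h3 : (A + B) / (1 - A * B) = C⁻¹ := by
    rw [show 1 - A * B = C * (A + B) by linarith]
    field_simp
  rw [h3, Real.arctan_inv_of_pos hC] at h2
  linarith

theorem al_pos {x y z : ℝ} (hx : 0 < x) (hy : 0 < y) (hz : 0 < z) : 0 < al x y z := by
  unfold al
  have : 0 < √(y * z / (x * (x + y + z))) := Real.sqrt_pos.2 (by positivity)
  have := Real.arctan_pos.2 this
  linarith

theorem al_mono_y {x y y' z : ℝ} (hx : 0 < x) (hy : 0 < y) (hz : 0 < z) (h : y ≤ y') :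
    al x y z ≤ al x y' z := by
  unfold al
  have hy' : 0 < y' := hy.trans_le h
  gcongr 2 * ?_
  refine Real.arctan_strictMono.monotone (Real.sqrt_le_sqrt ?_)
  rw [div_le_div_iff₀ (by positivity) (by positivity)]
  have : 0 ≤ z * x * (x + z) * (y' - y) := by
    have := sub_nonneg.2 h
    positivity
  nlinarith

theorem al_swap {x y z : ℝ} : al x y z = al x z y := by
  unfold al
  rw [mul_comm y z, show x + y + z = x + z + y by ring]

theorem al_mono_z {x y z z' : ℝ} (hx : 0 < x) (hy : 0 < y) (hz : 0 < z) (h : z ≤ z') :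
    al x y z ≤ al x y z' := by
  rw [al_swap, al_swap (y := y)]
  exact al_mono_y hx hz hy h

theorem arctan_le_self' {t : ℝ} (h : 0 ≤ t) : arctan t ≤ t := by
  by_cases h' : arctan t < π / 2
  · have h1 := Real.le_tan (Real.arctan_nonneg.2 h) h'
    rwa [Real.tan_arctan] at h1
  · exact absurd (Real.arctan_lt_pi_div_two t) h'

theorem al_le {x y z : ℝ} (hx : 0 < x) (hy : 0 < y) (hz : 0 < z) : al x y z ≤ 2 * √(y / x) := by
  unfold al
  gcongr 2 * ?_
  refine (arctan_le_self' (Real.sqrt_nonneg _)).trans (Real.sqrt_le_sqrt ?_)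
  rw [div_le_div_iff₀ (by positivity) hx]
  have : 0 < x * y * (x + y) := by positivity
  nlinarith

theorem al_le' {x y z : ℝ} (hx : 0 < x) (hy : 0 < y) (hz : 0 < z) : al x y z ≤ 2 * √(z / x) := by
  rw [al_swap]; exact al_le hx hz hy

/-- total angle -/
noncomputable def theta (T : Finset (ℕ × ℕ × ℕ)) (r : ℕ → ℝ) (v : ℕ) : ℝ :=
  ∑ t ∈ T.filter (fun t => t.1 = v), al (r t.1) (r t.2.1) (r t.2.2)

theorem theta_sum (T : Finset (ℕ × ℕ × ℕ)) (r : ℕ → ℝ) (S : Finset ℕ) :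
    ∑ v ∈ S, theta T r v = ∑ t ∈ T, if t.1 ∈ S then al (r t.1) (r t.2.1) (r t.2.2) else 0 := by
  unfold theta
  simp only [Finset.sum_filter]
  rw [Finset.sum_comm]
  refine Finset.sum_congr rfl fun t _ => ?_
  rw [Finset.sum_ite_eq]

section
variable {T : Finset (ℕ × ℕ × ℕ)} (h : Sph T)
include h

theorem theta_sum3 (r : ℕ → ℝ) (S : Finset ℕ) :
    3 * ∑ v ∈ S, theta T r v = ∑ t ∈ T,
      ((if t.1 ∈ S then al (r t.1) (r t.2.1) (r t.2.2) else 0) +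
       (if t.2.1 ∈ S then al (r t.2.1) (r t.2.2) (r t.1) else 0) +
       (if t.2.2 ∈ S then al (r t.2.2) (r t.1) (r t.2.1) else 0)) := by
  have r1 := h.sum_rot (fun a b c => if a ∈ S then al (r a) (r b) (r c) else 0)
  have r2 := h.sum_rot (fun a b c => if b ∈ S then al (r b) (r c) (r a) else 0)
  simp only [Finset.sum_add_distrib]
  rw [← r2, ← r1, theta_sum]
  ring

/-- extremal configuration on a box -/
theorem box_min (I : Finset ℕ) (hI : ∀ v ∈ I, v ∈ vs T) (n : ℕ) : ∃ w : ℕ → ℝ,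
    (∀ a, a ∉ I → w a = 0) ∧
    (∀ a ∈ I, w a = n ∨ theta T (fun a => exp (w a)) a ≤ 2 * π) ∧
    (∀ a ∈ I, w a = -n ∨ 2 * π ≤ theta T (fun a => exp (w a)) a) := by
  classical
  let ex : (I → ℝ) → ℕ → ℝ := fun u a => if ha : a ∈ I then u ⟨a, ha⟩ else 0
  have exc : ∀ a, Continuous (fun u => ex u a) := by
    intro a
    by_cases ha : a ∈ I
    · simp only [ex, ha, dite_true]; fun_prop
    · simp only [ex, ha, dite_false]; fun_prop
  have exi : ∀ u (i : I), ex u i.1 = u i := by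
    intro u i; simp [ex]
  let Θ : (I → ℝ) → ℕ → ℝ := fun u a => theta T (fun a => exp (ex u a)) a
  have hΘ : ∀ a, Continuous (fun u => Θ u a) := by
    intro a
    simp only [Θ, theta, al]
    refine continuous_finsetSum _ fun t _ => ?_
    refine Continuous.const_mul ?_ _
    refine Real.continuous_arctan.comp (Real.continuous_sqrt.comp ?_)
    have e : ∀ a, Continuous (fun u => exp (ex u a)) := fun a => Real.continuous_exp.comp (exc a)
    refine Continuous.div ((e _).mul (e _)) ((e _).mul (((e _).add (e _)).add (e _))) ?_
    intro u
    positivity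
  let C : Set (I → ℝ) := Set.Icc (fun _ => -(n:ℝ)) (fun _ => (n:ℝ)) ∩ ⋂ i : I, ({u | u i = n} ∪ {u | Θ u i.1 ≤ 2 * π})
  have hC : IsCompact C := by
    refine isCompact_Icc.inter_right (isClosed_iInter fun i => IsClosed.union ?_ ?_)
    · exact isClosed_eq (f := fun u : I → ℝ => u i) (by fun_prop) continuous_const
    · exact isClosed_le (hΘ i.1) continuous_const
  have hne : C.Nonempty := by
    refine ⟨fun _ => (n:ℝ), ⟨?_, le_rfl⟩, Set.mem_iInter.2 fun i => Or.inl rfl⟩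
    intro i
    have : (0:ℝ) ≤ n := Nat.cast_nonneg n
    simp only; linarith
  obtain ⟨u, huC, hmin⟩ := hC.exists_isMinOn hne (f := fun u => ∑ i, u i)
    (Continuous.continuousOn (by fun_prop))
  have hbox := huC.1
  have hor : ∀ i : I, u i = n ∨ Θ u i.1 ≤ 2 * π := fun i => Set.mem_iInter.1 huC.2 i
  refine ⟨ex u, fun a ha => by simp [ex, ha], fun a ha => ?_, fun a ha => ?_⟩
  · have := hor ⟨a, ha⟩
    rw [← exi u ⟨a, ha⟩] at this
    exact this
  · by_contra hno
    push Not at hno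
    obtain ⟨hna, hlt⟩ := hno
    have e1 : ex u a = u ⟨a, ha⟩ := exi u ⟨a, ha⟩
    rw [e1] at hna
    have hgt : -(n:ℝ) < u ⟨a, ha⟩ := lt_of_le_of_ne (hbox.1 ⟨a, ha⟩) (Ne.symm hna)
    -- decrease
    have hcont : Continuous (fun t : ℝ => Θ (Function.update u ⟨a, ha⟩ t) a) :=
      (hΘ a).comp (continuous_const.update _ continuous_id)
    have hev : ∀ᶠ t in 𝓝 (u ⟨a, ha⟩), Θ (Function.update u ⟨a, ha⟩ t) a < 2 * π := by
      refine hcont.continuousAt.eventually_lt continuousAt_const ?_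
      simp only [Function.update_eq_self]
      exact hlt
    have hev2 : ∀ᶠ t in 𝓝 (u ⟨a, ha⟩), -(n:ℝ) < t := eventually_gt_nhds hgt
    have hev3 : ∃ᶠ t in 𝓝 (u ⟨a, ha⟩), t < u ⟨a, ha⟩ := by
      have : (𝓝[<] (u ⟨a, ha⟩)).NeBot := inferInstance
      rw [frequently_iff_neBot]; exact this
    obtain ⟨t, htl, ht1, ht2⟩ := (hev3.and_eventually (hev.and hev2)).exists
    have hle : ∀ i, Function.update u ⟨a, ha⟩ t i ≤ u i := by
      intro i
      by_cases hi : i = ⟨a, ha⟩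
      · rw [hi, Function.update_self]; exact htl.le
      · rw [Function.update_of_ne hi]
    have hexle : ∀ b, ex (Function.update u ⟨a, ha⟩ t) b ≤ ex u b := by
      intro b
      by_cases hb : b ∈ I
      · simp only [ex, hb, dite_true]; exact hle _
      · simp only [ex, hb, dite_false]; exact le_rfl
    have hmem : Function.update u ⟨a, ha⟩ t ∈ C := by
      refine ⟨⟨?_, fun i => (hle i).trans (hbox.2 i)⟩, Set.mem_iInter.2 fun i => ?_⟩
      · intro i
        by_cases hi : i = ⟨a, ha⟩
        · rw [hi, Function.update_self]; exact ht2.le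
        · rw [Function.update_of_ne hi]; exact hbox.1 i
      · by_cases hi : i = ⟨a, ha⟩
        · rw [hi]; exact Or.inr ht1.le
        · rcases hor i with h1 | h1
          · left; change Function.update u ⟨a, ha⟩ t i = n
            rw [Function.update_of_ne hi]; exact h1
          · right
            refine le_trans ?_ h1
            have hsame : ex (Function.update u ⟨a, ha⟩ t) i.1 = ex u i.1 := by
              rw [exi, exi, Function.update_of_ne hi]
            refine Finset.sum_le_sum fun τ hτ => ?_
            rw [Finset.mem_filter] at hτ
            simp only [hτ.2, hsame]
            refine (al_mono_y (exp_pos _) (exp_pos _) (exp_pos _) (exp_le_exp.2 (hexle _))).trans ?_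
            exact al_mono_z (exp_pos _) (exp_pos _) (exp_pos _) (exp_le_exp.2 (hexle _))
    have hm := hmin hmem
    have : ∑ i, Function.update u ⟨a, ha⟩ t i < ∑ i, u i := by
      refine Finset.sum_lt_sum (fun i _ => hle i) ⟨⟨a, ha⟩, Finset.mem_univ _, ?_⟩
      rw [Function.update_self]; exact htl
    exact absurd (hm : ∑ i, u i ≤ _) (not_le.2 this)

omit h in
theorem al_small (η : ℝ) (hη : 0 < η) : ∃ C : ℝ, ∀ x y z : ℝ, y < x - C →
    al (exp x) (exp y) (exp z) < η ∧ al (exp x) (exp z) (exp y) < η := by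
  refine ⟨-(2 * log (η / 2)), fun x y z hxy => ?_⟩
  have key : 2 * √(exp y / exp x) < η := by
    rw [← exp_sub, ← Real.exp_half]
    have : exp ((y - x) / 2) < exp (log (η / 2)) := exp_lt_exp.2 (by linarith)
    rw [exp_log (by positivity)] at this
    linarith
  exact ⟨(al_le (exp_pos _) (exp_pos _) (exp_pos _)).trans_lt key,
    (al_le' (exp_pos _) (exp_pos _) (exp_pos _)).trans_lt key⟩

theorem exists_radii {p q s : ℕ} (ht : (p, q, s) ∈ T) : ∃ r : ℕ → ℝ, (∀ a, 0 < r a) ∧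
    ∀ v ∈ vs T, v ≠ p → v ≠ q → v ≠ s → theta T r v = 2 * π := by
  classical
  let I := (vs T).filter (fun v => v ≠ p ∧ v ≠ q ∧ v ≠ s)
  have hIv : ∀ v ∈ I, v ∈ vs T := fun v hv => (Finset.mem_filter.1 hv).1
  have hpI : p ∉ I := by simp [I]
  have hqI : q ∉ I := by simp [I]
  have hsI : s ∉ I := by simp [I]
  choose w w0 w1 w2 using box_min h I hIv
  let U := (hyperfilter ℕ : Filter ℕ)
  have hat : U ≤ atTop := by
    rw [← Nat.cofinite_eq_atTop]; exact hyperfilter_le_cofinite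
  let th : ℕ → ℕ → ℝ := fun n => theta T (fun a => exp (w n a))
  -- S0
  let S0 := I.filter (fun i => ∀ C : ℝ, ∀ᶠ n in U, w n i < C)
  let S1 := I.filter (fun i => ∀ C : ℝ, ∀ᶠ n in U, C < w n i)
  have n0 : ∀ a, a ∉ S0 → ∃ C : ℝ, ∀ᶠ n in U, C ≤ w n a := by
    intro a ha
    by_cases haI : a ∈ I
    · have : ¬ ∀ C : ℝ, ∀ᶠ n in U, w n a < C := fun h' => ha (Finset.mem_filter.2 ⟨haI, h'⟩)
      push Not at this
      obtain ⟨C, hC⟩ := this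
      refine ⟨C, ?_⟩
      have := (Ultrafilter.eventually_not (f := hyperfilter ℕ)).2 hC
      exact this.mono fun n hn => not_not.1 hn
    · exact ⟨0, Eventually.of_forall fun n => (w0 n a haI).ge⟩
  have n1 : ∀ a, a ∉ S1 → ∃ C : ℝ, ∀ᶠ n in U, w n a ≤ C := by
    intro a ha
    by_cases haI : a ∈ I
    · have : ¬ ∀ C : ℝ, ∀ᶠ n in U, C < w n a := fun h' => ha (Finset.mem_filter.2 ⟨haI, h'⟩)
      push Not at this
      obtain ⟨C, hC⟩ := this
      refine ⟨C, ?_⟩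
      have := (Ultrafilter.eventually_not (f := hyperfilter ℕ)).2 hC
      exact this.mono fun n hn => not_not.1 hn
    · exact ⟨0, Eventually.of_forall fun n => (w0 n a haI).le⟩
  -- ratio claims
  have sm0 : ∀ η > 0, ∀ i ∈ S0, ∀ j, j ∉ S0 → ∀ᶠ n in U, ∀ z,
      al (exp (w n j)) (exp (w n i)) (exp z) < η ∧ al (exp (w n j)) (exp z) (exp (w n i)) < η := by
    intro η hη i hi j hj
    obtain ⟨C, hC⟩ := al_small η hη
    obtain ⟨C', hC'⟩ := n0 j hj
    filter_upwards [hC', (Finset.mem_filter.1 hi).2 (C' - C)] with n h1 h2 z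
    exact hC _ _ _ (by linarith)
  have sm1 : ∀ η > 0, ∀ i ∈ S1, ∀ j, j ∉ S1 → ∀ᶠ n in U, ∀ z,
      al (exp (w n i)) (exp (w n j)) (exp z) < η ∧ al (exp (w n i)) (exp z) (exp (w n j)) < η := by
    intro η hη i hi j hj
    obtain ⟨C, hC⟩ := al_small η hη
    obtain ⟨C', hC'⟩ := n1 j hj
    filter_upwards [hC', (Finset.mem_filter.1 hi).2 (C' + C)] with n h1 h2 z
    exact hC _ _ _ (by linarith)
  have hS0 : S0 = ∅ := by
    by_contra hne
    have hne := Finset.nonempty_iff_ne_empty.2 hne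
    have hcount := tau_ge h (S := S0) (fun v hv => hIv v (Finset.mem_filter.1 hv).1) hne ht
      (fun h' => hpI (Finset.mem_filter.1 h').1) (fun h' => hqI (Finset.mem_filter.1 h').1)
      (fun h' => hsI (Finset.mem_filter.1 h').1)
    have hub : ∀ᶠ n in U, ∀ i ∈ S0, th n i ≤ 2 * π := by
      rw [Filter.eventually_all_finset]
      intro i hi
      filter_upwards [(Finset.mem_filter.1 hi).2 0] with n hn
      rcases w1 n i (Finset.mem_filter.1 hi).1 with h' | h'
      · have : (0:ℝ) ≤ n := Nat.cast_nonneg n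
        linarith
      · exact h'
    let η : ℝ := 1 / (2 * (tau T S0 + 1))
    have hη : 0 < η := by positivity
    have hsm : ∀ᶠ n in U, ∀ i ∈ S0, ∀ j ∈ vs T \ S0, ∀ z,
        al (exp (w n j)) (exp (w n i)) (exp z) < η ∧ al (exp (w n j)) (exp z) (exp (w n i)) < η := by
      rw [Filter.eventually_all_finset]; intro i hi
      rw [Filter.eventually_all_finset]; intro j hj
      exact sm0 η hη i hi j (Finset.mem_sdiff.1 hj).2
    obtain ⟨n, hn1, hn2⟩ := (hub.and hsm).exists
    have e1 := theta_sum3 h (fun a => exp (w n a)) S0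
    have e2 : ∑ v ∈ S0, theta T (fun a => exp (w n a)) v ≤ S0.card * (2 * π) := by
      rw [← nsmul_eq_mul]; exact Finset.sum_le_card_nsmul _ _ _ hn1
    have e3 : (tau T S0 : ℝ) * (π - 2 * η) ≤ ∑ t ∈ T,
      ((if t.1 ∈ S0 then al (exp (w n t.1)) (exp (w n t.2.1)) (exp (w n t.2.2)) else 0) +
       (if t.2.1 ∈ S0 then al (exp (w n t.2.1)) (exp (w n t.2.2)) (exp (w n t.1)) else 0) +
       (if t.2.2 ∈ S0 then al (exp (w n t.2.2)) (exp (w n t.1)) (exp (w n t.2.1)) else 0)) := by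
      have : (tau T S0 : ℝ) * (π - 2 * η) = ∑ t ∈ T, if t.1 ∈ S0 ∨ t.2.1 ∈ S0 ∨ t.2.2 ∈ S0 then (π - 2 * η) else 0 := by
        rw [← Finset.sum_filter, Finset.sum_const, nsmul_eq_mul, tau]
      rw [this]
      refine Finset.sum_le_sum ?_
      rintro ⟨a, b, c⟩ habc
      have hs := al_sum (exp_pos (w n a)) (exp_pos (w n b)) (exp_pos (w n c))
      have va := h.m1 habc
      have vb := h.m2 habc
      have vc := h.m3 habc
      have q1 := al_pos (exp_pos (w n a)) (exp_pos (w n b)) (exp_pos (w n c))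
      have q2 := al_pos (exp_pos (w n b)) (exp_pos (w n c)) (exp_pos (w n a))
      have q3 := al_pos (exp_pos (w n c)) (exp_pos (w n a)) (exp_pos (w n b))
      have k : ∀ i j, i ∈ S0 → j ∈ vs T → j ∉ S0 → ∀ z,
        al (exp (w n j)) (exp (w n i)) (exp z) < η ∧ al (exp (w n j)) (exp z) (exp (w n i)) < η :=
        fun i j hi hj hj' => hn2 i hi j (Finset.mem_sdiff.2 ⟨hj, hj'⟩)
      simp only
      by_cases ha : a ∈ S0 <;> by_cases hb : b ∈ S0 <;> by_cases hc : c ∈ S0 <;>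
        simp only [ha, hb, hc, if_true, if_false, true_or, or_true, or_self]
      · linarith
      · have := (k a c ha vc hc (w n b)).1; linarith
      · have := (k a b ha vb hb (w n c)).2; linarith
      · have := (k a b ha vb hb (w n c)).2; have := (k a c ha vc hc (w n b)).1; linarith
      · have := (k b a hb va ha (w n c)).1; linarith
      · have := (k b a hb va ha (w n c)).1; have := (k b c hb vc hc (w n a)).2; linarith
      · have := (k c a hc va ha (w n b)).2; have := (k c b hc vb hb (w n a)).1; linarith
      · linarith
    have e4 : (tau T S0 : ℝ) * η ≤ 1 / 2 := by
      simp only [η]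
      rw [mul_one_div, div_le_div_iff₀ (by positivity) (by norm_num)]
      linarith
    have e5 : (6 * S0.card + 3 : ℝ) ≤ tau T S0 := by exact_mod_cast hcount
    have := Real.pi_gt_three
    nlinarith
  have hS1 : S1 = ∅ := by
    by_contra hne
    have hne := Finset.nonempty_iff_ne_empty.2 hne
    have hcount := n3_le h (S := S1) (fun v hv => hIv v (Finset.mem_filter.1 hv).1) hne (h.m1 ht)
      (fun h' => hpI (Finset.mem_filter.1 h').1)
    have hub : ∀ᶠ n in U, ∀ i ∈ S1, 2 * π ≤ th n i := by
      rw [Filter.eventually_all_finset]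
      intro i hi
      filter_upwards [(Finset.mem_filter.1 hi).2 0] with n hn
      rcases w2 n i (Finset.mem_filter.1 hi).1 with h' | h'
      · have : (0:ℝ) ≤ n := Nat.cast_nonneg n
        linarith
      · exact h'
    let η : ℝ := 1 / (2 * (T.card + 1))
    have hη : 0 < η := by positivity
    have hsm : ∀ᶠ n in U, ∀ i ∈ S1, ∀ j ∈ vs T \ S1, ∀ z,
        al (exp (w n i)) (exp (w n j)) (exp z) < η ∧ al (exp (w n i)) (exp z) (exp (w n j)) < η := by
      rw [Filter.eventually_all_finset]; intro i hi
      rw [Filter.eventually_all_finset]; intro j hj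
      exact sm1 η hη i hi j (Finset.mem_sdiff.1 hj).2
    obtain ⟨n, hn1, hn2⟩ := (hub.and hsm).exists
    have e1 := theta_sum3 h (fun a => exp (w n a)) S1
    have e2 : S1.card * (2 * π) ≤ ∑ v ∈ S1, theta T (fun a => exp (w n a)) v := by
      rw [← nsmul_eq_mul]; exact Finset.card_nsmul_le_sum _ _ _ hn1
    have e3 : ∑ t ∈ T,
      ((if t.1 ∈ S1 then al (exp (w n t.1)) (exp (w n t.2.1)) (exp (w n t.2.2)) else 0) +
       (if t.2.1 ∈ S1 then al (exp (w n t.2.1)) (exp (w n t.2.2)) (exp (w n t.1)) else 0) +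
       (if t.2.2 ∈ S1 then al (exp (w n t.2.2)) (exp (w n t.1)) (exp (w n t.2.1)) else 0)) ≤
       ((T.filter (fun t => t.1 ∈ S1 ∧ t.2.1 ∈ S1 ∧ t.2.2 ∈ S1)).card : ℝ) * π + T.card * (2 * η) := by
      have : ((T.filter (fun t => t.1 ∈ S1 ∧ t.2.1 ∈ S1 ∧ t.2.2 ∈ S1)).card : ℝ) * π + T.card * (2 * η) =
          ∑ t ∈ T, ((if t.1 ∈ S1 ∧ t.2.1 ∈ S1 ∧ t.2.2 ∈ S1 then π else 0) + 2 * η) := by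
        rw [Finset.sum_add_distrib, ← Finset.sum_filter, Finset.sum_const, nsmul_eq_mul,
          Finset.sum_const, nsmul_eq_mul]
      rw [this]
      refine Finset.sum_le_sum ?_
      rintro ⟨a, b, c⟩ habc
      have hs := al_sum (exp_pos (w n a)) (exp_pos (w n b)) (exp_pos (w n c))
      have va := h.m1 habc
      have vb := h.m2 habc
      have vc := h.m3 habc
      have k : ∀ i j, i ∈ S1 → j ∈ vs T → j ∉ S1 → ∀ z,
        al (exp (w n i)) (exp (w n j)) (exp z) < η ∧ al (exp (w n i)) (exp z) (exp (w n j)) < η :=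
        fun i j hi hj hj' => hn2 i hi j (Finset.mem_sdiff.2 ⟨hj, hj'⟩)
      simp only
      by_cases ha : a ∈ S1 <;> by_cases hb : b ∈ S1 <;> by_cases hc : c ∈ S1 <;>
        simp only [ha, hb, hc, if_true, if_false, and_true, true_and, and_false, false_and]
      · linarith
      · have := (k a c ha vc hc (w n b)).2; have := (k b c hb vc hc (w n a)).1; linarith
      · have := (k a b ha vb hb (w n c)).1; have := (k c b hc vb hb (w n a)).2; linarith
      · have := (k a b ha vb hb (w n c)).1; linarith
      · have := (k b a hb va ha (w n c)).2; have := (k c a hc va ha (w n b)).1; linarith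
      · have := (k b a hb va ha (w n c)).2; linarith
      · have := (k c a hc va ha (w n b)).1; linarith
      · linarith
    have e4 : (T.card : ℝ) * (2 * η) ≤ 1 := by
      simp only [η]
      rw [show (T.card : ℝ) * (2 * (1 / (2 * (T.card + 1)))) = T.card / (T.card + 1) by field_simp,
        div_le_one (by positivity)]
      linarith
    have e5 : ((T.filter (fun t => t.1 ∈ S1 ∧ t.2.1 ∈ S1 ∧ t.2.2 ∈ S1)).card + 6 : ℝ) ≤ 6 * S1.card := by
      exact_mod_cast hcount
    have := Real.pi_gt_three
    nlinarith
  have hall : ∀ᶠ n in U, ∀ i ∈ I, th n i = 2 * π := by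
    rw [Filter.eventually_all_finset]
    intro i hi
    obtain ⟨C0, hC0⟩ := n0 i (by rw [hS0]; simp)
    obtain ⟨C1, hC1⟩ := n1 i (by rw [hS1]; simp)
    have hb : ∀ᶠ n : ℕ in U, max (-C0) C1 < (n:ℝ) :=
      hat (tendsto_natCast_atTop_atTop.eventually_gt_atTop _)
    filter_upwards [hC0, hC1, hb] with n h0 h1 h2
    have h3 := (max_lt_iff.1 h2).1
    have h4 := (max_lt_iff.1 h2).2
    apply le_antisymm
    · exact (w1 n i hi).resolve_left (fun h' => by linarith)
    · exact (w2 n i hi).resolve_left (fun h' => by linarith)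
  obtain ⟨n, hn⟩ := hall.exists
  exact ⟨fun a => exp (w n a), fun a => exp_pos _, fun v hv hp hq hs => hn v
    (Finset.mem_filter.2 ⟨hv, hp, hq, hs⟩)⟩
end
end Koebe


namespace Koebe
set_option linter.unusedSectionVars false
set_option linter.unusedVariables false
open Real Filter Topology

/-- complex ratio -/
noncomputable def rho (x y z : ℝ) : ℂ :=
  (((x + z) / (x + y) : ℝ) : ℂ) * Complex.exp ((al x y z : ℝ) * Complex.I)

theorem cos_al {x y z : ℝ} (hx : 0 < x) (hy : 0 < y) (hz : 0 < z) :
    cos (al x y z) = (x * (x + y + z) - y * z) / ((x + y) * (x + z)) := by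
  unfold al
  rw [Real.cos_two_mul, Real.cos_sq_arctan, Real.sq_sqrt (by positivity)]
  have : (x + y) * (x + z) = x * (x + y + z) + y * z := by ring
  rw [this]
  field_simp
  ring

theorem sin_al {x y z : ℝ} (hx : 0 < x) (hy : 0 < y) (hz : 0 < z) :
    sin (al x y z) = 2 * √(x * y * z * (x + y + z)) / ((x + y) * (x + z)) := by
  unfold al
  set t := √(y * z / (x * (x + y + z))) with ht
  have ht2 : t ^ 2 = y * z / (x * (x + y + z)) := Real.sq_sqrt (by positivity)
  have h1 : sin (2 * arctan t) = 2 * t * cos (arctan t) ^ 2 := by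
    rw [Real.sin_two_mul]
    have : sin (arctan t) = t * cos (arctan t) := by
      have := Real.tan_mul_cos (Real.cos_arctan_pos t).ne'
      rw [Real.tan_arctan] at this
      exact this.symm
    rw [this]; ring
  rw [h1, Real.cos_sq_arctan, ht2]
  have h2 : √(x * y * z * (x + y + z)) = x * (x + y + z) * t := by
    rw [Real.sqrt_eq_iff_mul_self_eq (by positivity) (by positivity)]
    have : x * (x + y + z) * t * (x * (x + y + z) * t) = (x * (x + y + z)) ^ 2 * t ^ 2 := by ring
    rw [this, ht2]
    field_simp
  rw [h2]
  have : (x + y) * (x + z) = x * (x + y + z) + y * z := by ring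
  rw [this]
  field_simp

theorem rho_re {x y z : ℝ} (hx : 0 < x) (hy : 0 < y) (hz : 0 < z) :
    (rho x y z).re = (x * (x + y + z) - y * z) / (x + y) ^ 2 := by
  unfold rho
  rw [Complex.re_ofReal_mul, Complex.exp_ofReal_mul_I_re, cos_al hx hy hz]
  field_simp

theorem rho_im {x y z : ℝ} (hx : 0 < x) (hy : 0 < y) (hz : 0 < z) :
    (rho x y z).im = 2 * √(x * y * z * (x + y + z)) / (x + y) ^ 2 := by
  unfold rho
  rw [Complex.im_ofReal_mul, Complex.exp_ofReal_mul_I_im, sin_al hx hy hz]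
  field_simp

theorem rho_im_pos {x y z : ℝ} (hx : 0 < x) (hy : 0 < y) (hz : 0 < z) : 0 < (rho x y z).im := by
  rw [rho_im hx hy hz]; positivity

theorem rho_norm {x y z : ℝ} (hx : 0 < x) (hy : 0 < y) (hz : 0 < z) :
    ‖rho x y z‖ = (x + z) / (x + y) := by
  unfold rho
  rw [norm_mul, Complex.norm_exp_ofReal_mul_I, mul_one, Complex.norm_real, Real.norm_of_nonneg (by positivity)]

theorem rho_rot {x y z : ℝ} (hx : 0 < x) (hy : 0 < y) (hz : 0 < z) :
    rho y z x * (1 - rho x y z) = 1 := by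
  have e : √(y * z * x * (y + z + x)) = √(x * y * z * (x + y + z)) := by congr 1; ring
  have hs : √(x * y * z * (x + y + z)) ^ 2 = x * y * z * (x + y + z) := Real.sq_sqrt (by positivity)
  apply Complex.ext
  · simp only [Complex.mul_re, Complex.sub_re, Complex.sub_im, Complex.one_re, Complex.one_im,
      rho_re hx hy hz, rho_re hy hz hx, rho_im hx hy hz, rho_im hy hz hx, e]
    generalize √(x * y * z * (x + y + z)) = D at hs
    field_simp
    linear_combination 4 * hs
  · simp only [Complex.mul_im, Complex.sub_re, Complex.sub_im, Complex.one_re, Complex.one_im,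
      rho_re hx hy hz, rho_re hy hz hx, rho_im hx hy hz, rho_im hy hz hx, e]
    field_simp
    ring

/-- cocycles on a cycle -/
theorem cyc_cob {N M : Type*} [Fintype N] [AddCommGroup M] (s : N → N)
    (hs : ∀ A : Set N, (∀ a ∈ A, s a ∈ A) → ∀ a b, a ∈ A → b ∈ A) (f : N → M)
    (hf : ∑ a, f a = 0) : ∃ φ : N → M, ∀ a, φ (s a) = φ a + f a := by
  classical
  rcases isEmpty_or_nonempty N with hN | ⟨⟨a0⟩⟩
  · exact ⟨fun a => 0, fun a => hN.elim a⟩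
  have hsurj : Function.Surjective s := fun b =>
    hs (Set.range s) (fun a _ => ⟨a, rfl⟩) (s a0) b ⟨a0, rfl⟩
  let σ : Equiv.Perm N := Equiv.ofBijective s (Finite.surjective_iff_bijective.1 hsurj)
  have hcyc : σ.IsCycleOn (Finset.univ : Finset N) := by
    refine ⟨by simpa using Set.bijOn_univ.2 σ.bijective, fun a _ b _ => ?_⟩
    refine hs {b | σ.SameCycle a b} ?_ a b (Equiv.Perm.SameCycle.refl _ _)
    intro c hc
    exact Equiv.Perm.sameCycle_apply_right.2 hc
  have hex : ∀ b, ∃ n < Fintype.card N, (σ ^ n) a0 = b := fun b =>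
    hcyc.exists_pow_eq (Finset.mem_univ a0) (Finset.mem_univ b)
  have hbij : Function.Bijective (fun k : Fin (Fintype.card N) => (σ ^ k.1) a0) := by
    rw [Fintype.bijective_iff_surjective_and_card]
    refine ⟨fun b => ?_, by simp⟩
    obtain ⟨n, hn, e⟩ := hex b
    exact ⟨⟨n, hn⟩, e⟩
  choose k hk ek using hex
  have huniq : ∀ n < Fintype.card N, k ((σ ^ n) a0) = n := by
    intro n hn
    have := hbij.1 (a₁ := ⟨k ((σ ^ n) a0), hk _⟩) (a₂ := ⟨n, hn⟩) (ek _)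
    exact congrArg Fin.val this
  refine ⟨fun a => ∑ j ∈ Finset.range (k a), f ((σ ^ j) a0), fun a => ?_⟩
  have e1 : s a = (σ ^ (k a + 1)) a0 := by
    rw [pow_succ', Equiv.Perm.mul_apply, ek]; rfl
  have e2 : ∑ j ∈ Finset.range (k a + 1), f ((σ ^ j) a0) =
      ∑ j ∈ Finset.range (k a), f ((σ ^ j) a0) + f a := by
    rw [Finset.sum_range_succ, ek]
  simp only
  rw [← e2]
  by_cases hlt : k a + 1 < Fintype.card N
  · rw [e1, huniq _ hlt]
  · have heq : k a + 1 = Fintype.card N := le_antisymm (hk a) (not_lt.1 hlt)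
    have hz : ∑ j ∈ Finset.range (k a + 1), f ((σ ^ j) a0) = 0 := by
      rw [heq, ← hf, Finset.sum_range]
      exact hbij.sum_comp f
    rw [hz]
    have : s a = a0 := by
      rw [e1, heq]
      exact hcyc.pow_card_apply (Finset.mem_univ a0)
    rw [this]
    have h0 : k a0 = 0 := by
      have := huniq 0 (Fintype.card_pos_iff.2 ⟨a0⟩)
      simpa using this
    rw [h0]; simp

section
variable {T : Finset (ℕ × ℕ × ℕ)} (h : Sph T)
include h

theorem adj_of_mem13 {a b c : ℕ} (ht : (a, b, c) ∈ T) : Adj T a c :=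
  h.adj_symm ⟨b, h.rot _ _ _ (h.rot _ _ _ ht)⟩

/-- link sums -/
theorem link_sum {M : Type*} [AddCommMonoid M] (v : ℕ) (g : ℕ → M) :
    ∑ t ∈ T.filter (fun t => t.1 = v), g t.2.1 = ∑ t ∈ T.filter (fun t => t.1 = v), g t.2.2 := by
  classical
  let N := (vs T).filter (fun a => Adj T v a)
  have e1 : ∑ t ∈ T.filter (fun t => t.1 = v), g t.2.1 = ∑ a ∈ N, g a := by
    refine Finset.sum_bij (fun t _ => t.2.1) ?_ ?_ ?_ (fun _ _ => rfl)
    · rintro ⟨a, b, c⟩ ht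
      obtain ⟨h1, rfl⟩ := Finset.mem_filter.1 ht
      exact Finset.mem_filter.2 ⟨h.m2 h1, c, h1⟩
    · rintro ⟨a, b, c⟩ ht ⟨a', b', c'⟩ ht' e
      obtain ⟨h1, rfl⟩ := Finset.mem_filter.1 ht
      obtain ⟨h2, e2⟩ := Finset.mem_filter.1 ht'
      simp only at e e2
      subst e e2
      rw [h.uniq _ _ _ _ h1 h2]
    · intro a ha
      obtain ⟨c, hc⟩ := (Finset.mem_filter.1 ha).2
      exact ⟨(v, a, c), Finset.mem_filter.2 ⟨hc, rfl⟩, rfl⟩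
  have e2 : ∑ t ∈ T.filter (fun t => t.1 = v), g t.2.2 = ∑ a ∈ N, g a := by
    refine Finset.sum_bij (fun t _ => t.2.2) ?_ ?_ ?_ (fun _ _ => rfl)
    · rintro ⟨a, b, c⟩ ht
      obtain ⟨h1, rfl⟩ := Finset.mem_filter.1 ht
      exact Finset.mem_filter.2 ⟨h.m3 h1, adj_of_mem13 h h1⟩
    · rintro ⟨a, b, c⟩ ht ⟨a', b', c'⟩ ht' e
      obtain ⟨h1, rfl⟩ := Finset.mem_filter.1 ht
      obtain ⟨h2, e2⟩ := Finset.mem_filter.1 ht'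
      simp only at e e2
      subst e e2
      rw [h.uniq _ _ _ _ (h.rot _ _ _ (h.rot _ _ _ h1)) (h.rot _ _ _ (h.rot _ _ _ h2))]
    · intro a ha
      obtain ⟨c, hc⟩ := h.adj_symm (Finset.mem_filter.1 ha).2
      exact ⟨(v, c, a), Finset.mem_filter.2 ⟨h.rot _ _ _ hc, rfl⟩, rfl⟩
  rw [e1, e2]

/-- local developing map at an interior vertex -/
theorem exists_w (r : ℕ → ℝ) (hr : ∀ a, 0 < r a) (v : ℕ) (hv : theta T r v = 2 * π) :
    ∃ w : ℕ → ℂ, (∀ a, Adj T v a → w a ≠ 0) ∧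
      ∀ a b, (v, a, b) ∈ T → w b = rho (r v) (r a) (r b) * w a := by
  classical
  let N := {a // a ∈ (vs T).filter (fun a => Adj T v a)}
  have hN : ∀ a, Adj T v a → a ∈ (vs T).filter (fun a => Adj T v a) := fun a ha =>
    Finset.mem_filter.2 ⟨h.adj_mem' ha, ha⟩
  have hN' : ∀ a : N, Adj T v a.1 := fun a => (Finset.mem_filter.1 a.2).2
  choose c hc using hN'
  let s : N → N := fun a => ⟨c a, hN _ (adj_of_mem13 h (hc a))⟩
  obtain ⟨φ, hφ⟩ := cyc_cob (M := Real.Angle) s (by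
    intro A hA a b ha
    have := h.link v {x | ∃ hx, (⟨x, hx⟩ : N) ∈ A} (by
      rintro x y ⟨hx, hxA⟩ hxy
      have e : y = c ⟨x, hx⟩ := h.uniq _ _ _ _ hxy (hc ⟨x, hx⟩)
      subst e
      exact ⟨(s ⟨x, hx⟩).2, hA _ hxA⟩) a.1 (c a) b.1 (c b) ⟨a.2, ha⟩ (hc a) (hc b)
    exact this.2) (fun a => ((al (r v) (r a.1) (r (c a)) : ℝ) : Real.Angle)) (by
    have : ∑ a : N, al (r v) (r a.1) (r (c a)) = 2 * π := by
      rw [← hv, theta]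
      refine Finset.sum_bij (fun a _ => (v, a.1, c a)) ?_ ?_ ?_ ?_
      · intro a _; exact Finset.mem_filter.2 ⟨hc a, rfl⟩
      · intro a _ b _ e
        simp only [Prod.mk.injEq] at e
        exact Subtype.ext e.2.1
      · rintro ⟨v', a, b⟩ ht
        obtain ⟨h1, e0⟩ := Finset.mem_filter.1 ht
        simp only at e0
        rw [e0] at h1
        have ha : Adj T v a := ⟨b, h1⟩
        have e1 := h.uniq _ _ _ _ h1 (hc ⟨a, hN _ ha⟩)
        exact ⟨⟨a, hN _ ha⟩, Finset.mem_univ _, by simp only [Prod.mk.injEq]; exact ⟨e0.symm, trivial, e1.symm⟩⟩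
      · intro a _; rfl
    have h2 := congrArg Real.Angle.coeHom this
    rw [map_sum] at h2
    simpa [Real.Angle.coe_two_pi] using h2)
  refine ⟨fun a => if ha : a ∈ (vs T).filter (fun a => Adj T v a) then
    ((r v + r a : ℝ) : ℂ) * ((φ ⟨a, ha⟩).toCircle : ℂ) else 0, ?_, ?_⟩
  · intro a ha
    simp only [hN a ha, dite_true]
    refine mul_ne_zero ?_ (Circle.coe_ne_zero _)
    have := hr v
    have := hr a
    exact Complex.ofReal_ne_zero.2 (by positivity)
  · intro a b hab
    have ha := hN a ⟨b, hab⟩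
    have hb := hN b (adj_of_mem13 h hab)
    have e : b = c ⟨a, ha⟩ := h.uniq _ _ _ _ hab (hc ⟨a, ha⟩)
    have e2 : φ ⟨b, hb⟩ = φ ⟨a, ha⟩ + ((al (r v) (r a) (r b) : ℝ) : Real.Angle) := by
      have := hφ ⟨a, ha⟩
      have e3 : s ⟨a, ha⟩ = ⟨b, hb⟩ := Subtype.ext e.symm
      rw [e3] at this
      rw [this]
      simp only [← e]
    simp only [ha, hb, dite_true]
    rw [e2, Real.Angle.toCircle_add, Real.Angle.toCircle_coe, Circle.coe_mul, Circle.coe_exp]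
    unfold rho
    have := hr v
    have := hr a
    have hne : ((r v : ℂ) + r a) ≠ 0 := by
      rw [← Complex.ofReal_add]; exact Complex.ofReal_ne_zero.2 (by positivity)
    push_cast
    field_simp

end
end Koebe


namespace Koebe
set_option linter.unusedSectionVars false
set_option linter.unusedVariables false
open Real Filter Topology

/-- rotation of a fixed triple -/
def tz (p q s a b c : ℕ) : Prop := (a = p ∧ b = q ∧ c = s) ∨ (a = q ∧ b = s ∧ c = p) ∨ (a = s ∧ b = p ∧ c = q)

theorem tz_rot {p q s a b c : ℕ} (h : tz p q s a b c) : tz p q s b c a := by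
  rcases h with ⟨rfl, rfl, rfl⟩ | ⟨rfl, rfl, rfl⟩ | ⟨rfl, rfl, rfl⟩ <;> simp [tz]

theorem tz_rot' {p q s a b c : ℕ} (h : tz p q s b c a) : tz p q s a b c := tz_rot (tz_rot h)

theorem tz_rot2 {p q s a b c : ℕ} (h : tz q s p a b c) : tz p q s a b c := by
  rcases h with ⟨rfl, rfl, rfl⟩ | ⟨rfl, rfl, rfl⟩ | ⟨rfl, rfl, rfl⟩ <;> simp [tz]

section
variable {T : Finset (ℕ × ℕ × ℕ)} (h : Sph T)
include h

/-- sums over representatives -/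
theorem sum_reps {M : Type*} [AddCommMonoid M] (f : ℕ → ℕ → ℕ → M) :
    ∑ t ∈ T, f t.1 t.2.1 t.2.2 = ∑ t ∈ T.filter (fun t => t.1 < t.2.1 ∧ t.1 < t.2.2),
      (f t.1 t.2.1 t.2.2 + f t.2.1 t.2.2 t.1 + f t.2.2 t.1 t.2.1) := by
  rw [Finset.sum_filter]
  have r1 := h.sum_rot (fun a b c => if c < a ∧ c < b then f a b c else 0)
  have r1' := h.sum_rot (fun a b c => if b < c ∧ b < a then f b c a else 0)
  have r2 := h.sum_rot (fun a b c => if b < c ∧ b < a then f a b c else 0)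
  have r3 := h.sum_rot (fun a b c => if a < b ∧ a < c then f c a b else 0)
  have e : ∀ t ∈ T, f t.1 t.2.1 t.2.2 = (if t.1 < t.2.1 ∧ t.1 < t.2.2 then f t.1 t.2.1 t.2.2 else 0) +
      (if t.2.2 < t.1 ∧ t.2.2 < t.2.1 then f t.1 t.2.1 t.2.2 else 0) +
      (if t.2.1 < t.2.2 ∧ t.2.1 < t.1 then f t.1 t.2.1 t.2.2 else 0) := by
    rintro ⟨a, b, c⟩ ht
    have n1 := h.ne _ _ _ ht
    have n2 := h.ne2 ht
    have n3 := h.ne3 ht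
    simp only
    rcases lt_trichotomy a b with h1 | h1 | h1
    · rcases lt_trichotomy a c with h2 | h2 | h2
      · rw [if_pos ⟨h1, h2⟩, if_neg (by omega), if_neg (by omega)]; simp
      · exact absurd h2.symm n3
      · rw [if_neg (by omega), if_pos (by omega), if_neg (by omega)]; simp
    · exact absurd h1 n1
    · rcases lt_trichotomy b c with h2 | h2 | h2
      · rw [if_neg (by omega), if_neg (by omega), if_pos (by omega)]; simp
      · exact absurd h2 n2
      · rw [if_neg (by omega), if_pos (by omega), if_neg (by omega)]; simp
  rw [Finset.sum_congr rfl e]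
  simp only [Finset.sum_add_distrib]
  have q1 : ∑ t ∈ T, (if t.2.2 < t.1 ∧ t.2.2 < t.2.1 then f t.1 t.2.1 t.2.2 else 0) =
      ∑ t ∈ T, (if t.1 < t.2.1 ∧ t.1 < t.2.2 then f t.2.1 t.2.2 t.1 else 0) := r1
  have q2 : ∑ t ∈ T, (if t.2.1 < t.2.2 ∧ t.2.1 < t.1 then f t.1 t.2.1 t.2.2 else 0) =
      ∑ t ∈ T, (if t.1 < t.2.1 ∧ t.1 < t.2.2 then f t.2.2 t.1 t.2.1 else 0) := r3.symm
  rw [q1, q2, ← Finset.sum_add_distrib, ← Finset.sum_add_distrib]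
  refine Finset.sum_congr rfl fun t _ => ?_
  split_ifs <;> simp

theorem reps_card : 3 * (T.filter (fun t => t.1 < t.2.1 ∧ t.1 < t.2.2)).card = T.card := by
  have := sum_reps h (fun _ _ _ => (1:ℕ))
  simp only [Finset.sum_const, smul_eq_mul, mul_one] at this
  omega

theorem exists_rep {a b c : ℕ} (ht : (a, b, c) ∈ T) (P : ℕ → ℕ → ℕ → Prop)
    (hrot : ∀ a b c, (a, b, c) ∈ T → P a b c → P b c a)
    (hP : ∀ a b c, (a, b, c) ∈ T → a < b → a < c → P a b c) : P a b c := by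
  have n1 := h.ne _ _ _ ht
  have n2 := h.ne2 ht
  have n3 := h.ne3 ht
  have t2 := h.rot _ _ _ ht
  have t3 := h.rot _ _ _ t2
  rcases lt_trichotomy a b with h1 | h1 | h1
  · rcases lt_trichotomy a c with h2 | h2 | h2
    · exact hP _ _ _ ht h1 h2
    · exact absurd h2.symm n3
    · exact hrot _ _ _ t3 (hP _ _ _ t3 h2 (by omega))
  · exact absurd h1 n1
  · rcases lt_trichotomy b c with h2 | h2 | h2
    · exact hrot _ _ _ t3 (hrot _ _ _ t2 (hP _ _ _ t2 h2 h1))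
    · exact absurd h2 n2
    · exact hrot _ _ _ t3 (hP _ _ _ t3 (by omega) h2)

theorem ker_exists_aux {p q s : ℕ} (ht0 : (p, q, s) ∈ T) (hpq : p < q) (hps : p < s)
    (ρ : ℕ → ℕ → ℕ → ℂ) (hρ : ∀ a b c, (a, b, c) ∈ T → ρ b c a * (1 - ρ a b c) = 1)
    (w : ℕ → ℕ → ℂ) (hw0 : ∀ v ∈ vs T, v ≠ p → v ≠ q → v ≠ s → ∀ a, Adj T v a → w v a ≠ 0)
    (hw : ∀ v ∈ vs T, v ≠ p → v ≠ q → v ≠ s → ∀ a b, (v, a, b) ∈ T → w v b = ρ v a b * w v a) :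
    ∃ z : ℕ → ℂ, (∀ a b c, (a, b, c) ∈ T → ¬ tz p q s a b c → z c - z a = ρ a b c * (z b - z a)) ∧
      ∃ a ∈ vs T, ∃ b ∈ vs T, z a ≠ z b := by
  classical
  let I := (vs T).filter (fun v => v ≠ p ∧ v ≠ q ∧ v ≠ s)
  let F := (T.filter (fun t => t.1 < t.2.1 ∧ t.1 < t.2.2)).erase (p, q, s)
  have hI : ∀ v ∈ I, v ∈ vs T ∧ v ≠ p ∧ v ≠ q ∧ v ≠ s := fun v hv => Finset.mem_filter.1 hv
  have hp0 : (p, q, s) ∈ T.filter (fun t => t.1 < t.2.1 ∧ t.1 < t.2.2) :=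
    Finset.mem_filter.2 ⟨ht0, hpq, hps⟩
  have hFT : ∀ t ∈ F, t ∈ T := fun t ht => (Finset.mem_filter.1 (Finset.mem_erase.1 ht).2).1
  -- products of ratios
  have hprod : ∀ a b c, (a, b, c) ∈ T → ρ a b c * ρ b c a * ρ c a b = -1 := by
    intro a b c habc
    have h1 := hρ _ _ _ habc
    have h2 := hρ _ _ _ (h.rot _ _ _ habc)
    have h3 := hρ _ _ _ (h.rot _ _ _ (h.rot _ _ _ habc))
    linear_combination (-ρ c a b) * h1 - h2
  have hρ0 : ∀ a b c, (a, b, c) ∈ T → ρ a b c ≠ 0 := by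
    intro a b c habc h0
    have := hprod _ _ _ habc
    rw [h0] at this
    simp at this
  let C : ℕ → ℕ → ℕ → ℕ → ℂ := fun v a b c =>
    (if a = v then (w v c)⁻¹ else 0) - (if b = v then (w v a)⁻¹ else 0) * ρ b c a
      + (if c = v then (w v b)⁻¹ else 0) * (ρ b c a * ρ c a b)
  let k : ℕ → ℕ → ℕ → ℕ → ℂ := fun a b c x =>
    ((if x = c then 1 else 0) - (if x = a then 1 else 0)) - ρ a b c * ((if x = b then 1 else 0) - (if x = a then 1 else 0))
  let R : Matrix I F ℂ := fun v t => C v.1 t.1.1 t.1.2.1 t.1.2.2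
  let K : Matrix F (vs T) ℂ := fun t x => k t.1.1 t.1.2.1 t.1.2.2 x.1
  have hk1 : ∀ a b c x, (a, b, c) ∈ T → k b c a x = - ρ b c a * k a b c x := by
    intro a b c x habc
    have h1 := hρ _ _ _ habc
    simp only [k]
    generalize (if x = a then (1:ℂ) else 0) = A
    generalize (if x = b then (1:ℂ) else 0) = B
    generalize (if x = c then (1:ℂ) else 0) = D
    linear_combination (B - A) * h1
  have hRK : R * K = 0 := by
    ext v x
    rw [Matrix.mul_apply, Matrix.zero_apply]
    obtain ⟨hv, hvp, hvq, hvs⟩ := hI v.1 v.2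
    have hT : ∑ t ∈ T, (if t.1 = v.1 then (w v.1 t.2.2)⁻¹ * k t.1 t.2.1 t.2.2 x.1 else 0) = 0 := by
      rw [← Finset.sum_filter]
      let g : ℕ → ℂ := fun b => (w v.1 b)⁻¹ * ((if x.1 = b then 1 else 0) - (if x.1 = v.1 then 1 else 0))
      have : ∀ t ∈ T.filter (fun t => t.1 = v.1), (w v.1 t.2.2)⁻¹ * k t.1 t.2.1 t.2.2 x.1 = g t.2.2 - g t.2.1 := by
        rintro ⟨v', a, b⟩ ht
        obtain ⟨h1, e⟩ := Finset.mem_filter.1 ht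
        simp only at e
        subst e
        simp only [k, g]
        rw [hw v.1 hv hvp hvq hvs a b h1]
        have n1 := hw0 v.1 hv hvp hvq hvs a ⟨b, h1⟩
        have n2 := hρ0 _ _ _ h1
        field_simp
      rw [Finset.sum_congr rfl this, Finset.sum_sub_distrib, link_sum h v.1 g, sub_self]
    rw [sum_reps h (fun a b c => if a = v.1 then (w v.1 c)⁻¹ * k a b c x.1 else 0)] at hT
    rw [← Finset.add_sum_erase _ _ hp0] at hT
    simp only [if_neg hvp.symm, if_neg hvq.symm, if_neg hvs.symm, zero_add, add_zero] at hT
    rw [← hT]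
    change _ = ∑ t ∈ F, _
    rw [← Finset.sum_coe_sort F]
    refine Finset.sum_congr rfl fun t _ => ?_
    obtain ⟨⟨a, b, c⟩, ht⟩ := t
    have hm := hFT _ ht
    simp only [R, K, C]
    rw [hk1 _ _ _ _ (h.rot _ _ _ hm), hk1 _ _ _ _ hm]
    split_ifs <;> ring
  have hinj : Function.Injective R.transpose.mulVec := by
    rw [← Matrix.coe_mulVecLin, ← LinearMap.ker_eq_bot, LinearMap.ker_eq_bot']
    intro l hl
    let L : ℕ → ℂ := fun v => if hv : v ∈ I then l ⟨v, hv⟩ else 0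
    have hL : ∀ v : I, L v.1 = l v := fun v => by simp [L]
    have hLp : L p = 0 := by simp [L, I]
    have hLq : L q = 0 := by simp [L, I]
    have hLs : L s = 0 := by simp [L, I]
    have hsum : ∀ f : ℕ → ℂ, ∀ a ∈ vs T, ∑ v : I, (if a = v.1 then f v.1 else 0) * l v = f a * L a := by
      intro f a ha
      by_cases haI : a ∈ I
      · rw [Finset.sum_eq_single ⟨a, haI⟩]
        · simp [L, haI]
        · intro b _ hb
          rw [if_neg (fun e => hb (Subtype.ext e.symm)), zero_mul]
        · intro h'; exact absurd (Finset.mem_univ _) h'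
      · rw [show L a = 0 by simp [L, haI], mul_zero]
        refine Finset.sum_eq_zero fun v _ => ?_
        rw [if_neg (fun e => haI (by rw [e]; exact v.2)), zero_mul]
    have heq : ∀ a b c, (a, b, c) ∈ T → ¬ tz p q s a b c →
        (w a c)⁻¹ * L a - (w b a)⁻¹ * L b * ρ b c a + (w c b)⁻¹ * L c * (ρ b c a * ρ c a b) = 0 := by
      intro a b c habc
      refine exists_rep h habc (fun a b c => ¬ tz p q s a b c →
        (w a c)⁻¹ * L a - (w b a)⁻¹ * L b * ρ b c a + (w c b)⁻¹ * L c * (ρ b c a * ρ c a b) = 0) ?_ ?_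
      · intro a b c habc hP hn
        have h1 := hP (fun h' => hn (tz_rot h'))
        have h2 := hprod _ _ _ habc
        have n2 := hρ0 _ _ _ (h.rot _ _ _ habc)
        refine mul_left_cancel₀ n2 ?_
        rw [mul_zero]
        linear_combination -h1 + (w a c)⁻¹ * L a * h2
      · intro a b c habc h1 h2 hn
        have hF : (a, b, c) ∈ F := by
          refine Finset.mem_erase.2 ⟨fun e => hn ?_, Finset.mem_filter.2 ⟨habc, h1, h2⟩⟩
          simp only [Prod.mk.injEq] at e
          exact Or.inl e
        have := congrFun hl ⟨(a, b, c), hF⟩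
        rw [Matrix.mulVecLin_apply, Matrix.mulVec, dotProduct] at this
        change ∑ v : I, C v.1 a b c * l v = 0 at this
        simp only [C] at this
        rw [← this, ← hsum (fun v => (w v c)⁻¹) a (h.m1 habc), ← hsum (fun v => (w v a)⁻¹) b (h.m2 habc),
          ← hsum (fun v => (w v b)⁻¹) c (h.m3 habc), Finset.sum_mul, Finset.sum_mul, ← Finset.sum_sub_distrib, ← Finset.sum_add_distrib]
        refine Finset.sum_congr rfl fun v _ => ?_
        ring
    have hall := h.dual (fun a b c => L a = 0 ∧ L b = 0 ∧ L c = 0) (fun a b c _ h' => ⟨h'.2.1, h'.2.2, h'.1⟩)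
      (by
        rintro a b c d habc hbad ⟨h1, h2, h3⟩
        refine ⟨h2, h1, ?_⟩
        by_cases hz : tz p q s b a d
        · rcases hz with ⟨-, -, rfl⟩ | ⟨-, -, rfl⟩ | ⟨-, -, rfl⟩ <;> assumption
        · by_cases hdI : d ∈ I
          · have h4 := heq _ _ _ hbad hz
            rw [h1, h2] at h4
            obtain ⟨hv, hvp, hvq, hvs⟩ := hI d hdI
            have n1 := hw0 d hv hvp hvq hvs a (h.adj_symm ⟨b, h.rot _ _ _ hbad⟩)
            have n2 := hρ0 _ _ _ (h.rot _ _ _ hbad)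
            have n3 := hρ0 _ _ _ (h.rot _ _ _ (h.rot _ _ _ hbad))
            simpa [n1, n2, n3] using h4
          · simp [L, hdI])
      ht0 ⟨hLp, hLq, hLs⟩
    ext v
    obtain ⟨b, c, hbc⟩ := mem_vs.1 (hI v.1 v.2).1
    rw [← hL v, Pi.zero_apply]
    exact (hall _ _ _ hbc).1
  -- dimension count
  have hcI : I.card + 3 = (vs T).card := by
    have e : vs T = insert p (insert q (insert s I)) := by
      ext x
      simp only [Finset.mem_insert, I, Finset.mem_filter]
      constructor
      · intro hx
        by_cases h1 : x = p
        · exact Or.inl h1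
        by_cases h2 : x = q
        · exact Or.inr (Or.inl h2)
        by_cases h3 : x = s
        · exact Or.inr (Or.inr (Or.inl h3))
        exact Or.inr (Or.inr (Or.inr ⟨hx, h1, h2, h3⟩))
      · rintro (rfl | rfl | rfl | h')
        · exact h.m1 ht0
        · exact h.m2 ht0
        · exact h.m3 ht0
        · exact h'.1
    rw [e, Finset.card_insert_of_notMem, Finset.card_insert_of_notMem, Finset.card_insert_of_notMem]
    · simp [I]
    · simp only [Finset.mem_insert, not_or]
      exact ⟨h.ne2 ht0, by simp [I]⟩
    · simp only [Finset.mem_insert, not_or]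
      exact ⟨h.ne _ _ _ ht0, (h.ne3 ht0).symm, by simp [I]⟩
  have hcF : F.card + 5 = 2 * (vs T).card := by
    have h1 := reps_card h
    have h2 := h.count
    have h3 := Finset.card_erase_add_one hp0
    have : F.card + 1 = (T.filter (fun t => t.1 < t.2.1 ∧ t.1 < t.2.2)).card := h3
    omega
  have hrR : R.rank = I.card := by
    rw [← Matrix.rank_transpose, Matrix.rank]
    rw [LinearMap.finrank_range_of_inj (by rw [Matrix.coe_mulVecLin]; exact hinj)]
    simp
  have hrk := Matrix.rank_add_rank_le_card_of_mul_eq_zero hRK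
  rw [Fintype.card_coe, hrR] at hrk
  have hrn := LinearMap.finrank_range_add_finrank_ker K.mulVecLin
  rw [show Module.finrank ℂ (LinearMap.range K.mulVecLin) = K.rank from rfl, Module.finrank_pi, Fintype.card_coe] at hrn
  have hker : 2 ≤ Module.finrank ℂ (LinearMap.ker K.mulVecLin) := by omega
  have hne : ∃ z ∈ LinearMap.ker K.mulVecLin, z ∉ Submodule.span ℂ {(fun _ => 1 : vs T → ℂ)} := by
    by_contra hno
    push Not at hno
    have h1 : LinearMap.ker K.mulVecLin ≤ Submodule.span ℂ {(fun _ => 1 : vs T → ℂ)} := hno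
    have h2 := Submodule.finrank_mono h1
    have h3 := finrank_span_le_card (R := ℂ) ({(fun _ => 1 : vs T → ℂ)} : Set (vs T → ℂ))
    simp at h3
    omega
  obtain ⟨z, hz, hzn⟩ := hne
  let Z : ℕ → ℂ := fun v => if hv : v ∈ vs T then z ⟨v, hv⟩ else 0
  have hksum : ∀ a ∈ vs T, ∑ x : vs T, (if x.1 = a then (1:ℂ) else 0) * z x = Z a := by
    intro a ha
    rw [Finset.sum_eq_single ⟨a, ha⟩]
    · simp [Z, ha]
    · intro b _ hb
      rw [if_neg (fun e => hb (Subtype.ext e)), zero_mul]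
    · intro h'; exact absurd (Finset.mem_univ _) h'
  refine ⟨Z, ?_, ?_⟩
  · intro a b c habc
    refine exists_rep h habc (fun a b c => ¬ tz p q s a b c → Z c - Z a = ρ a b c * (Z b - Z a)) ?_ ?_
    · intro a b c habc hP hn
      have h1 := hP (fun h' => hn (tz_rot h'))
      have h2 := hρ _ _ _ habc
      linear_combination (Z b - Z a) * h2 - ρ b c a * h1
    · intro a b c habc h1 h2 hn
      have hF : (a, b, c) ∈ F := by
        refine Finset.mem_erase.2 ⟨fun e => hn ?_, Finset.mem_filter.2 ⟨habc, h1, h2⟩⟩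
        simp only [Prod.mk.injEq] at e
        exact Or.inl e
      have := congrFun (LinearMap.mem_ker.1 hz) ⟨(a, b, c), hF⟩
      rw [Matrix.mulVecLin_apply, Matrix.mulVec, dotProduct] at this
      simp only [K, k, Pi.zero_apply] at this
      rw [← sub_eq_zero, ← this, ← hksum a (h.m1 habc), ← hksum b (h.m2 habc), ← hksum c (h.m3 habc),
        ← Finset.sum_sub_distrib, ← Finset.sum_sub_distrib, Finset.mul_sum, ← Finset.sum_sub_distrib]
      refine Finset.sum_congr rfl fun v _ => ?_
      ring
  · by_contra hno
    push Not at hno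
    apply hzn
    rw [Submodule.mem_span_singleton]
    refine ⟨Z p, ?_⟩
    ext x
    have := hno p (h.m1 ht0) x.1 x.2
    rw [Pi.smul_apply, smul_eq_mul, mul_one, this]
    simp [Z]

theorem ker_exists {p q s : ℕ} (ht0 : (p, q, s) ∈ T)
    (ρ : ℕ → ℕ → ℕ → ℂ) (hρ : ∀ a b c, (a, b, c) ∈ T → ρ b c a * (1 - ρ a b c) = 1)
    (w : ℕ → ℕ → ℂ) (hw0 : ∀ v ∈ vs T, v ≠ p → v ≠ q → v ≠ s → ∀ a, Adj T v a → w v a ≠ 0)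
    (hw : ∀ v ∈ vs T, v ≠ p → v ≠ q → v ≠ s → ∀ a b, (v, a, b) ∈ T → w v b = ρ v a b * w v a) :
    ∃ z : ℕ → ℂ, (∀ a b c, (a, b, c) ∈ T → ¬ tz p q s a b c → z c - z a = ρ a b c * (z b - z a)) ∧
      ∃ a ∈ vs T, ∃ b ∈ vs T, z a ≠ z b := by
  revert hw0 hw
  refine exists_rep h ht0 (fun p q s => 
    (∀ v ∈ vs T, v ≠ p → v ≠ q → v ≠ s → ∀ a, Adj T v a → w v a ≠ 0) → 
    (∀ v ∈ vs T, v ≠ p → v ≠ q → v ≠ s → ∀ a b, (v, a, b) ∈ T → w v b = ρ v a b * w v a) →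
    ∃ z : ℕ → ℂ, (∀ a b c, (a, b, c) ∈ T → ¬ tz p q s a b c → z c - z a = ρ a b c * (z b - z a)) ∧
      ∃ a ∈ vs T, ∃ b ∈ vs T, z a ≠ z b) ?_ ?_
  · intro a b c habc hP h1 h2
    obtain ⟨z, hz, hz'⟩ := hP (fun v hv e1 e2 e3 => h1 v hv e2 e3 e1) (fun v hv e1 e2 e3 => h2 v hv e2 e3 e1)
    refine ⟨z, fun x y t hx hn => hz x y t hx fun h' => hn ?_, hz'⟩
    exact tz_rot2 (tz_rot2 h')
  · intro a b c habc h1 h2 h3 h4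
    exact ker_exists_aux h habc h1 h2 ρ hρ w h3 h4

end
end Koebe


namespace Koebe
set_option linter.unusedSectionVars false
set_option linter.unusedVariables false
open Real Filter Topology

/-- cross product -/
def cr (u w : ℂ) : ℝ := u.re * w.im - u.im * w.re

theorem cr_swap (u w : ℂ) : cr w u = - cr u w := by unfold cr; ring

theorem cr_mul (u w : ℂ) : cr u (w * u) = ‖u‖ ^ 2 * w.im := by
  rw [← Complex.normSq_eq_norm_sq, Complex.normSq_apply]
  unfold cr
  simp only [Complex.mul_re, Complex.mul_im]
  ring

theorem cr_div (u w : ℂ) : cr u w = ‖u‖ ^ 2 * (w / u).im := by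
  by_cases h : u = 0
  · simp [h, cr]
  · rw [← cr_mul, div_mul_cancel₀ _ h]

section
variable {T : Finset (ℕ × ℕ × ℕ)} (h : Sph T)
include h

theorem layout {p q s : ℕ} (ht0 : (p, q, s) ∈ T) (r : ℕ → ℝ) (hr : ∀ a, 0 < r a)
    (hth : ∀ v ∈ vs T, v ≠ p → v ≠ q → v ≠ s → theta T r v = 2 * π) :
    ∃ z : ℕ → ℂ, (∀ a b c, (a, b, c) ∈ T → ¬ tz p q s a b c →
        z c - z a = rho (r a) (r b) (r c) * (z b - z a)) ∧
      ∀ a b, Adj T a b → ‖z b - z a‖ = r a + r b := by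
  classical
  have hw : ∀ v, ∃ w : ℕ → ℂ, v ∈ vs T → v ≠ p → v ≠ q → v ≠ s → (∀ a, Adj T v a → w a ≠ 0) ∧
      ∀ a b, (v, a, b) ∈ T → w b = rho (r v) (r a) (r b) * w a := by
    intro v
    by_cases hv : v ∈ vs T ∧ v ≠ p ∧ v ≠ q ∧ v ≠ s
    · obtain ⟨w, hw⟩ := exists_w h r hr v (hth v hv.1 hv.2.1 hv.2.2.1 hv.2.2.2)
      exact ⟨w, fun _ _ _ _ => hw⟩
    · exact ⟨0, fun h1 h2 h3 h4 => absurd ⟨h1, h2, h3, h4⟩ hv⟩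
  choose w hw using hw
  obtain ⟨z, hz, a0, ha0, b0, hb0, hne⟩ := ker_exists h ht0 (fun a b c => rho (r a) (r b) (r c))
    (fun a b c _ => rho_rot (hr a) (hr b) (hr c)) w (fun v h1 h2 h3 h4 => (hw v h1 h2 h3 h4).1)
    (fun v h1 h2 h3 h4 => (hw v h1 h2 h3 h4).2)
  let sc : ℕ → ℕ → ℝ := fun a b => ‖z b - z a‖ / (r a + r b)
  have scs : ∀ a b, sc a b = sc b a := fun a b => by
    simp only [sc]; rw [norm_sub_rev, add_comm]
  have hsc : ∀ a b c, (a, b, c) ∈ T → ¬ tz p q s a b c → sc a c = sc a b := by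
    intro a b c habc hn
    have := hr a
    have := hr b
    have := hr c
    simp only [sc]
    rw [hz a b c habc hn, norm_mul, rho_norm (hr a) (hr b) (hr c)]
    field_simp
  -- constant at every vertex
  have hvert : ∀ v ∈ vs T, ∃ S, ∀ a, Adj T v a → sc v a = S := by
    intro v hv
    have start : ∃ a0 b0, (v, a0, b0) ∈ T ∧ ∀ a b, (v, a, b) ∈ T → tz p q s v a b → b = a0 := by
      by_cases hz' : ∃ a b, (v, a, b) ∈ T ∧ tz p q s v a b
      · obtain ⟨a, b, hab, ht⟩ := hz'
        obtain ⟨c, hc⟩ := adj_of_mem13 h hab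
        refine ⟨b, c, hc, fun a' b' hab' ht' => ?_⟩
        have n1 := h.ne _ _ _ ht0
        have n2 := h.ne2 ht0
        have n3 := h.ne3 ht0
        rcases ht with ⟨e1, e2, e3⟩ | ⟨e1, e2, e3⟩ | ⟨e1, e2, e3⟩ <;>
          rcases ht' with ⟨f1, f2, f3⟩ | ⟨f1, f2, f3⟩ | ⟨f1, f2, f3⟩ <;> omega
      · obtain ⟨a, b, hab⟩ := mem_vs.1 hv
        exact ⟨a, b, hab, fun a' b' h1 h2 => absurd ⟨a', b', h1, h2⟩ hz'⟩
    obtain ⟨a1, b1, h1, h2⟩ := start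
    refine ⟨sc v a1, fun a ha => ?_⟩
    obtain ⟨b, hb⟩ := ha
    refine h.link v {a | sc v a = sc v a1} ?_ a1 b1 a b rfl h1 hb
    intro a b ha hab
    by_cases ht : tz p q s v a b
    · rw [h2 a b hab ht]; rfl
    · exact (hsc v a b hab ht).trans ha
  obtain ⟨S, hS⟩ := hvert p (h.m1 ht0)
  have hall : ∀ a b, Adj T a b → sc a b = S := by
    intro a b hab
    obtain ⟨c, hc⟩ := hab
    refine h.conn {v | ∀ a, Adj T v a → sc v a = S} ?_ p q s a b c hS ht0 hc b ⟨c, hc⟩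
    intro x y t hx hxy a hya
    obtain ⟨S', hS'⟩ := hvert y (h.m2 hxy)
    rw [hS' a hya, ← hS' x (h.adj_symm ⟨t, hxy⟩), scs]
    exact hx y ⟨t, hxy⟩
  have hS0 : S ≠ 0 := by
    rintro rfl
    apply hne
    have key : ∀ a ∈ vs T, z a = z p := by
      intro a ha
      obtain ⟨b, c, hbc⟩ := mem_vs.1 ha
      refine h.conn {v | z v = z p} ?_ p q s a b c rfl ht0 hbc
      intro x y t hx hxy
      have h1 := hall x y ⟨t, hxy⟩
      have := hr x
      have := hr y
      simp only [sc] at h1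
      rw [div_eq_zero_iff] at h1
      rcases h1 with h1 | h1
      · rw [norm_eq_zero, sub_eq_zero] at h1
        exact h1.trans hx
      · linarith
    rw [key _ ha0, key _ hb0]
  have hSpos : 0 < S := by
    refine lt_of_le_of_ne ?_ (Ne.symm hS0)
    rw [← hall p q ⟨s, ht0⟩]
    have := hr p
    have := hr q
    positivity
  refine ⟨fun a => z a / S, ?_, ?_⟩
  · intro a b c habc hn
    have := hz a b c habc hn
    simp only at this ⊢
    rw [← sub_div, this, ← sub_div]
    ring
  · intro a b hab
    have h1 := hall a b hab
    have := hr a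
    have := hr b
    simp only [sc] at h1
    rw [← sub_div, norm_div, Complex.norm_real, Real.norm_of_nonneg hSpos.le]
    rw [← h1] at hSpos ⊢
    have : ‖z b - z a‖ ≠ 0 := by
      intro e; rw [e] at hSpos; simp at hSpos
    field_simp

end

theorem in_tri {A B P : ℂ} {x y z m : ℝ} (hx : 0 < x) (hm : 0 < m) (hmy : m ≤ y) (hmz : m ≤ z)
    (hA : ‖A‖ = x + y) (hB : ‖B‖ = x + z) (hAB : ‖B - A‖ = y + z) (h0 : 0 < cr A B)
    (h1 : 0 < cr A P) (h2 : 0 < cr P B) (hP : ‖P‖ ^ 2 < x ^ 2 + 2 * x * m) :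
    0 < cr (A - P) (B - P) := by
  have e : cr (A - P) (B - P) = cr A B - cr A P - cr P B := by
    unfold cr; simp only [Complex.sub_re, Complex.sub_im]; ring
  rw [e]
  by_contra hno
  obtain ⟨s, hs⟩ : ∃ s, s = cr P B / cr A B := ⟨_, rfl⟩
  obtain ⟨t, ht⟩ : ∃ t, t = cr A P / cr A B := ⟨_, rfl⟩
  have hs0 : 0 < s := by rw [hs]; positivity
  have ht0 : 0 < t := by rw [ht]; positivity
  have hst : 1 ≤ s + t := by
    rw [hs, ht, ← add_div, le_div_iff₀ h0]; linarith
  have hPre : P.re = s * A.re + t * B.re := by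
    rw [hs, ht]; field_simp; unfold cr; ring
  have hPim : P.im = s * A.im + t * B.im := by
    rw [hs, ht]; field_simp; unfold cr; ring
  have hA2 : A.re ^ 2 + A.im ^ 2 = (x + y) ^ 2 := by
    rw [← hA, ← Complex.normSq_eq_norm_sq, Complex.normSq_apply]; ring
  have hB2 : B.re ^ 2 + B.im ^ 2 = (x + z) ^ 2 := by
    rw [← hB, ← Complex.normSq_eq_norm_sq, Complex.normSq_apply]; ring
  have hAB2 : (B.re - A.re) ^ 2 + (B.im - A.im) ^ 2 = (y + z) ^ 2 := by
    rw [← hAB, ← Complex.normSq_eq_norm_sq, Complex.normSq_apply]; simp only [Complex.sub_re, Complex.sub_im]; ring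
  have hP2 : ‖P‖ ^ 2 = (s + t) ^ 2 * x ^ 2 + 2 * (s + t) * x * (s * y + t * z) + (s * y - t * z) ^ 2 := by
    rw [← Complex.normSq_eq_norm_sq, Complex.normSq_apply, hPre, hPim]
    linear_combination (s ^ 2 + s * t) * hA2 + (t ^ 2 + s * t) * hB2 - s * t * hAB2
  clear hs ht hPre hPim hA2 hB2 hAB2 hA hB hAB h0 h1 h2 e hno
  have k1 : m ≤ s * y + t * z := by
    have q1 : s * m ≤ s * y := by gcongr
    have q2 : t * m ≤ t * z := by gcongr
    have q3 : 1 * m ≤ (s + t) * m := by gcongr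
    linarith
  have k2 : 2 * x * m ≤ 2 * (s + t) * x * (s * y + t * z) := by
    have : 2 * x * m ≤ 2 * x * (s * y + t * z) := by gcongr
    have k3 : 0 ≤ 2 * x * (s * y + t * z) := le_trans (by positivity) this
    have k5 : 1 * (2 * x * (s * y + t * z)) ≤ (s + t) * (2 * x * (s * y + t * z)) := by gcongr
    linarith
  have k4 : x ^ 2 ≤ (s + t) ^ 2 * x ^ 2 := by
    have k5 : 1 ^ 2 * x ^ 2 ≤ (s + t) ^ 2 * x ^ 2 := by gcongr
    linarith
  linarith [sq_nonneg (s * y - t * z)]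

theorem arg_neg_of_cr {u w : ℂ} (hu : u ≠ 0) : Complex.arg (w / u) < 0 ↔ cr u w < 0 := by
  rw [Complex.arg_neg_iff, cr_div]
  have : 0 < ‖u‖ ^ 2 := by positivity
  constructor
  · intro h; nlinarith
  · intro h; by_contra h'; push Not at h'; nlinarith

theorem cr_ne {u w : ℂ} (h : cr u w ≠ 0) : u ≠ 0 ∧ w ≠ 0 := by
  constructor <;> rintro rfl <;> simp [cr] at h

theorem arg_ne_of_cr {u w : ℂ} (h : cr u w ≠ 0) :
    Complex.arg (w / u) ≠ π ∧ Complex.arg (w / u) ≠ 0 := by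
  rw [cr_div] at h
  have : (w / u).im ≠ 0 := fun e => h (by rw [e, mul_zero])
  refine ⟨fun e => this (Complex.arg_eq_pi_iff.1 e).2, fun e => this (Complex.arg_eq_zero_iff.1 e).2⟩

theorem arg_bd {u w : ℂ} (h : cr u w ≠ 0) :
    -π < Complex.arg (w / u) ∧ Complex.arg (w / u) < π :=
  ⟨Complex.neg_pi_lt_arg _, lt_of_le_of_ne (Complex.arg_le_pi _) (arg_ne_of_cr h).1⟩

theorem arg_pos_of_cr {u w : ℂ} (h : cr u w ≠ 0) : 0 < Complex.arg (w / u) ↔ 0 < cr u w := by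
  have h1 := arg_neg_of_cr (w := w) (cr_ne h).1
  have h2 := (arg_ne_of_cr h).2
  constructor
  · intro h3
    refine lt_of_le_of_ne (not_lt.1 fun h4 => ?_) (Ne.symm h)
    linarith [h1.2 h4]
  · intro h3
    refine lt_of_le_of_ne (not_lt.1 fun h4 => ?_) (Ne.symm h2)
    linarith [h1.1 h4]

theorem arg_anti {u w : ℂ} (h : cr u w ≠ 0) : Complex.arg (u / w) = - Complex.arg (w / u) := by
  rw [← inv_div, Complex.arg_inv, if_neg (arg_ne_of_cr h).1]

/-- sum of three arguments -/
theorem arg_sum3 {u v w : ℂ} (h1 : cr u v ≠ 0) (h2 : cr v w ≠ 0) (h3 : cr w u ≠ 0) :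
    ∃ n : ℤ, Complex.arg (v / u) + Complex.arg (w / v) + Complex.arg (u / w) = 2 * π * n ∧ -1 ≤ n ∧ n ≤ 1 := by
  have hu := (cr_ne h1).1
  have hv := (cr_ne h2).1
  have hw := (cr_ne h3).1
  have e : ((Complex.arg (v / u) + Complex.arg (w / v) + Complex.arg (u / w) : ℝ) : Real.Angle) = ((0 : ℝ) : Real.Angle) := by
    rw [Real.Angle.coe_add, Real.Angle.coe_add, ← Complex.arg_mul_coe_angle (div_ne_zero hv hu) (div_ne_zero hw hv),
      ← Complex.arg_mul_coe_angle (mul_ne_zero (div_ne_zero hv hu) (div_ne_zero hw hv)) (div_ne_zero hu hw)]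
    have : v / u * (w / v) * (u / w) = 1 := by field_simp
    rw [this, Complex.arg_one]
  obtain ⟨n, hn⟩ := Real.Angle.angle_eq_iff_two_pi_dvd_sub.1 e
  rw [sub_zero] at hn
  refine ⟨n, hn, ?_, ?_⟩
  · have := (arg_bd h1).1
    have := (arg_bd h2).1
    have := (arg_bd h3).1
    by_contra hc
    have hc : n ≤ -2 := by omega
    have hc : (n : ℝ) ≤ -2 := by exact_mod_cast hc
    nlinarith [Real.pi_pos]
  · have := (arg_bd h1).2
    have := (arg_bd h2).2
    have := (arg_bd h3).2
    by_contra hc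
    have hc : 2 ≤ n := by omega
    have hc : (2 : ℝ) ≤ n := by exact_mod_cast hc
    nlinarith [Real.pi_pos]

section
variable {T : Finset (ℕ × ℕ × ℕ)} (h : Sph T)
include h

theorem degree {p q s : ℕ} (ht0 : (p, q, s) ∈ T) (u : ℕ → ℂ)
    (hgen : ∀ a b, Adj T a b → cr (u a) (u b) ≠ 0)
    (hpos : ∀ a b c, (a, b, c) ∈ T → ¬ tz p q s a b c → 0 < cr (u a) (u b) + cr (u b) (u c) + cr (u c) (u a))
    {a b c a' b' c' : ℕ} (h1 : (a, b, c) ∈ T) (n1 : ¬ tz p q s a b c)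
    (h2 : (a', b', c') ∈ T) (n2 : ¬ tz p q s a' b' c')
    (i1 : 0 < cr (u a) (u b) ∧ 0 < cr (u b) (u c) ∧ 0 < cr (u c) (u a))
    (i2 : 0 < cr (u a') (u b') ∧ 0 < cr (u b') (u c') ∧ 0 < cr (u c') (u a')) : tz a b c a' b' c' := by
  classical
  let A : ℕ → ℕ → ℝ := fun a b => Complex.arg (u b / u a)
  let D : ℕ → ℕ → ℕ → ℝ := fun a b c => A a b + A b c + A c a
  let F := T.filter (fun t => t.1 < t.2.1 ∧ t.1 < t.2.2)
  have g3 : ∀ a b c, (a, b, c) ∈ T → cr (u a) (u b) ≠ 0 ∧ cr (u b) (u c) ≠ 0 ∧ cr (u c) (u a) ≠ 0 :=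
    fun a b c hh => ⟨hgen _ _ ⟨_, hh⟩, hgen _ _ ⟨_, h.rot _ _ _ hh⟩, hgen _ _ ⟨_, h.rot _ _ _ (h.rot _ _ _ hh)⟩⟩
  have hD0 : ∀ a b c, (a, b, c) ∈ T → -(2 * π) ≤ D a b c := by
    intro a b c hh
    obtain ⟨g1, g2, g3⟩ := g3 a b c hh
    obtain ⟨n, hn, hn1, hn2⟩ := arg_sum3 g1 g2 g3
    simp only [D, A]
    rw [hn]
    have : (-1 : ℝ) ≤ n := by exact_mod_cast hn1
    nlinarith [Real.pi_pos]
  have hD1 : ∀ a b c, (a, b, c) ∈ T → ¬ tz p q s a b c → 0 ≤ D a b c := by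
    intro a b c hh hn
    obtain ⟨g1, g2, g3⟩ := g3 a b c hh
    obtain ⟨n, hn', hn1, hn2⟩ := arg_sum3 g1 g2 g3
    by_contra hlt
    simp only [D, A] at hlt
    rw [hn'] at hlt
    have hne : n = -1 := by
      by_contra hne
      have : 0 ≤ n := by omega
      have : (0 : ℝ) ≤ n := by exact_mod_cast this
      exact hlt (by have := Real.pi_pos; positivity)
    rw [hne] at hn'
    push_cast at hn'
    have b1 := (arg_bd g1).1
    have b2 := (arg_bd g2).1
    have b3 := (arg_bd g3).1
    have c1 := (arg_neg_of_cr (w := u b) (cr_ne g1).1).1 (by linarith)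
    have c2 := (arg_neg_of_cr (w := u c) (cr_ne g2).1).1 (by linarith)
    have c3 := (arg_neg_of_cr (w := u a) (cr_ne g3).1).1 (by linarith)
    linarith [hpos a b c hh hn]
  have hD2 : ∀ a b c, (a, b, c) ∈ T → 0 < cr (u a) (u b) ∧ 0 < cr (u b) (u c) ∧ 0 < cr (u c) (u a) →
      2 * π ≤ D a b c := by
    rintro a b c hh ⟨p1, p2, p3⟩
    obtain ⟨g1, g2, g3⟩ := g3 a b c hh
    obtain ⟨n, hn', hn1, hn2⟩ := arg_sum3 g1 g2 g3
    have c1 := (arg_pos_of_cr g1).2 p1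
    have c2 := (arg_pos_of_cr g2).2 p2
    have c3 := (arg_pos_of_cr g3).2 p3
    simp only [D, A]
    rw [hn']
    have : 0 < n := by
      by_contra hc
      have : (n : ℝ) ≤ 0 := by exact_mod_cast (not_lt.1 hc)
      nlinarith [Real.pi_pos]
    have : (1 : ℝ) ≤ n := by exact_mod_cast this
    nlinarith [Real.pi_pos]
  have hsum : ∑ t ∈ F, D t.1 t.2.1 t.2.2 = 0 := by
    have e := sum_reps h (fun a b c => A a b)
    have e1 : ∑ t ∈ F, D t.1 t.2.1 t.2.2 = ∑ t ∈ T, A t.1 t.2.1 := e.symm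
    have e2 : ∑ t ∈ T, A t.1 t.2.1 = ∑ t ∈ T, A t.2.1 t.1 := by
      choose d hd using fun t : T => h.opp t.1.1 t.1.2.1 t.1.2.2 t.2
      refine Finset.sum_bij (fun t ht => (t.2.1, t.1, d ⟨t, ht⟩)) ?_ ?_ ?_ ?_
      · intro t ht; exact hd ⟨t, ht⟩
      · rintro ⟨a, b, c⟩ ht ⟨a', b', c'⟩ ht' e
        simp only [Prod.mk.injEq] at e
        obtain ⟨rfl, rfl, -⟩ := e
        rw [h.uniq _ _ _ _ ht ht']
      · rintro ⟨a, b, c⟩ ht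
        obtain ⟨c', hc'⟩ := h.opp _ _ _ ht
        refine ⟨(b, a, c'), hc', ?_⟩
        simp only [Prod.mk.injEq, true_and]
        exact h.uniq _ _ _ _ (hd ⟨(b, a, c'), hc'⟩) ht
      · rintro ⟨a, b, c⟩ ht; rfl
    have e3 : ∑ t ∈ T, A t.2.1 t.1 = - ∑ t ∈ T, A t.1 t.2.1 := by
      rw [← Finset.sum_neg_distrib]
      refine Finset.sum_congr rfl ?_
      rintro ⟨a, b, c⟩ ht
      exact arg_anti (hgen a b ⟨c, ht⟩)
    linarith
  -- representatives
  have rep : ∀ a b c, (a, b, c) ∈ T → ∃ a' b' c', (a', b', c') ∈ F ∧ tz a b c a' b' c' := by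
    intro a b c habc
    refine exists_rep h habc (fun a b c => ∃ a' b' c', (a', b', c') ∈ F ∧ tz a b c a' b' c') ?_ ?_
    · rintro a b c _ ⟨a', b', c', hF, ht⟩
      exact ⟨a', b', c', hF, tz_rot2 (tz_rot2 ht)⟩
    · intro a b c habc h1 h2
      exact ⟨a, b, c, Finset.mem_filter.2 ⟨habc, h1, h2⟩, Or.inl ⟨rfl, rfl, rfl⟩⟩
  by_contra hno
  obtain ⟨x0, y0, z0, hF0, e0⟩ := rep p q s ht0
  obtain ⟨x1, y1, z1, hF1, e1⟩ := rep a b c h1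
  obtain ⟨x2, y2, z2, hF2, e2⟩ := rep a' b' c' h2
  have tz_tr : ∀ {a b c x y z x' y' z' : ℕ}, tz a b c x y z → tz x' y' z' x y z → tz a b c x' y' z' := by
    intro a b c x y z x' y' z' k1 k2
    rcases k1 with ⟨rfl, rfl, rfl⟩ | ⟨rfl, rfl, rfl⟩ | ⟨rfl, rfl, rfl⟩ <;>
      rcases k2 with ⟨rfl, rfl, rfl⟩ | ⟨rfl, rfl, rfl⟩ | ⟨rfl, rfl, rfl⟩ <;> simp [tz]
  have inv : ∀ {a b c x y z : ℕ}, tz a b c x y z → 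
      (0 < cr (u a) (u b) ∧ 0 < cr (u b) (u c) ∧ 0 < cr (u c) (u a)) →
      (0 < cr (u x) (u y) ∧ 0 < cr (u y) (u z) ∧ 0 < cr (u z) (u x)) := by
    intro a b c x y z k1 k2
    rcases k1 with ⟨rfl, rfl, rfl⟩ | ⟨rfl, rfl, rfl⟩ | ⟨rfl, rfl, rfl⟩
    · exact k2
    · exact ⟨k2.2.1, k2.2.2, k2.1⟩
    · exact ⟨k2.2.2, k2.1, k2.2.1⟩
  have d1 := hD2 x1 y1 z1 (Finset.mem_filter.1 hF1).1 (inv e1 i1)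
  have d2 := hD2 x2 y2 z2 (Finset.mem_filter.1 hF2).1 (inv e2 i2)
  have d0 := hD0 x0 y0 z0 (Finset.mem_filter.1 hF0).1
  have ne01 : (x1, y1, z1) ≠ (x0, y0, z0) := by
    intro e; simp only [Prod.mk.injEq] at e
    obtain ⟨rfl, rfl, rfl⟩ := e
    exact n1 (tz_tr e0 e1)
  have ne02 : (x2, y2, z2) ≠ (x0, y0, z0) := by
    intro e; simp only [Prod.mk.injEq] at e
    obtain ⟨rfl, rfl, rfl⟩ := e
    exact n2 (tz_tr e0 e2)
  have ne12 : (x2, y2, z2) ≠ (x1, y1, z1) := by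
    intro e; simp only [Prod.mk.injEq] at e
    obtain ⟨rfl, rfl, rfl⟩ := e
    exact hno (tz_tr e1 e2)
  have m1 : (x1, y1, z1) ∈ F.erase (x0, y0, z0) := Finset.mem_erase.2 ⟨ne01, hF1⟩
  have m2 : (x2, y2, z2) ∈ (F.erase (x0, y0, z0)).erase (x1, y1, z1) :=
    Finset.mem_erase.2 ⟨ne12, Finset.mem_erase.2 ⟨ne02, hF2⟩⟩
  have rest : 0 ≤ ∑ t ∈ ((F.erase (x0, y0, z0)).erase (x1, y1, z1)).erase (x2, y2, z2), D t.1 t.2.1 t.2.2 := by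
    refine Finset.sum_nonneg ?_
    rintro ⟨x, y, z⟩ ht
    have hm := (Finset.mem_erase.1 (Finset.mem_erase.1 (Finset.mem_erase.1 ht).2).2)
    have hmT := Finset.mem_filter.1 hm.2
    refine hD1 _ _ _ hmT.1 fun htz => hm.1 ?_
    change tz p q s x y z at htz
    have l0 := (Finset.mem_filter.1 hF0).2
    have l1 := hmT.2
    simp only at l0 l1
    simp only [Prod.mk.injEq]
    rcases htz with ⟨f1, f2, f3⟩ | ⟨f1, f2, f3⟩ | ⟨f1, f2, f3⟩ <;>
      rcases e0 with ⟨g1, g2, g3⟩ | ⟨g1, g2, g3⟩ | ⟨g1, g2, g3⟩ <;> omega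
  rw [← Finset.add_sum_erase _ _ hF0, ← Finset.add_sum_erase _ _ m1, ← Finset.add_sum_erase _ _ m2] at hsum
  simp only at hsum
  linarith [Real.pi_pos]

end
end Koebe


namespace Koebe
set_option linter.unusedSectionVars false
set_option linter.unusedVariables false
open Real Filter Topology

theorem al_lt {x y z : ℝ} : al x y z < π := by
  unfold al
  have := Real.arctan_lt_pi_div_two (√(y * z / (x * (x + y + z))))
  linarith

theorem rho_arg {x y z : ℝ} (hx : 0 < x) (hy : 0 < y) (hz : 0 < z) :
    Complex.arg (rho x y z) = al x y z := by
  unfold rho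
  rw [Complex.arg_real_mul _ (by positivity), Complex.arg_exp_mul_I, toIocMod_eq_self]
  have h1 := al_pos hx hy hz
  have h2 := al_lt (x := x) (y := y) (z := z)
  have := Real.pi_pos
  constructor <;> linarith

section
variable {T : Finset (ℕ × ℕ × ℕ)} (h : Sph T)
include h

theorem cone {v : ℕ} (hv : v ∈ vs T) (r : ℕ → ℝ) (hr : ∀ a, 0 < r a) (hth : theta T r v = 2 * π)
    (g : ℕ → ℂ) (hg : ∀ a b, (v, a, b) ∈ T → g b = rho (r v) (r a) (r b) * g a)
    (P : ℂ) (hP : ∀ a, Adj T v a → cr P (g a) ≠ 0) :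
    ∃ a b, (v, a, b) ∈ T ∧ 0 < cr (g a) P ∧ 0 < cr P (g b) := by
  by_contra hno
  push Not at hno
  let B : ℕ → ℝ := fun a => Complex.arg (g a / P)
  have hneg : ∀ a, Adj T v a → (B a < 0 ↔ cr P (g a) < 0) := fun a ha => arg_neg_of_cr (cr_ne (hP a ha)).1
  have hpos : ∀ a, Adj T v a → (0 < B a ↔ 0 < cr P (g a)) := fun a ha => arg_pos_of_cr (hP a ha)
  have hB0 : ∀ a, Adj T v a → B a ≠ 0 := fun a ha => (arg_ne_of_cr (hP a ha)).2
  have hbd : ∀ a, Adj T v a → -π < B a ∧ B a < π := fun a ha => arg_bd (hP a ha)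
  -- closed
  have hcl : ∀ a b, B a < 0 → (v, a, b) ∈ T → B b < 0 := by
    intro a b ha hab
    have h1 : Adj T v a := ⟨b, hab⟩
    have h2 : Adj T v b := adj_of_mem13 h hab
    have h3 := hno a b hab (by rw [cr_swap]; linarith [(hneg a h1).1 ha])
    exact (hneg b h2).2 (lt_of_le_of_ne h3 (hP b h2))
  have hback : ∀ a b, (v, a, b) ∈ T → B b < 0 → B a < 0 := by
    intro a b hab hb
    obtain ⟨c, hc⟩ := adj_of_mem13 h hab
    exact h.link v {x | B x < 0} (fun x y hx hxy => hcl x y hx hxy) b c a b hb hc hab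
  have hstep : ∀ a b, (v, a, b) ∈ T → al (r v) (r a) (r b) = B b - B a := by
    intro a b hab
    have h1 : Adj T v a := ⟨b, hab⟩
    have h2 : Adj T v b := adj_of_mem13 h hab
    have a1 := al_pos (hr v) (hr a) (hr b)
    have a2 := al_lt (x := r v) (y := r a) (z := r b)
    have ar := rho_arg (hr v) (hr a) (hr b)
    have ρ0 : rho (r v) (r a) (r b) ≠ 0 := by
      intro e
      have := rho_im_pos (hr v) (hr a) (hr b)
      rw [e] at this; simp at this
    have q1 : g a / P ≠ 0 := div_ne_zero (cr_ne (hP a h1)).2 (cr_ne (hP a h1)).1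
    have q2 : g b / P ≠ 0 := div_ne_zero (cr_ne (hP b h2)).2 (cr_ne (hP b h2)).1
    have e : g b / P = rho (r v) (r a) (r b) * (g a / P) := by rw [hg a b hab]; ring
    by_cases ha : B a < 0
    · have := (Complex.arg_mul_eq_add_arg_iff ρ0 q1).2 (by
        rw [ar]
        have := (hbd a h1).1
        constructor
        · change -π < _ + B a; linarith
        · change _ + B a ≤ π; linarith)
      rw [← e, ar] at this
      change B b = _ + B a at this
      linarith
    · have hb : 0 < B b := by
        refine lt_of_le_of_ne (not_lt.1 fun h' => ha (hback a b hab h')) (Ne.symm (hB0 b h2))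
      have e2 : g a / P = (rho (r v) (r a) (r b))⁻¹ * (g b / P) := by rw [e]; field_simp
      have ai : Complex.arg (rho (r v) (r a) (r b))⁻¹ = - al (r v) (r a) (r b) := by
        rw [Complex.arg_inv, ar, if_neg (by linarith)]
      have := (Complex.arg_mul_eq_add_arg_iff (inv_ne_zero ρ0) q2).2 (by
        rw [ai]
        have := (hbd b h2).2
        constructor
        · change -π < _ + B b; linarith
        · change _ + B b ≤ π; linarith)
      rw [← e2, ai] at this
      change B a = _ + B b at this
      linarith
  have hsum : theta T r v = 0 := by
    unfold theta
    have : ∀ t ∈ T.filter (fun t => t.1 = v), al (r t.1) (r t.2.1) (r t.2.2) = B t.2.2 - B t.2.1 := by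
      rintro ⟨v', a, b⟩ ht
      obtain ⟨h1, e⟩ := Finset.mem_filter.1 ht
      simp only at e
      rw [e] at h1 ⊢
      exact hstep a b h1
    rw [Finset.sum_congr rfl this, Finset.sum_sub_distrib, link_sum h v B, sub_self]
  rw [hth] at hsum
  linarith [Real.pi_pos]

omit h in
theorem line_dense {a b : ℂ} (hab : a ≠ b) : IsOpen {x : ℂ | cr (a - x) (b - x) ≠ 0} ∧
    Dense {x : ℂ | cr (a - x) (b - x) ≠ 0} := by
  have hc : Continuous (fun x : ℂ => cr (a - x) (b - x)) := by
    unfold cr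
    simp only [Complex.sub_re, Complex.sub_im]
    have := Complex.continuous_re
    have := Complex.continuous_im
    fun_prop
  refine ⟨isOpen_ne_fun hc continuous_const, ?_⟩
  intro x
  rw [Metric.mem_closure_iff]
  intro ε hε
  by_cases hx : cr (a - x) (b - x) = 0
  · have hn : 0 < ‖b - a‖ := norm_pos_iff.2 (sub_ne_zero.2 (Ne.symm hab))
    refine ⟨x + ((ε / 2 / ‖b - a‖ : ℝ) : ℂ) * (Complex.I * (b - a)), ?_, ?_⟩
    · have e : cr (a - (x + ((ε / 2 / ‖b - a‖ : ℝ) : ℂ) * (Complex.I * (b - a)))) (b - (x + ((ε / 2 / ‖b - a‖ : ℝ) : ℂ) * (Complex.I * (b - a)))) = cr (a - x) (b - x) - (ε / 2 / ‖b - a‖) * ‖b - a‖ ^ 2 * (-1) ∨ 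
         cr (a - (x + ((ε / 2 / ‖b - a‖ : ℝ) : ℂ) * (Complex.I * (b - a)))) (b - (x + ((ε / 2 / ‖b - a‖ : ℝ) : ℂ) * (Complex.I * (b - a)))) = cr (a - x) (b - x) - (ε / 2 / ‖b - a‖) * ‖b - a‖ ^ 2 := by
        generalize ε / 2 / ‖b - a‖ = k
        rw [← Complex.normSq_eq_norm_sq, Complex.normSq_apply]
        unfold cr
        simp only [Complex.sub_re, Complex.sub_im, Complex.add_re, Complex.add_im, Complex.re_ofReal_mul, Complex.im_ofReal_mul, Complex.I_mul_re, Complex.I_mul_im]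
        left; ring
      have hk : 0 < (ε / 2 / ‖b - a‖) * ‖b - a‖ ^ 2 := by positivity
      rw [hx] at e
      intro h'
      rw [h'] at e
      rcases e with e | e <;> linarith
    · rw [dist_eq_norm, show x - (x + ((ε / 2 / ‖b - a‖ : ℝ) : ℂ) * (Complex.I * (b - a))) = - (((ε / 2 / ‖b - a‖ : ℝ) : ℂ) * (Complex.I * (b - a))) by ring, norm_neg, norm_mul, norm_mul, Complex.norm_I, one_mul, Complex.norm_real, Real.norm_of_nonneg (by positivity)]
      field_simp
      linarith
  · exact ⟨x, hx, by simpa using hε⟩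

theorem packing {p q s : ℕ} (ht0 : (p, q, s) ∈ T) : ∃ (z : ℕ → ℂ) (r : ℕ → ℝ), (∀ a, 0 < r a) ∧
    ∀ u ∈ vs T, ∀ v ∈ vs T, u ≠ p → u ≠ q → u ≠ s → v ≠ p → v ≠ q → v ≠ s → u ≠ v →
      (Adj T u v → ‖z v - z u‖ = r u + r v) ∧ (¬ Adj T u v → r u + r v < ‖z v - z u‖) := by
  classical
  obtain ⟨r, hr, hth⟩ := exists_radii h ht0
  obtain ⟨z, hz, hzr⟩ := layout h ht0 r hr hth
  refine ⟨z, r, hr, ?_⟩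
  intro u hu v hv hup huq hus hvp hvq hvs huv
  refine ⟨hzr u v, fun hadj => ?_⟩
  by_contra hle
  push Not at hle
  -- lower bound of the radii
  obtain ⟨m, hm, hmr⟩ : ∃ m : ℝ, 0 < m ∧ ∀ a ∈ vs T, m ≤ r a := by
    obtain ⟨a, ha, hmin⟩ := (vs T).exists_min_image r ⟨u, hu⟩
    exact ⟨r a, hr a, hmin⟩
  let U : Set ℂ := {x | ‖x - z u‖ ^ 2 < r u ^ 2 + 2 * r u * m} ∩ {x | ‖x - z v‖ ^ 2 < r v ^ 2 + 2 * r v * m}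
  have hUo : IsOpen U := by
    refine IsOpen.inter ?_ ?_
    · exact isOpen_lt (f := fun x : ℂ => ‖x - z u‖ ^ 2) (g := fun _ => r u ^ 2 + 2 * r u * m) (by fun_prop) (by fun_prop)
    · exact isOpen_lt (f := fun x : ℂ => ‖x - z v‖ ^ 2) (g := fun _ => r v ^ 2 + 2 * r v * m) (by fun_prop) (by fun_prop)
  have hru := hr u
  have hrv := hr v
  have hUn : U.Nonempty := by
    let k : ℝ := r u / (r u + r v)
    have hk : 0 ≤ k := by positivity
    have hk1 : k * ‖z v - z u‖ ≤ r u := by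
      calc k * ‖z v - z u‖ ≤ k * (r u + r v) := by gcongr
        _ = r u := by simp only [k]; field_simp
    have hk2 : (1 - k) * ‖z v - z u‖ ≤ r v := by
      have e : 1 - k = r v / (r u + r v) := by simp only [k]; field_simp; ring
      rw [e]
      calc r v / (r u + r v) * ‖z v - z u‖ ≤ r v / (r u + r v) * (r u + r v) := by gcongr
        _ = r v := by field_simp
    have hk3 : 0 ≤ 1 - k := by
      have e : 1 - k = r v / (r u + r v) := by simp only [k]; field_simp; ring
      rw [e]; positivity
    refine ⟨z u + (k : ℂ) * (z v - z u), ?_, ?_⟩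
    · change ‖_‖ ^ 2 < _
      rw [add_sub_cancel_left, norm_mul, Complex.norm_real, Real.norm_of_nonneg hk]
      have : (k * ‖z v - z u‖) ^ 2 ≤ r u ^ 2 := by gcongr
      have : 0 < 2 * r u * m := by positivity
      linarith
    · change ‖_‖ ^ 2 < _
      rw [show z u + (k : ℂ) * (z v - z u) - z v = -(((1 - k : ℝ) : ℂ) * (z v - z u)) by push_cast; ring,
        norm_neg, norm_mul, Complex.norm_real, Real.norm_of_nonneg hk3]
      have : ((1 - k) * ‖z v - z u‖) ^ 2 ≤ r v ^ 2 := by gcongr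
      have : 0 < 2 * r v * m := by positivity
      linarith
  have hdist : ∀ a b, Adj T a b → z a ≠ z b := by
    intro a b hab e
    have := hzr a b hab
    rw [e, sub_self, norm_zero] at this
    linarith [hr a, hr b]
  have hdense : Dense (⋂ t : {t // t ∈ T}, {x : ℂ | cr (z t.1.1 - x) (z t.1.2.1 - x) ≠ 0}) := by
    refine dense_iInter_of_isOpen (fun t => (line_dense (hdist _ _ ⟨t.1.2.2, t.2⟩)).1)
      (fun t => (line_dense (hdist _ _ ⟨t.1.2.2, t.2⟩)).2)
  obtain ⟨x, hxU, hxg⟩ := hdense.inter_open_nonempty U hUo hUn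
  have hgen : ∀ a b, Adj T a b → cr (z a - x) (z b - x) ≠ 0 := by
    rintro a b ⟨c, hc⟩
    exact Set.mem_iInter.1 hxg ⟨(a, b, c), hc⟩
  have hnt : ∀ w a b, w ≠ p → w ≠ q → w ≠ s → ¬ tz p q s w a b := by
    rintro w a b h1 h2 h3 (h' | h' | h')
    · exact h1 h'.1
    · exact h2 h'.1
    · exact h3 h'.1
  have crs : ∀ a b c, cr (z a - x) (z b - x) + cr (z b - x) (z c - x) + cr (z c - x) (z a - x) =
      cr (z b - z a) (z c - z a) := by
    intro a b c
    unfold cr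
    simp only [Complex.sub_re, Complex.sub_im]
    ring
  have hor : ∀ a b c, (a, b, c) ∈ T → ¬ tz p q s a b c → 0 < cr (z b - z a) (z c - z a) := by
    intro a b c habc hn
    rw [hz a b c habc hn, cr_mul, hzr a b ⟨c, habc⟩]
    have := rho_im_pos (hr a) (hr b) (hr c)
    have := hr a
    have := hr b
    positivity
  have find : ∀ w ∈ vs T, w ≠ p → w ≠ q → w ≠ s → ‖x - z w‖ ^ 2 < r w ^ 2 + 2 * r w * m →
      ∃ a b, (w, a, b) ∈ T ∧ 0 < cr (z w - x) (z a - x) ∧ 0 < cr (z a - x) (z b - x) ∧ 0 < cr (z b - x) (z w - x) := by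
    intro w hw h1 h2 h3 hx
    have i1 : ∀ a, cr (x - z w) (z a - z w) = - cr (z w - x) (z a - x) := by
      intro a; unfold cr; simp only [Complex.sub_re, Complex.sub_im]; ring
    obtain ⟨a, b, hab, c1, c2⟩ := cone h hw r hr (hth w hw h1 h2 h3) (fun a => z a - z w)
      (fun a b hab => hz w a b hab (hnt w a b h1 h2 h3)) (x - z w) (fun a ha => by
        rw [i1]; exact neg_ne_zero.2 (hgen w a ha))
    have hin := in_tri (A := z a - z w) (B := z b - z w) (P := x - z w) (hr w) hm (hmr a (h.m2 hab)) (hmr b (h.m3 hab))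
      (hzr w a ⟨b, hab⟩) (hzr w b (adj_of_mem13 h hab))
      (by rw [sub_sub_sub_cancel_right]; exact hzr a b ⟨w, h.rot _ _ _ hab⟩)
      (hor w a b hab (hnt w a b h1 h2 h3)) c1 c2 hx
    rw [sub_sub_sub_cancel_right, sub_sub_sub_cancel_right] at hin
    refine ⟨a, b, hab, ?_, hin, ?_⟩
    · rw [cr_swap, i1] at c1; linarith
    · rw [i1, ← cr_swap] at c2; exact c2
  obtain ⟨a, b, hab, i1⟩ := find u hu hup huq hus hxU.1
  obtain ⟨c, d, hcd, i2⟩ := find v hv hvp hvq hvs hxU.2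
  have := degree h ht0 (fun a => z a - x) hgen (fun a b c habc hn => by
    rw [crs]; exact hor a b c habc hn) hab (hnt u a b hup huq hus) hcd (hnt v c d hvp hvq hvs) i1 i2
  rcases this with h' | h' | h'
  · exact huv h'.1.symm
  · exact hadj (h'.1 ▸ ⟨b, hab⟩)
  · exact hadj (h'.1 ▸ adj_of_mem13 h hab)

end
end Koebe


namespace Koebe
theorem dist_conv (a b : ℂ) : dist (!₂[a.re, a.im] : EuclideanSpace ℝ (Fin 2)) !₂[b.re, b.im] = ‖b - a‖ := by
  rw [EuclideanSpace.dist_eq, Fin.sum_univ_two, ← dist_eq_norm, dist_comm, Complex.dist_eq_re_im]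
  simp [Real.dist_eq, sq_abs]
  ring_nf

theorem main {V : Type*} [Fintype V] (G : SimpleGraph V)
    (hplanar : Nonempty (ProperDrawing G)) :
    ∃ (z : V → EuclideanSpace ℝ (Fin 2)) (r : V → ℝ),
      (∀ v, 0 < r v) ∧
      ∀ u v, u ≠ v →
        r u + r v ≤ dist (z u) (z v) ∧
        (dist (z u) (z v) = r u + r v ↔ G.Adj u v) := by
  obtain ⟨D⟩ := hplanar
  obtain ⟨T, β, hSt⟩ := drawing_St D
  obtain ⟨T', φ, p, q, s, h, hφ, hmem, hadj, ht0, hne⟩ := St.final hSt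
  obtain ⟨z, r, hr, hp⟩ := packing h ht0
  refine ⟨fun v => !₂[(z (φ v)).re, (z (φ v)).im], fun v => r (φ v), fun v => hr _, ?_⟩
  intro u v huv
  rw [dist_conv]
  obtain ⟨h1, h2⟩ := hp (φ u) (hmem u) (φ v) (hmem v) (hne u).1 (hne u).2.1 (hne u).2.2 (hne v).1
    (hne v).2.1 (hne v).2.2 (fun e => huv (hφ e))
  rw [hadj] at h1 h2
  by_cases hG : G.Adj u v
  · exact ⟨(h1 hG).ge, fun _ => hG, fun _ => h1 hG⟩
  · exact ⟨(h2 hG).le, fun e => absurd e (h2 hG).ne', fun h' => absurd h' hG⟩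
end Koebe

/-- **Koebe's circle packing theorem**: every finite simple planar graph is the
tangency graph of a circle packing. -/
theorem koebe_circle_packing {V : Type*} [Fintype V] (G : SimpleGraph V)
    (hplanar : Nonempty (ProperDrawing G)) :
    ∃ (z : V → EuclideanSpace ℝ (Fin 2)) (r : V → ℝ),
      (∀ v, 0 < r v) ∧
      ∀ u v, u ≠ v →
        r u + r v ≤ dist (z u) (z v) ∧
        (dist (z u) (z v) = r u + r v ↔ G.Adj u v) := by
  exact Koebe.main G hplanar
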